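/- Let E be a Banach space, let 𝔐 be an R-admissible weight matrix, let U ⊆ E be open, and let j be a positive integer. If f : U → ℂ is a function such that f^j and f^{j+1} belong to the Roumieu class E^{{𝔐}}(U), then f belongs to E^{{𝔐}}(U). -/

import Mathlib

open Set Filter Topology Metric
open scoped ENNReal NNReal Topology

noncomputable section

namespace JorisPaper

/-- The sequence `m` with `m_k = M_k / k!`. -/
def lc (M : ℕ → ℝ) (k : ℕ) : ℝ := M k / (Nat.factorial k : ℝ)

/-- A weight sequence: positive, log-convex, `M_0 = 1 ≤ M_1`, `M_k^{1/k} → ∞`. -/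
structure IsWeightSeq (M : ℕ → ℝ) : Prop where
  pos : ∀ k, 0 < M k
  first : M 0 = 1
  one_le : 1 ≤ M 1
  logconvex : ∀ k, 1 ≤ k → M k ^ 2 ≤ M (k - 1) * M (k + 1)
  root : Filter.Tendsto (fun k : ℕ => M k ^ ((1 : ℝ) / (k : ℝ))) atTop atTop

/-- `m_k^{1/k} → ∞`. -/
def RootsTendsto (m : ℕ → ℝ) : Prop :=
  Filter.Tendsto (fun k : ℕ => m k ^ ((1 : ℝ) / (k : ℝ))) atTop atTop

/-- `h_m(t) = inf_k m_k t^k` for `t > 0`, and `0` for `t ≤ 0`. -/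
def hfn (m : ℕ → ℝ) (t : ℝ) : ℝ := if t ≤ 0 then 0 else ⨅ k : ℕ, m k * t ^ k

/-- `Γ̄_m(t) = min {k | h_m(t) = m_k t^k}`. -/
def GammaUpper (m : ℕ → ℝ) (t : ℝ) : ℕ := sInf {k : ℕ | hfn m t = m k * t ^ k}

/-- `Γ̲_m(t) = min {k | m_{k+1}/m_k ≥ 1/t}`. -/
def GammaLower (m : ℕ → ℝ) (t : ℝ) : ℕ := sInf {k : ℕ | 1 / t ≤ m (k + 1) / m k}

/-- `mg(M,N) = sup_{j+k ≥ 1} (M_{j+k}/(N_j N_k))^{1/(j+k)}`, as an extended real. -/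
def mg (M N : ℕ → ℝ) : ℝ≥0∞ :=
  ⨆ (j : ℕ) (k : ℕ) (_ : 1 ≤ j + k),
    ENNReal.ofReal ((M (j + k) / (N j * N k)) ^ (((j : ℝ) + (k : ℝ))⁻¹))

/-- A weight matrix: a totally ordered (pointwise) family of weight sequences. -/
structure IsWeightMatrix (W : Set (ℕ → ℝ)) : Prop where
  weight : ∀ M ∈ W, IsWeightSeq M
  ordered : ∀ M ∈ W, ∀ N ∈ W, (∀ k, M k ≤ N k) ∨ (∀ k, N k ≤ M k)

/-- R-admissible weight matrix. -/
structure RAdmissible (W : Set (ℕ → ℝ)) : Prop where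
  matrix : IsWeightMatrix W
  roots : ∀ M ∈ W, RootsTendsto (lc M)
  gamma : ∀ M ∈ W, ∃ N ∈ W, ∃ C : ℝ, 1 ≤ C ∧
    ∀ t : ℝ, 0 < t → GammaUpper (lc N) (C * t) ≤ GammaLower (lc M) t
  mgrowth : ∀ M ∈ W, ∃ N ∈ W, mg M N < ⊤

/-- B-admissible weight matrix. -/
structure BAdmissible (W : Set (ℕ → ℝ)) : Prop where
  matrix : IsWeightMatrix W
  roots : ∀ M ∈ W, RootsTendsto (lc M)
  gamma : ∀ M ∈ W, ∃ N ∈ W, ∃ C : ℝ, 1 ≤ C ∧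
    ∀ t : ℝ, 0 < t → GammaUpper (lc M) (C * t) ≤ GammaLower (lc N) t
  mgrowth : ∀ M ∈ W, ∃ N ∈ W, mg N M < ⊤

/-- `‖f‖^M_{K,ρ} < ∞` (derivatives taken within `U`). -/
def SeqBoundedOn {E F : Type*} [NormedAddCommGroup E] [NormedSpace ℝ E]
    [NormedAddCommGroup F] [NormedSpace ℝ F]
    (M : ℕ → ℝ) (ρ : ℝ) (f : E → F) (U K : Set E) : Prop :=
  ∃ C : ℝ, ∀ x ∈ K, ∀ k : ℕ, ‖iteratedFDerivWithin ℝ k f U x‖ ≤ C * ρ ^ k * M k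

/-- `f ∈ B^M_ρ(V)`: smooth on `V` with global bounds `‖f‖^M_{V,ρ} < ∞`. -/
def GlobalClass {E F : Type*} [NormedAddCommGroup E] [NormedSpace ℝ E]
    [NormedAddCommGroup F] [NormedSpace ℝ F]
    (M : ℕ → ℝ) (ρ : ℝ) (f : E → F) (V : Set E) : Prop :=
  ContDiffOn ℝ (⊤ : ℕ∞) f V ∧ SeqBoundedOn M ρ f V V

/-- The Roumieu class `E^{{W}}(U)`. -/
def Roumieu {E F : Type*} [NormedAddCommGroup E] [NormedSpace ℝ E]
    [NormedAddCommGroup F] [NormedSpace ℝ F]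
    (W : Set (ℕ → ℝ)) (U : Set E) (f : E → F) : Prop :=
  ContDiffOn ℝ (⊤ : ℕ∞) f U ∧
    ∀ K ⊆ U, IsCompact K → ∃ M ∈ W, ∃ ρ : ℝ, 0 < ρ ∧ SeqBoundedOn M ρ f U K

/-- The Beurling class `E^{(W)}(U)`. -/
def Beurling {E F : Type*} [NormedAddCommGroup E] [NormedSpace ℝ E]
    [NormedAddCommGroup F] [NormedSpace ℝ F]
    (W : Set (ℕ → ℝ)) (U : Set E) (f : E → F) : Prop :=
  ContDiffOn ℝ (⊤ : ℕ∞) f U ∧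
    ∀ K ⊆ U, IsCompact K → ∀ M ∈ W, ∀ ρ : ℝ, 0 < ρ → SeqBoundedOn M ρ f U K

/-- The open ellipse `Ω_ε` with vertices `±cosh ε` and co-vertices `±i sinh ε`. -/
def Omega (ε : ℝ) : Set ℂ :=
  {z : ℂ | (z.re / Real.cosh ε) ^ 2 + (z.im / Real.sinh ε) ^ 2 < 1}

/-- `V_U = ⋃_{x ∈ U} (x + 𝔹)`. -/
def VU {E : Type*} [NormedAddCommGroup E] [NormedSpace ℝ E] (U : Set E) : Set E :=
  ⋃ x ∈ U, Metric.closedBall x 1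

/-- A weight function in the sense of Braun–Meise–Taylor. -/
structure IsWeightFunction (ω : ℝ → ℝ) : Prop where
  cont : ContinuousOn ω (Ici 0)
  mono : MonotoneOn ω (Ici 0)
  nonneg : ∀ t, 0 ≤ t → 0 ≤ ω t
  bigO : (fun t => ω (2 * t)) =O[atTop] ω
  littleO : ω =o[atTop] (fun t => t)
  logLittleO : Real.log =o[atTop] ω
  convex : ConvexOn ℝ (Ici 0) (fun t => ω (Real.exp t))

/-- The Young conjugate `φ*_ω(s) = sup_{t ≥ 0} (s t - ω(e^t))`. -/
def youngConj (ω : ℝ → ℝ) (s : ℝ) : ℝ :=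
  sSup {y : ℝ | ∃ t : ℝ, 0 ≤ t ∧ y = s * t - ω (Real.exp t)}

/-- The Roumieu class `E^{{ω}}(U)` for a weight function `ω`. -/
def RoumieuW {E F : Type*} [NormedAddCommGroup E] [NormedSpace ℝ E]
    [NormedAddCommGroup F] [NormedSpace ℝ F]
    (ω : ℝ → ℝ) (U : Set E) (f : E → F) : Prop :=
  ContDiffOn ℝ (⊤ : ℕ∞) f U ∧
    ∀ K ⊆ U, IsCompact K → ∃ C : ℝ, 0 < C ∧ ∃ ρ : ℝ, 0 < ρ ∧
      ∀ x ∈ K, ∀ k : ℕ, ‖iteratedFDerivWithin ℝ k f U x‖ ≤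
        C * Real.exp ((1 / ρ) * youngConj ω (ρ * k))

/-- The Beurling class `E^{(ω)}(U)` for a weight function `ω`. -/
def BeurlingW {E F : Type*} [NormedAddCommGroup E] [NormedSpace ℝ E]
    [NormedAddCommGroup F] [NormedSpace ℝ F]
    (ω : ℝ → ℝ) (U : Set E) (f : E → F) : Prop :=
  ContDiffOn ℝ (⊤ : ℕ∞) f U ∧
    ∀ K ⊆ U, IsCompact K → ∀ ρ : ℝ, 0 < ρ → ∃ C : ℝ, 0 < C ∧
      ∀ x ∈ K, ∀ k : ℕ, ‖iteratedFDerivWithin ℝ k f U x‖ ≤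
        C * Real.exp ((1 / ρ) * youngConj ω (ρ * k))

/-- The iterated difference `Δ_{v₁} ⋯ Δ_{vₖ} f` along a list of vectors. -/
def mixedDiff {E F : Type*} [AddCommGroup E] [AddCommGroup F] : List E → (E → F) → E → F
  | [], f, x => f x
  | v :: l, f, x => mixedDiff l f (x + v) - mixedDiff l f x

section MixedDiff

variable {E F : Type*} [NormedAddCommGroup E] [NormedSpace ℝ E]
  [NormedAddCommGroup F] [NormedSpace ℝ F]

theorem mixedDiff_perm {l l' : List E} (h : l.Perm l') (f : E → F) (x : E) :
    mixedDiff l f x = mixedDiff l' f x := by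
  induction h generalizing x with
  | nil => rfl
  | cons v _ ih => simp [mixedDiff, ih]
  | swap v w l =>
    simp only [mixedDiff]
    rw [add_right_comm]
    abel
  | trans _ _ ih₁ ih₂ => rw [ih₁, ih₂]

theorem mixedDiff_eq_zero_of_zero_mem {l : List E} (h : (0 : E) ∈ l) (f : E → F) (x : E) :
    mixedDiff l f x = 0 := by
  obtain ⟨s, t, rfl⟩ := List.append_of_mem h
  rw [mixedDiff_perm List.perm_middle]
  simp [mixedDiff]

theorem mixedDiff_fwdDiff (l : List E) (f : E → F) (v x : E) :
    mixedDiff l (fun y => f (y + v) - f y) x = mixedDiff (v :: l) f x := by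
  induction l generalizing x with
  | nil => simp [mixedDiff]
  | cons w l ih =>
    simp only [mixedDiff] at ih ⊢
    rw [ih, ih, add_right_comm]
    abel

theorem mixedDiff_clm_apply {G : Type*} [NormedAddCommGroup G] [NormedSpace ℝ G]
    (T : F →L[ℝ] G) (l : List E) (f : E → F) (x : E) :
    mixedDiff l (fun y => T (f y)) x = T (mixedDiff l f x) := by
  induction l generalizing x with
  | nil => rfl
  | cons w l ih => simp [mixedDiff, ih]

theorem tendsto_mixedDiff {ι : Type*} {L : Filter ι} (l : List E) (f : ι → E → F) (g : E → F)
    (x : E) (h : ∀ y, ‖y - x‖ ≤ (l.map norm).sum → Tendsto (fun i => f i y) L (𝓝 (g y))) :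
    Tendsto (fun i => mixedDiff l (f i) x) L (𝓝 (mixedDiff l g x)) := by
  induction l generalizing x with
  | nil => exact h x (by simp)
  | cons v l ih =>
    refine (ih _ fun y hy => h y ?_).sub (ih _ fun y hy => h y ?_)
    · have := norm_add_le (y - (x + v)) v
      rw [show y - (x + v) + v = y - x by abel] at this
      simp only [List.map_cons, List.sum_cons]
      linarith
    · simp only [List.map_cons, List.sum_cons]
      linarith [norm_nonneg v]

theorem norm_sum_mixedDiff_le {f : E → F} {x₀ : E} {r s A : ℝ} {n : ℕ} (w : ℕ → ℤ) (N : ℕ)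
    (hA : 0 ≤ A)
    (h : ∀ x y, ‖x - x₀‖ < r → ‖y‖ ≤ s →
      ‖∑ k ∈ Finset.range N, w k • f (x + k • y)‖ ≤ A * ‖y‖ ^ n)
    (l : List (E × E)) (x y : E) (hx : ‖x - x₀‖ + (l.map fun p => ‖p.1‖).sum < r)
    (hy : ‖y‖ + (l.map fun p => ‖p.2‖).sum ≤ s) :
    ‖∑ k ∈ Finset.range N, w k • mixedDiff (l.map fun p => p.1 + k • p.2) f (x + k • y)‖
      ≤ 2 ^ l.length * (A * (‖y‖ + (l.map fun p => ‖p.2‖).sum) ^ n) := by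
  induction l generalizing x y with
  | nil => simpa [mixedDiff] using h x y (by simpa using hx) (by simpa using hy)
  | cons p l ih =>
    have hs : 0 ≤ (l.map fun p => ‖p.2‖).sum := List.sum_nonneg (by
      rintro _ h
      obtain ⟨p, _, rfl⟩ := List.mem_map.1 h
      exact norm_nonneg _)
    simp only [List.map_cons, List.sum_cons, List.length_cons] at hx hy ⊢
    have e1 : ‖x + p.1 - x₀‖ ≤ ‖x - x₀‖ + ‖p.1‖ := by
      rw [show x + p.1 - x₀ = (x - x₀) + p.1 by abel]
      exact norm_add_le _ _
    have e2 : ‖y + p.2‖ ≤ ‖y‖ + ‖p.2‖ := norm_add_le _ _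
    have i1 := ih (x + p.1) (y + p.2) (by linarith) (by linarith)
    have i2 := ih x y (by linarith [norm_nonneg p.1]) (by linarith [norm_nonneg p.2])
    have key : ∑ k ∈ Finset.range N,
        w k • mixedDiff ((p.1 + k • p.2) :: l.map fun p => p.1 + k • p.2) f (x + k • y)
        = ∑ k ∈ Finset.range N,
            w k • mixedDiff (l.map fun p => p.1 + k • p.2) f (x + p.1 + k • (y + p.2))
          - ∑ k ∈ Finset.range N,
            w k • mixedDiff (l.map fun p => p.1 + k • p.2) f (x + k • y) := by
      rw [← Finset.sum_sub_distrib]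
      refine Finset.sum_congr rfl fun k _ => ?_
      rw [mixedDiff, smul_sub]
      congr 3
      rw [smul_add]
      abel
    rw [key]
    refine (norm_sub_le _ _).trans ?_
    have b1 : A * (‖y + p.2‖ + (l.map fun p => ‖p.2‖).sum) ^ n
        ≤ A * (‖y‖ + (‖p.2‖ + (l.map fun p => ‖p.2‖).sum)) ^ n := by
      exact mul_le_mul_of_nonneg_left (pow_le_pow_left₀ (by positivity) (by linarith) n) hA
    have b2 : A * (‖y‖ + (l.map fun p => ‖p.2‖).sum) ^ n
        ≤ A * (‖y‖ + (‖p.2‖ + (l.map fun p => ‖p.2‖).sum)) ^ n := by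
      gcongr
      linarith [norm_nonneg p.2]
    have hp : (0 : ℝ) ≤ 2 ^ l.length := by positivity
    have := mul_le_mul_of_nonneg_left b1 hp
    have := mul_le_mul_of_nonneg_left b2 hp
    rw [pow_succ]
    linarith

/-- Mixed differences are controlled by differences along lines. -/
theorem norm_mixedDiff_le_of_line {f : E → F} {x₀ : E} {r s A : ℝ} {n : ℕ} (hA : 0 ≤ A)
    (h : ∀ x y, ‖x - x₀‖ < r → ‖y‖ ≤ s → ‖(fwdDiff y)^[n] f x‖ ≤ A * ‖y‖ ^ n)
    (l : List E) (hl : l.length = n) (x : E) (hx : ‖x - x₀‖ + (l.map norm).sum < r)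
    (hs : (l.map norm).sum ≤ s) :
    ‖mixedDiff l f x‖ ≤ 2 ^ n * (A * (l.map norm).sum ^ n) := by
  set P : List (E × E) := l.mapIdx fun i v => (v, -((1 : ℝ) / (i + 1)) • v) with hP
  have hfst : (P.map fun p => ‖p.1‖) = l.map norm := by
    apply List.ext_getElem <;> simp [hP]
  have hsnd : (P.map fun p => ‖p.2‖).sum ≤ (l.map norm).sum := by
    rw [← hfst]
    refine List.sum_le_sum fun p hp => ?_
    obtain ⟨i, hi, rfl⟩ := List.mem_mapIdx.1 hp
    simp only [norm_smul, norm_neg]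
    refine mul_le_of_le_one_left (norm_nonneg _) ?_
    rw [Real.norm_of_nonneg (by positivity), div_le_one (by positivity)]
    linarith [(Nat.cast_nonneg i : (0 : ℝ) ≤ i)]
  have hlen : P.length = n := by simp [hP, hl]
  have hsn : 0 ≤ (P.map fun p => ‖p.2‖).sum := List.sum_nonneg (by
      rintro _ h
      obtain ⟨p, _, rfl⟩ := List.mem_map.1 h
      exact norm_nonneg _)
  have key := norm_sum_mixedDiff_le (f := f) (x₀ := x₀) (r := r) (s := s) (A := A) (n := n)
    (fun k => (-1) ^ (n - k) * (n.choose k : ℤ)) (n + 1) hA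
    (fun x y hx hy => by rw [← fwdDiff_iter_eq_sum_shift]; exact h x y hx hy)
    P x 0 (by rw [hfst]; exact hx) (by rw [norm_zero, zero_add]; linarith)
  rw [Finset.sum_eq_single 0] at key
  · have hz : (P.map fun p => p.1 + (0 : ℕ) • p.2) = l := by
      apply List.ext_getElem <;> simp [hP]
    rw [hz, hlen] at key
    simp only [smul_zero, add_zero, norm_zero, zero_add, Nat.choose_zero_right, Nat.cast_one,
      mul_one, Nat.sub_zero] at key
    have hn : ‖((-1 : ℤ) ^ n) • mixedDiff l f x‖ = ‖mixedDiff l f x‖ := by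
      rcases neg_one_pow_eq_or ℤ n with h | h <;> simp [h]
    rw [hn] at key
    refine key.trans ?_
    gcongr
  · intro k hk hk0
    have hkn : k - 1 < l.length := by
      have := Finset.mem_range.1 hk
      omega
    rw [mixedDiff_eq_zero_of_zero_mem, smul_zero]
    refine List.mem_map.2 ⟨_, List.mem_mapIdx.2 ⟨k - 1, hkn, rfl⟩, ?_⟩
    have h1 : ((k - 1 : ℕ) : ℝ) + 1 = k := by
      exact_mod_cast Nat.sub_add_cancel (Nat.one_le_iff_ne_zero.2 hk0)
    have h2 : (k : ℝ) ≠ 0 := by exact_mod_cast hk0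
    simp only
    rw [h1, ← Nat.cast_smul_eq_nsmul ℝ, smul_smul]
    rw [show (k : ℝ) * -(1 / k) = -1 by field_simp]
    simp
  · simp

theorem norm_mixedDiff_cons_le_subdiv {f : E → F} {l : List E} {v x : E} {b : ℝ} {N : ℕ}
    (hN : 0 < N)
    (h : ∀ y, ‖y - x‖ ≤ ‖v‖ → ‖mixedDiff (((N : ℝ)⁻¹ • v) :: l) f y‖ ≤ b) :
    ‖mixedDiff (v :: l) f x‖ ≤ N * b := by
  have hN' : (N : ℝ) ≠ 0 := by positivity
  have key : mixedDiff (v :: l) f x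
      = ∑ i ∈ Finset.range N, mixedDiff (((N : ℝ)⁻¹ • v) :: l) f (x + ((i : ℝ) * (N : ℝ)⁻¹) • v) := by
    have := Finset.sum_range_sub (fun i : ℕ => mixedDiff l f (x + ((i : ℝ) * (N : ℝ)⁻¹) • v)) N
    simp only [mixedDiff]
    rw [mul_inv_cancel₀ hN', one_smul, Nat.cast_zero, zero_mul, zero_smul, add_zero] at this
    rw [← this]
    refine Finset.sum_congr rfl fun i _ => ?_
    congr 2
    rw [add_assoc, ← add_smul]
    push_cast
    ring_nf
  rw [key]
  refine (norm_sum_le_of_le _ fun i hi => h _ ?_).trans (by simp)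
  rw [add_sub_cancel_left, norm_smul]
  refine mul_le_of_le_one_left (norm_nonneg _) ?_
  rw [Real.norm_of_nonneg (by positivity), ← div_eq_mul_inv, div_le_one (by positivity)]
  exact_mod_cast (Finset.mem_range.1 hi).le

/-- All mixed differences of order `k` near `x₀` are bounded by the product of the increments. -/
def MixedDiffBound (f : E → F) (x₀ : E) (k : ℕ) : Prop :=
  ∃ B r : ℝ, 0 ≤ B ∧ 0 < r ∧ ∀ x, ‖x - x₀‖ < r → ∀ l : List E, l.length = k →
    (∀ v ∈ l, ‖v‖ ≤ r) → ‖mixedDiff l f x‖ ≤ B * (l.map norm).prod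

theorem sum_map_norm_le {l : List E} {s : ℝ} (h : ∀ v ∈ l, ‖v‖ ≤ s) :
    (l.map norm).sum ≤ l.length * s := by
  have := List.sum_le_card_nsmul (l.map norm) s (by simpa using h)
  simpa using this

theorem mixedDiffBound_of_equal {f : E → F} {x₀ : E} {k : ℕ} {B r : ℝ} (hB : 0 ≤ B) (hr : 0 < r)
    (h : ∀ x s, ‖x - x₀‖ < r → s ≤ r → ∀ l : List E, l.length = k →
      (∀ v ∈ l, ‖v‖ ≤ s) → ‖mixedDiff l f x‖ ≤ B * s ^ k) :
    MixedDiffBound f x₀ k := by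
  set t : ℝ := r / (2 * (k + 1)) with ht
  have htpos : 0 < t := by positivity
  have htk : (k + 1) * t = r / 2 := by rw [ht]; field_simp
  refine ⟨B * 2 ^ k, t, by positivity, htpos, fun x hx l hl hlt => ?_⟩
  by_cases hz : (0 : E) ∈ l
  · rw [mixedDiff_eq_zero_of_zero_mem hz, norm_zero]
    have : 0 ≤ (l.map norm).prod := List.prod_nonneg (by simp)
    positivity
  have claim : ∀ (s : ℝ), 0 < s → s ≤ t → ∀ (l₁ l₂ : List E) (x : E), l₁.length + l₂.length = k →
      (∀ v ∈ l₁, s ≤ ‖v‖ ∧ ‖v‖ ≤ t) → (∀ v ∈ l₂, ‖v‖ ≤ s) →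
      ‖x - x₀‖ + (l₁.map norm).sum < r →
      ‖mixedDiff (l₁ ++ l₂) f x‖ ≤ B * 2 ^ l₁.length * (l₁.map norm).prod * s ^ l₂.length := by
    intro s hs hst l₁
    induction l₁ with
    | nil =>
      intro l₂ x hlen _ h2 hx
      simp only [List.length_nil, zero_add] at hlen
      simp only [List.nil_append, List.length_nil, pow_zero, List.map_nil, List.prod_nil, mul_one]
      rw [hlen]
      refine h x s (by simpa using hx) (hst.trans ?_) l₂ hlen h2
      have : 0 ≤ (k : ℝ) * t := by positivity
      linarith
    | cons v l₁ ih =>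
      intro l₂ x hlen h1 h2 hx
      obtain ⟨hv1, hv2⟩ := h1 v (by simp)
      have hvpos : 0 < ‖v‖ := hs.trans_le hv1
      set N := ⌈‖v‖ / s⌉₊ with hN
      have hNpos : 0 < N := Nat.ceil_pos.2 (by positivity)
      have hNle : ‖v‖ / s ≤ N := Nat.le_ceil _
      have hN2 : (N : ℝ) ≤ 2 * (‖v‖ / s) := by
        have h1 := (Nat.ceil_lt_add_one (a := ‖v‖ / s) (by positivity)).le
        have h2 : 1 ≤ ‖v‖ / s := (one_le_div hs).2 hv1
        linarith
      simp only [List.map_cons, List.sum_cons, List.prod_cons, List.length_cons] at hx hlen ⊢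
      have step := norm_mixedDiff_cons_le_subdiv (f := f) (l := l₁ ++ l₂) (v := v) (x := x)
        (b := B * 2 ^ l₁.length * (l₁.map norm).prod * s ^ (l₂.length + 1)) hNpos (by
          intro y hy
          rw [mixedDiff_perm (l' := l₁ ++ (((N : ℝ)⁻¹ • v) :: l₂)) List.perm_middle.symm]
          refine ih (((N : ℝ)⁻¹ • v) :: l₂) y (by simp only [List.length_cons]; omega)
            (fun w hw => h1 w (by simp [hw])) ?_ ?_
          · intro w hw
            rcases List.mem_cons.1 hw with rfl | hw
            · rw [norm_smul, norm_inv, Real.norm_natCast, inv_mul_le_iff₀ (by positivity)]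
              rw [div_le_iff₀ hs] at hNle
              exact hNle
            · exact h2 w hw
          · have := norm_add_le (y - x) (x - x₀)
            rw [sub_add_sub_cancel] at this
            linarith)
      refine step.trans ?_
      have hnn : 0 ≤ B * 2 ^ l₁.length * (l₁.map norm).prod * s ^ (l₂.length + 1) := by
        have : 0 ≤ (l₁.map norm).prod := List.prod_nonneg (by simp)
        positivity
      refine (mul_le_mul_of_nonneg_right hN2 hnn).trans (le_of_eq ?_)
      rw [pow_succ, pow_succ]
      field_simp
  obtain ⟨s, hs, hst, hsl⟩ : ∃ s, 0 < s ∧ s ≤ t ∧ ∀ v ∈ l, s ≤ ‖v‖ := by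
    have : ∀ l : List E, (0 : E) ∉ l → ∃ s, 0 < s ∧ s ≤ t ∧ ∀ v ∈ l, s ≤ ‖v‖ := by
      intro l
      induction l with
      | nil => exact fun _ => ⟨t, htpos, le_rfl, by simp⟩
      | cons v l ih =>
        intro h0
        obtain ⟨s, hs, hst, hsl⟩ := ih (fun h => h0 (by simp [h]))
        have hv : v ≠ 0 := fun h => h0 (by simp [h])
        refine ⟨min s ‖v‖, lt_min hs (norm_pos_iff.2 hv), (min_le_left _ _).trans hst, ?_⟩
        intro w hw
        rcases List.mem_cons.1 hw with rfl | hw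
        · exact min_le_right _ _
        · exact (min_le_left _ _).trans (hsl w hw)
    exact this l hz
  have := claim s hs hst l [] x (by simpa using hl) (fun v hv => ⟨hsl v hv, hlt v hv⟩) (by simp) (by
    have := sum_map_norm_le hlt
    rw [hl] at this
    linarith)
  simpa [hl] using this

/-- Bounds for differences along lines give bounds for mixed differences. -/
theorem mixedDiffBound_of_line {f : E → F} {x₀ : E} {r s A : ℝ} {n : ℕ} (hA : 0 ≤ A) (hr : 0 < r)
    (hs : 0 < s)
    (h : ∀ x y, ‖x - x₀‖ < r → ‖y‖ ≤ s → ‖(fwdDiff y)^[n] f x‖ ≤ A * ‖y‖ ^ n) :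
    MixedDiffBound f x₀ n := by
  set t : ℝ := min r s / (2 * (n + 1)) with ht
  have hrs : 0 < min r s := lt_min hr hs
  have htpos : 0 < t := by positivity
  have htk : (n + 1) * t = min r s / 2 := by rw [ht]; field_simp
  have htn : 0 ≤ (n : ℝ) * t := by positivity
  refine mixedDiffBound_of_equal (B := 2 ^ n * (A * n ^ n)) (r := t) (by positivity) htpos ?_
  intro x u hx hu l hl hlu
  have h1 := sum_map_norm_le hlu
  have h2 : (l.map norm).sum ≤ n * t := by
    rw [hl] at h1
    exact h1.trans (by gcongr)
  have h3 := min_le_left r s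
  have h4 := min_le_right r s
  refine (norm_mixedDiff_le_of_line hA h l hl x (by linarith) (by linarith)).trans ?_
  have h0 : 0 ≤ (l.map norm).sum := List.sum_nonneg (by
      rintro _ h
      obtain ⟨p, _, rfl⟩ := List.mem_map.1 h
      exact norm_nonneg _)
  rw [hl] at h1
  rw [mul_assoc, mul_assoc, ← mul_pow]
  gcongr

end MixedDiff

section MixedDiffDeriv

variable {E F : Type*} [NormedAddCommGroup E] [NormedSpace ℝ E]
  [NormedAddCommGroup F] [NormedSpace ℝ F]

theorem hasDerivAt_mixedDiff (l : List E) (f : E → F) (y w : E) (t : ℝ)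
    (h : ∀ z, ‖z - (y + t • w)‖ ≤ (l.map norm).sum → DifferentiableAt ℝ f z) :
    HasDerivAt (fun s : ℝ => mixedDiff l f (y + s • w))
      (mixedDiff l (fun z => fderiv ℝ f z w) (y + t • w)) t := by
  induction l generalizing y with
  | nil =>
    have h1 := (h (y + t • w) (by simp)).hasFDerivAt
    have h2 : HasDerivAt (fun s : ℝ => y + s • w) w t := by
      simpa using ((hasDerivAt_id t).smul_const w).const_add y
    exact h1.comp_hasDerivAt t h2
  | cons v l ih =>
    simp only [List.map_cons, List.sum_cons] at h
    have h1 := ih (y + v) fun z hz => h z (by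
      have := norm_add_le (z - (y + v + t • w)) v
      rw [show z - (y + v + t • w) + v = z - (y + t • w) by abel] at this
      linarith)
    have h2 := ih y fun z hz => h z (by linarith [norm_nonneg v])
    simp only [mixedDiff]
    simp only [add_right_comm y v] at h1
    exact h1.sub h2

/-- Rescaled mixed differences converge to the iterated derivative, locally uniformly. -/
theorem mixedDiff_sub_iteratedFDeriv_le {U : Set E} (hU : IsOpen U) {n : ℕ} {f : E → F}
    (hf : ContDiffOn ℝ (⊤ : ℕ∞) f U) (m : Fin n → E) {x : E} (hx : x ∈ U) {ε : ℝ} (hε : 0 < ε) :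
    ∃ δ > 0, ∀ s : ℝ, 0 < s → s < δ → ∀ y, ‖y - x‖ < δ →
      ‖mixedDiff ((List.ofFn m).reverse.map fun v => s • v) f y
        - s ^ n • iteratedFDeriv ℝ n f x m‖ ≤ ε * s ^ n := by
  induction n generalizing f ε with
  | zero =>
    have hc : ContinuousAt f x := hf.continuousOn.continuousAt (hU.mem_nhds hx)
    obtain ⟨δ, hδ, h⟩ := Metric.continuousAt_iff.1 hc ε hε
    refine ⟨δ, hδ, fun s _ _ y hy => ?_⟩
    have := h (x := y) (by rwa [dist_eq_norm])
    rw [dist_eq_norm] at this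
    simpa [mixedDiff] using this.le
  | succ n ih =>
    set w := m (Fin.last n) with hw
    set g : E → F := fun z => fderiv ℝ f z w with hg
    have hfd : ContDiffOn ℝ (⊤ : ℕ∞) (fderiv ℝ f) U := hf.fderiv_of_isOpen hU (by simp)
    have hgs : ContDiffOn ℝ (⊤ : ℕ∞) g U :=
      (ContinuousLinearMap.apply ℝ F w).contDiff.comp_contDiffOn hfd
    obtain ⟨δ, hδ, h⟩ := ih hgs (Fin.init m) hε
    have hiter : iteratedFDeriv ℝ (n + 1) f x m = iteratedFDeriv ℝ n g x (Fin.init m) := by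
      rw [iteratedFDeriv_succ_apply_right]
      have := (ContinuousLinearMap.apply ℝ F w).iteratedFDeriv_comp_left
        (f := fderiv ℝ f) (x := x) (n := (⊤ : ℕ∞))
        ((hfd x hx).contDiffAt (hU.mem_nhds hx)) (i := n) (by exact_mod_cast le_top)
      have h2 := congrArg (fun T => T (Fin.init m)) this
      simpa [hg, Function.comp_def] using h2.symm
    have hlist : (List.ofFn m).reverse = w :: (List.ofFn (Fin.init m)).reverse := by
      rw [List.ofFn_succ', List.concat_eq_append, List.reverse_append]
      rfl
    obtain ⟨r, hr, hrU⟩ := Metric.isOpen_iff.1 hU x hx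
    set S := (((List.ofFn (Fin.init m)).reverse).map norm).sum with hS
    have hS0 : 0 ≤ S := List.sum_nonneg (by
      rintro _ h
      obtain ⟨p, _, rfl⟩ := List.mem_map.1 h
      exact norm_nonneg _)
    have hw0 := norm_nonneg w
    set D := min δ r / (2 * (1 + ‖w‖ + S)) with hD
    have hmin : 0 < min δ r := lt_min hδ hr
    have hDpos : 0 < D := by positivity
    have hDeq : D * (1 + ‖w‖ + S) = min δ r / 2 := by rw [hD]; field_simp
    refine ⟨D, hDpos, fun s hs hsD y hy => ?_⟩
    have hm1 := min_le_left δ r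
    have hm2 := min_le_right δ r
    have p1 : s * ‖w‖ ≤ D * ‖w‖ := by gcongr
    have p2 : s * S ≤ D * S := by gcongr
    have p3 : 0 ≤ D * ‖w‖ := by positivity
    have p4 : 0 ≤ D * S := by positivity
    set L := (List.ofFn (Fin.init m)).reverse.map fun v => s • v with hL
    have hLsum : (L.map norm).sum = s * S := by
      rw [hL, hS, List.map_map, ← List.sum_map_mul_left]
      congr 1
      simp [Function.comp_def, norm_smul, abs_of_pos hs]
    set c := iteratedFDeriv ℝ n g x (Fin.init m) with hc
    have hclose : ∀ t ∈ Icc (0 : ℝ) 1, ‖y + t • (s • w) - x‖ < D + s * ‖w‖ := by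
      intro t ht
      calc ‖y + t • (s • w) - x‖ = ‖(y - x) + t • (s • w)‖ := by congr 1; abel
        _ ≤ ‖y - x‖ + ‖t • (s • w)‖ := norm_add_le _ _
        _ < D + s * ‖w‖ := by
          rw [norm_smul, norm_smul, Real.norm_of_nonneg ht.1, Real.norm_of_nonneg hs.le]
          have : t * (s * ‖w‖) ≤ s * ‖w‖ := mul_le_of_le_one_left (by positivity) ht.2
          linarith
    have hder : ∀ t ∈ Icc (0 : ℝ) 1,
        HasDerivAt (fun t : ℝ => mixedDiff L f (y + t • (s • w)) - t • (s ^ (n + 1) • c))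
          (s • mixedDiff L g (y + t • (s • w)) - s ^ (n + 1) • c) t := by
      intro t ht
      have h1 := hasDerivAt_mixedDiff L f y (s • w) t (by
        intro z hz
        have hz' : z ∈ ball x r := by
          rw [mem_ball, dist_eq_norm]
          have := norm_add_le (z - (y + t • (s • w))) (y + t • (s • w) - x)
          rw [sub_add_sub_cancel] at this
          have := hclose t ht
          rw [hLsum] at hz
          nlinarith
        exact (hf.differentiableOn (by simp)).differentiableAt (hU.mem_nhds (hrU hz')))
      have h2 : mixedDiff L (fun z => fderiv ℝ f z (s • w)) (y + t • s • w)
          = s • mixedDiff L g (y + t • s • w) := by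
        simp only [map_smul]
        exact mixedDiff_clm_apply (s • ContinuousLinearMap.id ℝ F) L g _
      rw [h2] at h1
      have h3 : HasDerivAt (fun t : ℝ => t • (s ^ (n + 1) • c)) (s ^ (n + 1) • c) t := by
        simpa using (hasDerivAt_id t).smul_const (s ^ (n + 1) • c)
      exact h1.sub h3
    have hbound : ∀ t ∈ Ico (0 : ℝ) 1,
        ‖s • mixedDiff L g (y + t • (s • w)) - s ^ (n + 1) • c‖ ≤ ε * s ^ (n + 1) := by
      intro t ht
      have h1 := h s hs (by nlinarith) (y + t • (s • w)) (by
        have := hclose t ⟨ht.1, ht.2.le⟩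
        nlinarith)
      have h2 : s • mixedDiff L g (y + t • (s • w)) - s ^ (n + 1) • c
          = s • (mixedDiff L g (y + t • (s • w)) - s ^ n • c) := by
        rw [smul_sub, pow_succ', mul_smul]
      rw [h2, norm_smul, Real.norm_of_nonneg hs.le, pow_succ']
      nlinarith [mul_le_mul_of_nonneg_left h1 hs.le]
    have key := norm_image_sub_le_of_norm_deriv_le_segment'
      (fun t ht => (hder t ht).hasDerivWithinAt) hbound 1 (by simp)
    rw [hiter, hlist, List.map_cons, mixedDiff]
    simp only [one_smul, zero_smul, add_zero, sub_zero, mul_one] at key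
    convert key using 2
    abel

theorem norm_iteratedFDeriv_apply_le_of_line {U : Set E} (hU : IsOpen U) {n : ℕ} {f : E → F}
    (hf : ContDiffOn ℝ (⊤ : ℕ∞) f U) {x : E} (hx : x ∈ U) {A r s : ℝ} (hA : 0 ≤ A) (hr : 0 < r)
    (hs : 0 < s)
    (h : ∀ z y, ‖z - x‖ < r → ‖y‖ ≤ s → ‖(fwdDiff y)^[n] f z‖ ≤ A * ‖y‖ ^ n)
    (m : Fin n → E) (hm : ∀ i, ‖m i‖ ≤ 1) :
    ‖iteratedFDeriv ℝ n f x m‖ ≤ 2 ^ n * n ^ n / n.factorial * A := by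
  rcases Nat.eq_zero_or_pos n with rfl | hn
  · simpa using h x 0 (by simpa using hr) (by simpa using hs.le)
  set L := iteratedFDeriv ℝ n f x m with hL
  set w : ℕ → ℤ := fun k => (-1) ^ (n - k) * (n.choose k : ℤ) with hw
  set c : ℝ := ∑ k ∈ Finset.range (n + 1), ‖w k‖ * (k : ℝ) ^ n with hc
  have hc0 : 0 ≤ c := by positivity
  have hfact : (0 : ℝ) < n.factorial := by positivity
  have hsum : ∑ k ∈ Finset.range (n + 1), (w k : ℝ) * (k : ℝ) ^ n = n.factorial := by
    have h1 := congrFun (fwdDiff_iter_eq_factorial (R := ℝ) (n := n)) 0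
    rw [fwdDiff_iter_eq_sum_shift] at h1
    simp only [zero_add, nsmul_eq_mul, mul_one, zsmul_eq_mul] at h1
    simpa [hw] using h1
  have hmain : n.factorial * ‖L‖ ≤ 2 ^ n * (A * n ^ n) := by
    refine le_of_forall_pos_le_add fun e he => ?_
    obtain ⟨δ, hδ, hd⟩ := mixedDiff_sub_iteratedFDeriv_le hU hf m hx
      (ε := e / (c + 1)) (by positivity)
    obtain ⟨σ, hσ, hσδ, hσs⟩ : ∃ σ : ℝ, 0 < σ ∧ (n + 1) * σ < δ ∧ (n + 1) * σ ≤ s := by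
      refine ⟨min δ s / (2 * (n + 1)), by positivity, ?_, ?_⟩
      · have : (n + 1) * (min δ s / (2 * (n + 1))) = min δ s / 2 := by field_simp
        rw [this]
        linarith [min_le_left δ s]
      · have : (n + 1) * (min δ s / (2 * (n + 1))) = min δ s / 2 := by field_simp
        rw [this]
        linarith [min_le_right δ s]
    set l := (List.ofFn m).reverse with hl
    have hlen : l.length = n := by simp [hl]
    have hlm : ∀ v ∈ l, ‖v‖ ≤ 1 := by
      intro v hv
      rw [hl, List.mem_reverse, List.mem_ofFn] at hv
      obtain ⟨i, rfl⟩ := hv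
      exact hm i
    set P : List (E × E) := l.map fun v => (0, σ • v) with hP
    have hPlen : P.length = n := by simp [hP, hlen]
    have hP1 : (P.map fun p => ‖p.1‖).sum = 0 := by simp [hP, Function.comp_def]
    have hP2 : (P.map fun p => ‖p.2‖).sum ≤ n * σ := by
      have := sum_map_norm_le (l := l.map fun v => σ • v) (s := σ) (by
        intro v hv
        obtain ⟨u, hu, rfl⟩ := List.mem_map.1 hv
        rw [norm_smul, Real.norm_of_nonneg hσ.le]
        exact mul_le_of_le_one_right hσ.le (hlm u hu))
      simpa [hP, hlen, List.map_map, Function.comp_def] using this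
    have hP20 : 0 ≤ (P.map fun p => ‖p.2‖).sum := List.sum_nonneg (by
      rintro _ h
      obtain ⟨p, _, rfl⟩ := List.mem_map.1 h
      exact norm_nonneg _)
    have key := norm_sum_mixedDiff_le (f := f) (x₀ := x) (r := r) (s := s) (A := A) (n := n)
      w (n + 1) hA
      (fun z y hz hy => by rw [← fwdDiff_iter_eq_sum_shift]; exact h z y hz hy)
      P x 0 (by simpa [hP1] using hr) (by rw [norm_zero, zero_add]; linarith)
    have hlist : ∀ k : ℕ, (P.map fun p => p.1 + k • p.2) = l.map fun v => ((k : ℝ) * σ) • v := by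
      intro k
      rw [hP, List.map_map]
      refine List.map_congr_left fun v _ => ?_
      simp [← Nat.cast_smul_eq_nsmul ℝ, smul_smul]
    simp only [hlist, smul_zero, add_zero, norm_zero, zero_add, hPlen] at key
    have herr : ∀ k ∈ Finset.range (n + 1),
        ‖w k • (mixedDiff (l.map fun v => ((k : ℝ) * σ) • v) f x - ((k : ℝ) * σ) ^ n • L)‖
          ≤ ‖w k‖ * (e / (c + 1) * (k * σ) ^ n) := by
      intro k hk
      have hwk : ‖w k • (mixedDiff (l.map fun v => ((k : ℝ) * σ) • v) f x
          - ((k : ℝ) * σ) ^ n • L)‖ ≤ ‖w k‖ * ‖mixedDiff (l.map fun v => ((k : ℝ) * σ) • v) f x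
          - ((k : ℝ) * σ) ^ n • L‖ := norm_zsmul_le _ _
      refine hwk.trans (mul_le_mul_of_nonneg_left ?_ (norm_nonneg _))
      rcases Nat.eq_zero_or_pos k with rfl | hk0
      · rw [mixedDiff_eq_zero_of_zero_mem]
        · simp [hn.ne']
        · have : l ≠ [] := by
            rintro h0
            rw [h0] at hlen
            simp at hlen
            omega
          obtain ⟨v, hv⟩ := List.exists_mem_of_ne_nil l this
          exact List.mem_map.2 ⟨v, hv, by simp⟩
      · refine hd (k * σ) (by positivity) ?_ x (by simpa using hδ)
        have : (k : ℝ) ≤ n + 1 := by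
          exact_mod_cast (Finset.mem_range.1 hk).le
        nlinarith
    have hsplit : ((n.factorial : ℝ) * σ ^ n) • L
        = ∑ k ∈ Finset.range (n + 1), w k • mixedDiff (l.map fun v => ((k : ℝ) * σ) • v) f x
          - ∑ k ∈ Finset.range (n + 1),
            w k • (mixedDiff (l.map fun v => ((k : ℝ) * σ) • v) f x - ((k : ℝ) * σ) ^ n • L) := by
      rw [← Finset.sum_sub_distrib, ← hsum, Finset.sum_mul, Finset.sum_smul]
      refine Finset.sum_congr rfl fun k _ => ?_
      rw [smul_sub, sub_sub_cancel, ← Int.cast_smul_eq_zsmul ℝ, smul_smul, mul_pow]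
      ring_nf
    have hfin : n.factorial * σ ^ n * ‖L‖ ≤ 2 ^ n * (A * (n * σ) ^ n)
        + ∑ k ∈ Finset.range (n + 1), ‖w k‖ * (e / (c + 1) * (k * σ) ^ n) := by
      have h1 : ‖((n.factorial : ℝ) * σ ^ n) • L‖ = n.factorial * σ ^ n * ‖L‖ := by
        rw [norm_smul, Real.norm_of_nonneg (by positivity)]
      rw [← h1, hsplit]
      refine (norm_sub_le _ _).trans (add_le_add (key.trans ?_) (norm_sum_le_of_le _ herr))
      gcongr
    have h2 : ∑ k ∈ Finset.range (n + 1), ‖w k‖ * (e / (c + 1) * (k * σ) ^ n)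
        = σ ^ n * (e / (c + 1) * c) := by
      rw [hc, Finset.mul_sum, Finset.mul_sum]
      refine Finset.sum_congr rfl fun k _ => ?_
      rw [mul_pow]
      ring
    have h3 : e / (c + 1) * c ≤ e := by
      rw [div_mul_eq_mul_div, div_le_iff₀ (by positivity)]
      nlinarith
    rw [h2, mul_pow] at hfin
    have hσn : 0 < σ ^ n := by positivity
    refine le_of_mul_le_mul_left ?_ hσn
    nlinarith [mul_le_mul_of_nonneg_left h3 hσn.le]
  rw [div_mul_eq_mul_div, le_div_iff₀ hfact]
  linarith

/-- Iterated differences along lines control the operator norm of the iterated derivative. -/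
theorem norm_iteratedFDeriv_le_of_line {U : Set E} (hU : IsOpen U) {n : ℕ} {f : E → F}
    (hf : ContDiffOn ℝ (⊤ : ℕ∞) f U) {x : E} (hx : x ∈ U) {A r s : ℝ} (hA : 0 ≤ A) (hr : 0 < r)
    (hs : 0 < s)
    (h : ∀ z y, ‖z - x‖ < r → ‖y‖ ≤ s → ‖(fwdDiff y)^[n] f z‖ ≤ A * ‖y‖ ^ n) :
    ‖iteratedFDeriv ℝ n f x‖ ≤ 2 ^ n * n ^ n / n.factorial * A := by
  refine ContinuousMultilinearMap.opNorm_le_bound (by positivity) fun m => ?_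
  have hsm : m = fun i => ‖m i‖ • (‖m i‖⁻¹ • m i) := by
    funext i
    by_cases h0 : m i = 0
    · simp [h0]
    · rw [smul_smul, mul_inv_cancel₀ (norm_ne_zero_iff.2 h0), one_smul]
  have h1 := norm_iteratedFDeriv_apply_le_of_line hU hf hx hA hr hs h
    (fun i => ‖m i‖⁻¹ • m i) (fun i => by
      rw [norm_smul, norm_inv, norm_norm]
      exact inv_mul_le_one)
  conv_lhs => rw [hsm]
  rw [ContinuousMultilinearMap.map_smul_univ, norm_smul, norm_prod, mul_comm]
  simp only [norm_norm]
  gcongr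

end MixedDiffDeriv

universe u

section Boman

theorem differentiableAt_of_mixedDiff {E F : Type*} [NormedAddCommGroup E] [NormedSpace ℝ E]
    [NormedAddCommGroup F] [NormedSpace ℝ F] [CompleteSpace F] {f : E → F} {x : E} {B r : ℝ}
    (hr : 0 < r)
    (h1 : ∀ v, ‖v‖ ≤ r → ‖mixedDiff [v] f x‖ ≤ B * ‖v‖)
    (h2 : ∀ v w, ‖v‖ ≤ r → ‖w‖ ≤ r → ‖mixedDiff [v, w] f x‖ ≤ B * (‖v‖ * ‖w‖)) :
    DifferentiableAt ℝ f x := by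
  set a : E → ℕ → F := fun v n => (2 : ℝ) ^ n • (f (x + ((2 : ℝ) ^ n)⁻¹ • v) - f x) with ha
  have hstep : ∀ v, ‖v‖ ≤ r → ∀ n, dist (a v n) (a v (n + 1)) ≤ B * ‖v‖ ^ 2 / 2 / 2 / 2 ^ n := by
    intro v hv n
    set u := ((2 : ℝ) ^ (n + 1))⁻¹ • v with hu
    have hun : ‖u‖ = ((2 : ℝ) ^ (n + 1))⁻¹ * ‖v‖ := by
      rw [hu, norm_smul, Real.norm_of_nonneg (by positivity)]
    have hur : ‖u‖ ≤ r := by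
      rw [hun]
      refine (mul_le_of_le_one_left (norm_nonneg v) ?_).trans hv
      exact inv_le_one_of_one_le₀ (one_le_pow₀ (by norm_num))
    have e1 : ((2 : ℝ) ^ n)⁻¹ • v = u + u := by
      rw [hu, ← add_smul, pow_succ]
      congr 1
      field_simp
      norm_num
    have e2 : a v n - a v (n + 1) = (2 : ℝ) ^ n • mixedDiff [u, u] f x := by
      simp only [ha, mixedDiff]
      rw [← hu, e1, pow_succ, mul_smul, ← smul_sub, two_smul, ← add_assoc]
      congr 1
      abel
    rw [dist_eq_norm, e2, norm_smul, Real.norm_of_nonneg (by positivity)]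
    refine (mul_le_mul_of_nonneg_left (h2 u u hur hur) (by positivity)).trans (le_of_eq ?_)
    rw [hun, pow_succ]
    field_simp
  have hlarge : ∀ v : E, ∀ᶠ n : ℕ in atTop, ‖((2 : ℝ) ^ n)⁻¹ • v‖ ≤ r := by
    intro v
    have : Tendsto (fun n : ℕ => ((2 : ℝ) ^ n)⁻¹ * ‖v‖) atTop (𝓝 (0 * ‖v‖)) :=
      (tendsto_inv_atTop_zero.comp (tendsto_pow_atTop_atTop_of_one_lt one_lt_two)).mul_const _
    rw [zero_mul] at this
    filter_upwards [this.eventually (eventually_le_nhds hr)] with n hn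
    rwa [norm_smul, Real.norm_of_nonneg (by positivity)]
  have hlim : ∀ v, ∃ y, Tendsto (a v) atTop (𝓝 y) := by
    intro v
    obtain ⟨N, hN⟩ := (hlarge v).exists
    obtain ⟨y, hy⟩ := cauchySeq_tendsto_of_complete
      (cauchySeq_of_le_geometric_two (hstep _ hN))
    refine ⟨(2 : ℝ) ^ N • y, (tendsto_add_atTop_iff_nat N).1 ?_⟩
    refine (hy.const_smul ((2 : ℝ) ^ N)).congr fun n => ?_
    simp only [ha, smul_smul]
    rw [pow_add, mul_inv, mul_comm]
  choose L hL using hlim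
  have hbd : ∀ v, ‖L v‖ ≤ B * ‖v‖ := by
    intro v
    refine le_of_tendsto (hL v).norm ?_
    filter_upwards [hlarge v] with n hn
    have := h1 _ hn
    simp only [mixedDiff] at this
    simp only [ha]
    rw [norm_smul] at this ⊢
    rw [Real.norm_of_nonneg (by positivity : (0 : ℝ) ≤ ((2 : ℝ) ^ n)⁻¹)] at this
    rw [Real.norm_of_nonneg (by positivity)]
    refine (mul_le_mul_of_nonneg_left this (by positivity)).trans (le_of_eq ?_)
    field_simp
  have hadd : ∀ v w, L (v + w) = L v + L w := by
    intro v w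
    have t1 := (hL (v + w)).sub ((hL v).add (hL w))
    have t2 : Tendsto (fun n => a (v + w) n - (a v n + a w n)) atTop (𝓝 0) := by
      refine squeeze_zero_norm' (a := fun n : ℕ => ((2 : ℝ) ^ n)⁻¹ * (B * (‖v‖ * ‖w‖))) ?_ ?_
      · filter_upwards [hlarge v, hlarge w] with n hv hw
        have e : a (v + w) n - (a v n + a w n)
            = (2 : ℝ) ^ n • mixedDiff [((2 : ℝ) ^ n)⁻¹ • v, ((2 : ℝ) ^ n)⁻¹ • w] f x := by
          simp only [ha, mixedDiff]
          rw [← smul_add, ← smul_sub, smul_add, add_assoc]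
          congr 1
          abel
        rw [e, norm_smul, Real.norm_of_nonneg (by positivity)]
        refine (mul_le_mul_of_nonneg_left (h2 _ _ hv hw) (by positivity)).trans (le_of_eq ?_)
        rw [norm_smul, norm_smul, Real.norm_of_nonneg (by positivity)]
        field_simp
      · simpa using (tendsto_inv_atTop_zero.comp
          (tendsto_pow_atTop_atTop_of_one_lt (one_lt_two (α := ℝ)))).mul_const (B * (‖v‖ * ‖w‖))
    have := tendsto_nhds_unique t1 t2
    rwa [sub_eq_zero] at this
  set L₀ : E →+ F := AddMonoidHom.mk' L hadd with hL₀
  have hcont : Continuous L₀ := AddMonoidHomClass.continuous_of_bound L₀ B hbd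
  set T : E →L[ℝ] F := L₀.toRealLinearMap hcont with hT
  refine HasFDerivAt.differentiableAt (f' := T) ?_
  rw [hasFDerivAt_iff_isLittleO_nhds_zero]
  refine Asymptotics.IsBigO.trans_isLittleO (g := fun v : E => ‖v‖ ^ 2) ?_
    (Asymptotics.isLittleO_norm_pow_id one_lt_two)
  refine Asymptotics.IsBigO.of_bound (B / 2) ?_
  filter_upwards [Metric.closedBall_mem_nhds (0 : E) hr] with v hv
  rw [mem_closedBall, dist_zero_right] at hv
  have := dist_le_of_le_geometric_two_of_tendsto₀ (hstep v hv) (hL v)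
  simp only [ha, pow_zero, inv_one, one_smul] at this
  rw [dist_eq_norm] at this
  rw [norm_pow, norm_norm]
  refine this.trans (le_of_eq (by ring))

theorem MixedDiffBound.eventually_differentiableAt {E F : Type*} [NormedAddCommGroup E]
    [NormedSpace ℝ E] [NormedAddCommGroup F] [NormedSpace ℝ F] [CompleteSpace F] {f : E → F}
    {x₀ : E} (h1 : MixedDiffBound f x₀ 1) (h2 : MixedDiffBound f x₀ 2) :
    ∀ᶠ x in 𝓝 x₀, DifferentiableAt ℝ f x := by
  obtain ⟨B₁, r₁, hB₁, hr₁, h1⟩ := h1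
  obtain ⟨B₂, r₂, hB₂, hr₂, h2⟩ := h2
  have hr : 0 < min r₁ r₂ := lt_min hr₁ hr₂
  filter_upwards [Metric.ball_mem_nhds x₀ hr] with x hx
  rw [mem_ball, dist_eq_norm] at hx
  refine differentiableAt_of_mixedDiff (B := max B₁ B₂) hr (fun v hv => ?_) (fun v w hv hw => ?_)
  · have := h1 x (hx.trans_le (min_le_left _ _)) [v] rfl (by simpa using hv.trans (min_le_left _ _))
    simp only [List.map_cons, List.map_nil, List.prod_cons, List.prod_nil, mul_one] at this
    exact this.trans (by gcongr; exact le_max_left _ _)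
  · have := h2 x (hx.trans_le (min_le_right _ _)) [v, w] rfl (by
      simpa using ⟨hv.trans (min_le_right _ _), hw.trans (min_le_right _ _)⟩)
    simp only [List.map_cons, List.map_nil, List.prod_cons, List.prod_nil, mul_one] at this
    exact this.trans (by gcongr; exact le_max_right _ _)

theorem MixedDiffBound.fderiv {E F : Type*} [NormedAddCommGroup E] [NormedSpace ℝ E]
    [NormedAddCommGroup F] [NormedSpace ℝ F] {f : E → F} {x₀ : E} {k : ℕ}
    (h : MixedDiffBound f x₀ (k + 1)) (hd : ∀ᶠ x in 𝓝 x₀, DifferentiableAt ℝ f x) :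
    MixedDiffBound (fderiv ℝ f) x₀ k := by
  obtain ⟨B, r, hB, hr, h⟩ := h
  obtain ⟨δ, hδ, hd⟩ := Metric.eventually_nhds_iff_ball.1 hd
  set t : ℝ := min r δ / (2 * (k + 1)) with ht
  have hm : 0 < min r δ := lt_min hr hδ
  have htpos : 0 < t := by positivity
  have htk : (k + 1) * t = min r δ / 2 := by rw [ht]; field_simp
  have hkt : 0 ≤ k * t := by positivity
  have hm1 := min_le_left r δ
  have hm2 := min_le_right r δ
  refine ⟨B, t, hB, htpos, fun x hx l hl hlt => ?_⟩
  have hprod : 0 ≤ (l.map norm).prod := List.prod_nonneg (by simp)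
  refine ContinuousLinearMap.opNorm_le_bound _ (by positivity) fun w => ?_
  have hsum := sum_map_norm_le hlt
  rw [hl] at hsum
  have hlim := tendsto_mixedDiff (L := atTop) l
    (fun (n : ℕ) y => (2 : ℝ) ^ n • (f (y + ((2 : ℝ) ^ n)⁻¹ • w) - f y))
    (fun y => (_root_.fderiv ℝ f y) w) x (by
      intro y hy
      have hyd : DifferentiableAt ℝ f y := hd y (by
        rw [mem_ball, dist_eq_norm]
        have := norm_add_le (y - x) (x - x₀)
        rw [sub_add_sub_cancel] at this
        linarith)
      exact (hyd.hasFDerivAt.lim_real w).comp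
        (tendsto_pow_atTop_atTop_of_one_lt (one_lt_two (α := ℝ))))
  have happ := mixedDiff_clm_apply (ContinuousLinearMap.apply ℝ F w) l (_root_.fderiv ℝ f) x
  simp only [ContinuousLinearMap.apply_apply] at happ
  rw [happ] at hlim
  refine le_of_tendsto hlim.norm ?_
  have hlarge : ∀ᶠ n : ℕ in atTop, ‖((2 : ℝ) ^ n)⁻¹ • w‖ ≤ r := by
    have : Tendsto (fun n : ℕ => ((2 : ℝ) ^ n)⁻¹ * ‖w‖) atTop (𝓝 (0 * ‖w‖)) :=
      (tendsto_inv_atTop_zero.comp (tendsto_pow_atTop_atTop_of_one_lt one_lt_two)).mul_const _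
    rw [zero_mul] at this
    filter_upwards [this.eventually (eventually_le_nhds hr)] with n hn
    rwa [norm_smul, Real.norm_of_nonneg (by positivity)]
  filter_upwards [hlarge] with n hn
  have e := mixedDiff_clm_apply ((2 : ℝ) ^ n • ContinuousLinearMap.id ℝ F) l
    (fun y => f (y + ((2 : ℝ) ^ n)⁻¹ • w) - f y) x
  simp only [ContinuousLinearMap.smul_apply, ContinuousLinearMap.id_apply] at e
  rw [e, mixedDiff_fwdDiff, norm_smul, Real.norm_of_nonneg (by positivity)]
  have hb := h x (by linarith) ((((2 : ℝ) ^ n)⁻¹ • w) :: l) (by simp [hl]) (by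
    intro v hv
    rcases List.mem_cons.1 hv with rfl | hv
    · exact hn
    · have := hlt v hv
      linarith)
  refine (mul_le_mul_of_nonneg_left hb (by positivity)).trans (le_of_eq ?_)
  simp only [List.map_cons, List.prod_cons]
  rw [norm_smul, Real.norm_of_nonneg (by positivity)]
  field_simp

theorem contDiffAt_of_mixedDiffBound_aux {E F : Type u} [NormedAddCommGroup E] [NormedSpace ℝ E]
    [NormedAddCommGroup F] [NormedSpace ℝ F] [CompleteSpace F] (n : ℕ) {f : E → F} {x₀ : E}
    (h : ∀ k, MixedDiffBound f x₀ k) : ContDiffAt ℝ n f x₀ := by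
  induction n generalizing F with
  | zero =>
    have := (h 1).eventually_differentiableAt (h 2)
    obtain ⟨u, hu, hu'⟩ := eventually_iff_exists_mem.1 this
    exact contDiffAt_zero.2 ⟨u, hu, fun x hx => (hu' x hx).continuousAt.continuousWithinAt⟩
  | succ n ih =>
    have hd := (h 1).eventually_differentiableAt (h 2)
    obtain ⟨u, hu, hu'⟩ := eventually_iff_exists_mem.1 hd
    exact contDiffAt_succ_iff_hasFDerivAt.2 ⟨fderiv ℝ f, ⟨u, hu, fun x hx => (hu' x hx).hasFDerivAt⟩,
      ih fun k => (h (k + 1)).fderiv hd⟩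

/-- A function all of whose mixed differences are locally bounded by the product of the
increments is smooth. -/
theorem contDiffAt_of_mixedDiffBound {E : Type*} [NormedAddCommGroup E] [NormedSpace ℝ E]
    (n : ℕ) {f : E → ℂ} {x₀ : E} (h : ∀ k, MixedDiffBound f x₀ k) : ContDiffAt ℝ n f x₀ := by
  have hd := (h 1).eventually_differentiableAt (h 2)
  obtain ⟨u, hu, hu'⟩ := eventually_iff_exists_mem.1 hd
  have : ContDiffAt ℝ (n + 1 : ℕ) f x₀ := contDiffAt_succ_iff_hasFDerivAt.2
    ⟨fderiv ℝ f, ⟨u, hu, fun x hx => (hu' x hx).hasFDerivAt⟩,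
      contDiffAt_of_mixedDiffBound_aux n fun k => (h (k + 1)).fderiv hd⟩
  exact this.of_le (by exact_mod_cast Nat.le_succ n)

end Boman

section Local

/-- A weight matrix has a countable cofinal subfamily. -/
theorem IsWeightMatrix.exists_cofinal {W : Set (ℕ → ℝ)} (hW : IsWeightMatrix W)
    (hne : W.Nonempty) :
    ∃ s : ℕ × ℚ → ℕ → ℝ, (∀ i, s i ∈ W) ∧ ∀ M ∈ W, ∃ i, ∀ k, M k ≤ s i k := by
  obtain ⟨M₀, hM₀⟩ := hne
  by_cases hmax : ∃ M ∈ W, ∀ N ∈ W, ∀ k, N k ≤ M k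
  · obtain ⟨M, hM, h⟩ := hmax
    exact ⟨fun _ => M, fun _ => hM, fun N hN => ⟨(0, 0), h N hN⟩⟩
  push Not at hmax
  have hex : ∀ i : ℕ × ℚ, ∃ N ∈ W, (∃ N' ∈ W, (i.2 : ℝ) < N' i.1) → (i.2 : ℝ) < N i.1 := by
    intro i
    by_cases h : ∃ N' ∈ W, (i.2 : ℝ) < N' i.1
    · obtain ⟨N, hN, h'⟩ := h
      exact ⟨N, hN, fun _ => h'⟩
    · exact ⟨M₀, hM₀, fun h' => absurd h' h⟩
  choose s hs hs' using hex
  refine ⟨s, hs, fun M hM => ?_⟩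
  obtain ⟨N, hN, k, hk⟩ := hmax M hM
  obtain ⟨q, hq₁, hq₂⟩ := exists_rat_btwn hk
  refine ⟨(k, q), ?_⟩
  have h1 := hs' (k, q) ⟨N, hN, hq₂⟩
  rcases hW.ordered M hM _ (hs (k, q)) with h | h
  · exact h
  · exact absurd (h k) (not_le.2 (hq₁.trans h1))

variable {E F : Type*} [NormedAddCommGroup E] [NormedSpace ℝ E]
  [NormedAddCommGroup F] [NormedSpace ℝ F]

/-- Functions in a Roumieu class satisfy uniform bounds near every point. -/
theorem Roumieu.exists_ball_bound {W : Set (ℕ → ℝ)} (hW : IsWeightMatrix W) {U : Set E}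
    (hU : IsOpen U) {f : E → F} (hf : Roumieu W U f) {x₀ : E} (hx₀ : x₀ ∈ U) :
    ∃ M ∈ W, ∃ ρ > 0, ∃ C > 0, ∃ r > 0, ball x₀ r ⊆ U ∧
      ∀ x ∈ ball x₀ r, ∀ k, ‖iteratedFDeriv ℝ k f x‖ ≤ C * ρ ^ k * M k := by
  by_contra! hcon
  obtain ⟨r₀, hr₀, hball⟩ := Metric.isOpen_iff.1 hU x₀ hx₀
  have hne : W.Nonempty := by
    obtain ⟨M, hM, _⟩ := hf.2 ∅ (empty_subset _) isCompact_empty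
    exact ⟨M, hM⟩
  obtain ⟨s, hs, hcof⟩ := hW.exists_cofinal hne
  set R : (ℕ × ℚ) × ℕ → ℝ := fun i => min r₀ (1 / ((Encodable.encode i : ℝ) + 1)) with hR
  have hRpos : ∀ i, 0 < R i := fun i => lt_min hr₀ (by positivity)
  have hbad : ∀ i : (ℕ × ℚ) × ℕ, ∃ x ∈ ball x₀ (R i), ∃ k,
      ((i.2 : ℝ) + 1) * ((i.2 : ℝ) + 1) ^ k * s i.1 k < ‖iteratedFDeriv ℝ k f x‖ := fun i =>
    hcon (s i.1) (hs i.1) (i.2 + 1) (by positivity) (i.2 + 1) (by positivity) (R i) (hRpos i)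
      ((ball_subset_ball (min_le_left _ _)).trans hball)
  choose x hx k hk using hbad
  have hxU : ∀ i, x i ∈ U := fun i => hball (ball_subset_ball (min_le_left _ _) (hx i))
  have hRlim : Tendsto R cofinite (𝓝 0) := by
    have h1 : Tendsto (fun i : (ℕ × ℚ) × ℕ => Encodable.encode i) cofinite atTop := by
      rw [← Nat.cofinite_eq_atTop]
      exact Encodable.encode_injective.tendsto_cofinite
    have h2 := (tendsto_one_div_add_atTop_nhds_zero_nat (𝕜 := ℝ)).comp h1
    exact squeeze_zero (fun i => (hRpos i).le) (fun i => min_le_right _ _) h2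
  have hxlim : Tendsto x cofinite (𝓝 x₀) := by
    rw [tendsto_iff_dist_tendsto_zero]
    exact squeeze_zero (fun i => dist_nonneg) (fun i => (mem_ball.1 (hx i)).le) hRlim
  obtain ⟨M, hM, ρ, hρ, C, hC⟩ := hf.2 (insert x₀ (range x))
    (insert_subset hx₀ (range_subset_iff.2 hxU)) hxlim.isCompact_insert_range_of_cofinite
  obtain ⟨i, hi⟩ := hcof M hM
  obtain ⟨b, hb⟩ := exists_nat_ge (max C ρ)
  have h1 := hC (x (i, b)) (mem_insert_of_mem _ ⟨_, rfl⟩) (k (i, b))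
  rw [iteratedFDerivWithin_of_isOpen _ hU (hxU _)] at h1
  have h2 := hk (i, b)
  have hC' : C ≤ b + 1 := by linarith [le_max_left C ρ]
  have hρ' : ρ ≤ b + 1 := by linarith [le_max_right C ρ]
  have hMpos := (hW.weight M hM).pos (k (i, b))
  have h3 : C * ρ ^ k (i, b) * M (k (i, b))
      ≤ ((b : ℝ) + 1) * ((b : ℝ) + 1) ^ k (i, b) * s i (k (i, b)) := by
    have := hi (k (i, b))
    gcongr
  exact absurd (h1.trans h3) (not_le.2 h2)

/-- Smooth functions with uniform bounds near every point belong to the Roumieu class. -/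
theorem roumieu_of_ball_bound {W : Set (ℕ → ℝ)} (hW : IsWeightMatrix W) (hne : W.Nonempty)
    {U : Set E} (hU : IsOpen U) {f : E → F} (hf : ContDiffOn ℝ (⊤ : ℕ∞) f U)
    (h : ∀ x₀ ∈ U, ∃ M ∈ W, ∃ ρ > 0, ∃ C > 0, ∃ r > 0,
      ∀ x ∈ ball x₀ r, ∀ k, ‖iteratedFDeriv ℝ k f x‖ ≤ C * ρ ^ k * M k) :
    Roumieu W U f := by
  refine ⟨hf, fun K hKU hK => ?_⟩
  suffices ∃ M ∈ W, ∃ ρ > 0, ∃ C > 0, ∀ x ∈ K, ∀ k, ‖iteratedFDeriv ℝ k f x‖ ≤ C * ρ ^ k * M k by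
    obtain ⟨M, hM, ρ, hρ, C, hC, hb⟩ := this
    refine ⟨M, hM, ρ, hρ, C, fun x hx k => ?_⟩
    rw [iteratedFDerivWithin_of_isOpen _ hU (hKU hx)]
    exact hb x hx k
  refine hK.induction_on (p := fun K => ∃ M ∈ W, ∃ ρ > 0, ∃ C > 0, ∀ x ∈ K, ∀ k,
    ‖iteratedFDeriv ℝ k f x‖ ≤ C * ρ ^ k * M k) ?_ ?_ ?_ ?_
  · obtain ⟨M, hM⟩ := hne
    exact ⟨M, hM, 1, one_pos, 1, one_pos, by simp⟩
  · rintro s t hst ⟨M, hM, ρ, hρ, C, hC, hb⟩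
    exact ⟨M, hM, ρ, hρ, C, hC, fun x hx => hb x (hst hx)⟩
  · rintro s t ⟨M, hM, ρ, hρ, C, hC, hb⟩ ⟨M', hM', ρ', hρ', C', hC', hb'⟩
    obtain ⟨N, hN, h1, h2⟩ : ∃ N ∈ W, (∀ k, M k ≤ N k) ∧ ∀ k, M' k ≤ N k := by
      rcases hW.ordered M hM M' hM' with h | h
      · exact ⟨M', hM', h, fun _ => le_rfl⟩
      · exact ⟨M, hM, fun _ => le_rfl, h⟩
    have p1 := (hW.weight M hM).pos
    have p2 := (hW.weight M' hM').pos
    refine ⟨N, hN, max ρ ρ', lt_max_of_lt_left hρ, max C C', lt_max_of_lt_left hC, ?_⟩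
    rintro x (hx | hx) k
    · refine (hb x hx k).trans ?_
      have := p1 k
      have := h1 k
      gcongr
      exacts [le_max_left _ _, le_max_left _ _]
    · refine (hb' x hx k).trans ?_
      have := p2 k
      have := h2 k
      gcongr
      exacts [le_max_right _ _, le_max_right _ _]
  · intro x hx
    obtain ⟨M, hM, ρ, hρ, C, hC, r, hr, hb⟩ := h x (hKU hx)
    exact ⟨ball x r, mem_nhdsWithin_of_mem_nhds (ball_mem_nhds x hr), M, hM, ρ, hρ, C, hC, hb⟩

/-- Uniform bounds for iterated differences along lines give membership in the Roumieu class. -/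
theorem roumieu_of_line_bound {W : Set (ℕ → ℝ)} (hW : IsWeightMatrix W) (hne : W.Nonempty)
    {U : Set E} (hU : IsOpen U) {f : E → ℂ}
    (h : ∀ x₀ ∈ U, ∃ M ∈ W, ∃ ρ > 0, ∃ C > 0, ∃ r > 0, ∀ n, ∃ s > 0,
      ∀ x y, ‖x - x₀‖ < r → ‖y‖ ≤ s → ‖(fwdDiff y)^[n] f x‖ ≤ C * ρ ^ n * M n * ‖y‖ ^ n) :
    Roumieu W U f := by
  have hnn : ∀ M ∈ W, ∀ ρ > 0, ∀ C > 0, ∀ n, 0 ≤ C * ρ ^ n * M n := by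
    intro M hM ρ hρ C hC n
    have := (hW.weight M hM).pos n
    positivity
  have hf : ContDiffOn ℝ (⊤ : ℕ∞) f U := by
    intro x hx
    obtain ⟨M, hM, ρ, hρ, C, hC, r, hr, hb⟩ := h x hx
    refine ContDiffAt.contDiffWithinAt (contDiffAt_infty.2 fun n => ?_)
    refine contDiffAt_of_mixedDiffBound n fun k => ?_
    obtain ⟨s, hs, hb⟩ := hb k
    exact mixedDiffBound_of_line (hnn M hM ρ hρ C hC k) hr hs hb
  refine roumieu_of_ball_bound hW hne hU hf fun x₀ hx₀ => ?_
  obtain ⟨M, hM, ρ, hρ, C, hC, r, hr, hb⟩ := h x₀ hx₀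
  obtain ⟨r', hr', hU'⟩ := Metric.isOpen_iff.1 hU x₀ hx₀
  refine ⟨M, hM, 2 * Real.exp 1 * ρ, by positivity, C, hC, min r r', lt_min hr hr', ?_⟩
  intro x hx k
  obtain ⟨s, hs, hb⟩ := hb k
  rw [mem_ball, dist_eq_norm, lt_min_iff] at hx
  have hxU : x ∈ U := hU' (by rw [mem_ball, dist_eq_norm]; exact hx.2)
  have h0 := hnn M hM ρ hρ C hC k
  have := norm_iteratedFDeriv_le_of_line hU hf hxU h0 (r := r - ‖x - x₀‖)
    (s := s) (by linarith) hs (fun z y hz hy => hb z y (by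
      have := norm_add_le (z - x) (x - x₀)
      rw [sub_add_sub_cancel] at this
      linarith) hy)
  refine this.trans ?_
  have hexp : (k : ℝ) ^ k / k.factorial ≤ Real.exp 1 ^ k := by
    rw [← Real.exp_nat_mul, mul_one]
    exact Real.pow_div_factorial_le_exp _ (by positivity) _
  calc 2 ^ k * (k : ℝ) ^ k / k.factorial * (C * ρ ^ k * M k)
      = 2 ^ k * ((k : ℝ) ^ k / k.factorial) * (C * ρ ^ k * M k) := by ring
    _ ≤ 2 ^ k * Real.exp 1 ^ k * (C * ρ ^ k * M k) := by gcongr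
    _ = C * (2 * Real.exp 1 * ρ) ^ k * M k := by rw [mul_pow, mul_pow]; ring

end Local

section Weights

theorem tendsto_mul_pow_of_rootsTendsto {m : ℕ → ℝ} (hpos : ∀ k, 0 < m k) (hm : RootsTendsto m)
    {t : ℝ} (ht : 0 < t) : Tendsto (fun k => m k * t ^ k) atTop atTop := by
  refine tendsto_atTop_mono' _ ?_ (tendsto_pow_atTop_atTop_of_one_lt (one_lt_two (α := ℝ)))
  filter_upwards [hm.eventually_ge_atTop (2 / t), eventually_ge_atTop 1] with k hk hk1
  have h1 : (m k ^ ((1 : ℝ) / k)) ^ k = m k := by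
    rw [one_div, Real.rpow_inv_natCast_pow (hpos k).le (by omega)]
  calc (2 : ℝ) ^ k = (2 / t) ^ k * t ^ k := by rw [← mul_pow, div_mul_cancel₀ _ ht.ne']
    _ ≤ (m k ^ ((1 : ℝ) / k)) ^ k * t ^ k := by gcongr
    _ = m k * t ^ k := by rw [h1]

/-- `e` is the smallest index minimizing `a k * t ^ k`. -/
def IsLeastArgmin (a : ℕ → ℝ) (t : ℝ) (e : ℕ) : Prop :=
  (∀ k, a e * t ^ e ≤ a k * t ^ k) ∧ ∀ i < e, a e * t ^ e < a i * t ^ i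

theorem exists_isLeastArgmin {a : ℕ → ℝ} {t : ℝ}
    (h : Tendsto (fun k => a k * t ^ k) atTop atTop) : ∃ e, IsLeastArgmin a t e := by
  obtain ⟨e₀, he₀⟩ : ∃ e, ∀ k, a e * t ^ e ≤ a k * t ^ k := by
    obtain ⟨N, hN⟩ := eventually_atTop.1 (h.eventually_ge_atTop (a 0 * t ^ 0))
    obtain ⟨e, he, hmin⟩ := (Finset.range (N + 1)).exists_min_image (fun k => a k * t ^ k) (by simp)
    refine ⟨e, fun k => ?_⟩
    rcases le_total k N with hk | hk
    · exact hmin k (Finset.mem_range.2 (by omega))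
    · exact (hmin 0 (by simp)).trans (hN k hk)
  classical
  have hex : ∃ e, ∀ k, a e * t ^ e ≤ a k * t ^ k := ⟨e₀, he₀⟩
  refine ⟨Nat.find hex, Nat.find_spec hex, fun i hi => ?_⟩
  refine lt_of_le_of_ne (Nat.find_spec hex i) fun heq => Nat.find_min hex hi fun k => ?_
  rw [← heq]
  exact Nat.find_spec hex k

theorem gammaUpper_eq_of_isLeastArgmin {a : ℕ → ℝ} {t : ℝ} (ht : 0 < t) {e : ℕ}
    (h : IsLeastArgmin a t e) : GammaUpper a t = e := by
  have hinf : hfn a t = a e * t ^ e := by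
    rw [hfn, if_neg (not_le.2 ht)]
    exact le_antisymm (ciInf_le ⟨a e * t ^ e, by rintro _ ⟨k, rfl⟩; exact h.1 k⟩ e)
      (le_ciInf h.1)
  refine le_antisymm (Nat.sInf_le hinf) (le_csInf ⟨e, hinf⟩ fun k hk => ?_)
  by_contra! hlt
  have := h.2 k hlt
  rw [mem_ofPred_eq, hinf] at hk
  exact absurd hk this.ne

theorem lt_of_lt_gammaLower {m : ℕ → ℝ} (hpos : ∀ k, 0 < m k) {t : ℝ} (ht : 0 < t) {i : ℕ}
    (hi : i < GammaLower m t) : m (i + 1) * t < m i := by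
  have := Nat.notMem_of_lt_sInf hi
  simp only [mem_ofPred_eq, not_le] at this
  rwa [div_lt_div_iff₀ (hpos i) ht, one_mul] at this

theorem mul_pow_antitone_of_step {m : ℕ → ℝ} {t : ℝ} (ht : 0 < t) {e : ℕ}
    (h : ∀ i < e, m (i + 1) * t ≤ m i) {i j : ℕ} (hij : i ≤ j) (hj : j ≤ e) :
    m j * t ^ j ≤ m i * t ^ i := by
  induction j, hij using Nat.le_induction with
  | base => exact le_rfl
  | succ k hk ih =>
    refine le_trans ?_ (ih (by omega))
    rw [pow_succ', ← mul_assoc]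
    exact mul_le_mul_of_nonneg_right (h k (by omega)) (by positivity)

theorem le_of_isLeastArgmin {m a : ℕ → ℝ} (ha : ∀ k, 0 < a k)
    (h0 : m 0 ≤ a 0) (hlim : ∀ t > 0, Tendsto (fun k => a k * t ^ k) atTop atTop)
    (H : ∀ t > 0, ∀ e, IsLeastArgmin a t e → ∀ i < e, m (i + 1) * t < m i)
    (e : ℕ) {t : ℝ} (ht : 0 < t) (he : IsLeastArgmin a t e) : m e ≤ a e := by
  induction e using Nat.strong_induction_on generalizing t with
  | _ e ih =>
    rcases Nat.eq_zero_or_pos e with rfl | hepos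
    · exact h0
    set τ : ℕ → ℝ := fun i => (a i / a e) ^ (((e - i : ℕ) : ℝ)⁻¹) with hτ
    have hτpos : ∀ i, 0 < τ i := fun i => Real.rpow_pos_of_pos (div_pos (ha i) (ha e)) _
    have hτpow : ∀ i < e, a e * τ i ^ e = a i * τ i ^ i := by
      intro i hi
      have h1 : τ i ^ (e - i) = a i / a e :=
        Real.rpow_inv_natCast_pow (div_pos (ha i) (ha e)).le (by omega)
      have h2 : τ i ^ e = τ i ^ (e - i) * τ i ^ i := by rw [← pow_add, Nat.sub_add_cancel hi.le]
      rw [h2, h1, ← mul_assoc, mul_div_cancel₀ _ (ha e).ne']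
    have hτle : ∀ i < e, ∀ s, 0 < s → (a e * s ^ e < a i * s ^ i ↔ s < τ i) := by
      intro i hi s hs
      have h1 : τ i ^ (e - i) = a i / a e :=
        Real.rpow_inv_natCast_pow (div_pos (ha i) (ha e)).le (by omega)
      have h2 : s ^ e = s ^ (e - i) * s ^ i := by rw [← pow_add, Nat.sub_add_cancel hi.le]
      rw [h2, ← mul_assoc, mul_lt_mul_iff_left₀ (by positivity), mul_comm, ← lt_div_iff₀ (ha e), ← h1,
        pow_lt_pow_iff_left₀ hs.le (hτpos i).le (by omega)]
    obtain ⟨i₀, hi₀, hmin⟩ := (Finset.range e).exists_min_image τ ⟨0, by simpa using hepos⟩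
    rw [Finset.mem_range] at hi₀
    set T := τ i₀ with hT
    have hTpos : 0 < T := hτpos i₀
    have htT : t < T := (hτle i₀ hi₀ t ht).1 (he.2 i₀ hi₀)
    have hgt : ∀ s, t ≤ s → ∀ k, e ≤ k → a e * s ^ e ≤ a k * s ^ k := by
      intro s hs k hk
      have h1 := he.1 k
      have h2 : ∀ u : ℝ, u ^ k = u ^ (k - e) * u ^ e := fun u => by
        rw [← pow_add, Nat.sub_add_cancel hk]
      rw [h2, ← mul_assoc] at h1 ⊢
      have h3 : a e ≤ a k * t ^ (k - e) := le_of_mul_le_mul_right h1 (by positivity)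
      have h4 : a k * t ^ (k - e) ≤ a k * s ^ (k - e) := by
        have := ha k
        gcongr
      have hs0 : 0 < s := ht.trans_le hs
      exact mul_le_mul_of_nonneg_right (h3.trans h4) (by positivity)
    have hArg : ∀ s, t ≤ s → s < T → IsLeastArgmin a s e := by
      intro s hs hsT
      have hlt : ∀ i < e, a e * s ^ e < a i * s ^ i := fun i hi =>
        (hτle i hi s (ht.trans_le hs)).2 (hsT.trans_le (hmin i (Finset.mem_range.2 hi)))
      refine ⟨fun k => ?_, hlt⟩
      rcases lt_or_ge k e with hk | hk
      · exact (hlt k hk).le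
      · exact hgt s hs k hk
    have hstep : ∀ i < e, m (i + 1) * T ≤ m i := by
      intro i hi
      have h1 : Tendsto (fun s => m (i + 1) * s) (𝓝[<] T) (𝓝 (m (i + 1) * T)) :=
        ((continuous_const_mul (m (i + 1))).tendsto T).mono_left nhdsWithin_le_nhds
      refine le_of_tendsto h1 ?_
      filter_upwards [Ioo_mem_nhdsLT htT] with s hs
      exact (H s (ht.trans hs.1) e (hArg s hs.1.le hs.2) i hi).le
    obtain ⟨e', he'⟩ := exists_isLeastArgmin (hlim T hTpos)
    have he'lt : e' < e := by
      by_contra! hge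
      have h1 := he'.2 i₀ (hi₀.trans_le hge)
      have h2 := hgt T htT.le e' hge
      rw [hτpow i₀ hi₀] at h2
      linarith
    have h1 := ih e' he'lt hTpos he'
    have h2 := mul_pow_antitone_of_step hTpos hstep he'lt.le le_rfl
    have h3 : a e' * T ^ e' ≤ a e * T ^ e := he'.1 e
    have h4 : m e' * T ^ e' ≤ a e' * T ^ e' := by gcongr
    exact le_of_mul_le_mul_right ((h2.trans h4).trans h3) (by positivity : 0 < T ^ e)

theorem lc_pos {M : ℕ → ℝ} (hM : IsWeightSeq M) (k : ℕ) : 0 < lc M k :=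
  div_pos (hM.pos k) (by positivity)

/-- The consequence of the first admissibility condition. -/
theorem gammaLower_bounds {M N : ℕ → ℝ} (hM : IsWeightSeq M) (hN : IsWeightSeq N)
    (hNr : RootsTendsto (lc N)) {C : ℝ} (hC : 1 ≤ C)
    (h : ∀ t : ℝ, 0 < t → GammaUpper (lc N) (C * t) ≤ GammaLower (lc M) t)
    {t : ℝ} (ht : 0 < t) :
    (∀ i ≤ GammaLower (lc M) t, lc M i * t ^ i ≤ 1) ∧
      ∀ k, lc M (GammaLower (lc M) t) * t ^ GammaLower (lc M) t ≤ lc N k * (C * t) ^ k := by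
  have hC0 : 0 < C := by linarith
  have hm := lc_pos hM
  have hn := lc_pos hN
  have hm0 : lc M 0 = 1 := by simp [lc, hM.first]
  have hn0 : lc N 0 = 1 := by simp [lc, hN.first]
  set a : ℕ → ℝ := fun k => lc N k * C ^ k with ha
  have hat : ∀ s k, a k * s ^ k = lc N k * (C * s) ^ k := fun s k => by
    simp only [ha, mul_pow, mul_assoc]
  have hApos : ∀ k, 0 < a k := fun k => mul_pos (hn k) (by positivity)
  have hlim : ∀ s > 0, Tendsto (fun k => a k * s ^ k) atTop atTop := fun s hs => by
    simp only [hat]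
    exact tendsto_mul_pow_of_rootsTendsto hn hNr (by positivity)
  have hle : ∀ s > 0, ∀ e, IsLeastArgmin a s e → e ≤ GammaLower (lc M) s := by
    intro s hs e he
    have : IsLeastArgmin (lc N) (C * s) e := by simpa only [IsLeastArgmin, hat] using he
    rw [← gammaUpper_eq_of_isLeastArgmin (by positivity) this]
    exact h s hs
  have hdec : ∀ s > 0, ∀ i < GammaLower (lc M) s, lc M (i + 1) * s ≤ lc M i :=
    fun s hs i hi => (lt_of_lt_gammaLower hm hs hi).le
  refine ⟨fun i hi => ?_, fun k => ?_⟩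
  · have := mul_pow_antitone_of_step ht (hdec t ht) (Nat.zero_le i) hi
    simpa [hm0] using this
  · obtain ⟨e, he⟩ := exists_isLeastArgmin (hlim t ht)
    have h1 := le_of_isLeastArgmin hApos (by simp [ha, hm0, hn0]) hlim
      (fun s hs e he i hi => lt_of_lt_gammaLower hm hs (hi.trans_le (hle s hs e he))) e ht he
    have h2 := mul_pow_antitone_of_step ht (hdec t ht) (hle t ht e he) le_rfl
    rw [← hat]
    refine h2.trans (le_trans ?_ (he.1 k))
    gcongr

/-- The consequence of finite `mg`. -/
theorem exists_of_mg_lt_top {M N : ℕ → ℝ} (hM : IsWeightSeq M) (hN : IsWeightSeq N)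
    (h : mg M N < ⊤) : ∃ A : ℝ, 1 ≤ A ∧ ∀ i k, M (i + k) ≤ A ^ (i + k) * (N i * N k) := by
  refine ⟨max 1 (mg M N).toReal, le_max_left _ _, fun i k => ?_⟩
  rcases Nat.eq_zero_or_pos (i + k) with h0 | h0
  · obtain ⟨rfl, rfl⟩ := Nat.add_eq_zero_iff.1 h0
    simp [hM.first, hN.first]
  have hpos : 0 < N i * N k := mul_pos (hN.pos i) (hN.pos k)
  have hq : 0 ≤ M (i + k) / (N i * N k) := (div_pos (hM.pos _) hpos).le
  have h1 : ENNReal.ofReal ((M (i + k) / (N i * N k)) ^ (((i : ℝ) + (k : ℝ))⁻¹)) ≤ mg M N :=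
    le_iSup_of_le i (le_iSup_of_le k (le_iSup_of_le h0 le_rfl))
  have h2 := (ENNReal.ofReal_le_iff_le_toReal h.ne).1 h1
  have h3 : (M (i + k) / (N i * N k)) ≤ (max 1 (mg M N).toReal) ^ (i + k) := by
    have h4 : ((M (i + k) / (N i * N k)) ^ (((i : ℝ) + (k : ℝ))⁻¹)) ^ (i + k)
        = M (i + k) / (N i * N k) := by
      rw [← Nat.cast_add]
      exact Real.rpow_inv_natCast_pow hq (by omega)
    rw [← h4]
    exact pow_le_pow_left₀ (by positivity) (h2.trans (le_max_right _ _)) _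
  rwa [div_le_iff₀ hpos] at h3

end Weights

section WeightPowers

theorem RAdmissible.exists_lc_two_mul_le {W : Set (ℕ → ℝ)} (hW : RAdmissible W) {N : ℕ → ℝ}
    (hN : N ∈ W) : ∃ N' ∈ W, ∃ A : ℝ, 1 ≤ A ∧
      ∀ k, ∀ t : ℝ, 0 ≤ t → lc N (2 * k) * t ^ (2 * k) ≤ (lc N' k * (A * t) ^ k) ^ 2 := by
  obtain ⟨N', hN', hmg⟩ := hW.mgrowth N hN
  obtain ⟨A, hA, h⟩ := exists_of_mg_lt_top (hW.matrix.weight N hN) (hW.matrix.weight N' hN') hmg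
  refine ⟨N', hN', A, hA, fun k t ht => ?_⟩
  have hpos := (hW.matrix.weight N' hN').pos k
  have h1 : (k.factorial : ℝ) * k.factorial ≤ ((2 * k).factorial : ℝ) := by
    rw [two_mul]
    exact_mod_cast Nat.le_of_dvd (Nat.factorial_pos _) (Nat.factorial_mul_factorial_dvd_factorial_add k k)
  have h2 : N (2 * k) ≤ A ^ (2 * k) * (N' k * N' k) := by simpa [two_mul] using h k k
  calc lc N (2 * k) * t ^ (2 * k)
      ≤ (A ^ (2 * k) * (N' k * N' k)) / ((k.factorial : ℝ) * k.factorial) * t ^ (2 * k) := by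
        unfold lc
        gcongr
    _ = (lc N' k * (A * t) ^ k) ^ 2 := by
        unfold lc
        rw [mul_pow A t, pow_mul' A, pow_mul' t]
        ring

theorem RAdmissible.exists_lc_two_pow_mul_le {W : Set (ℕ → ℝ)} (hW : RAdmissible W) (p : ℕ)
    {N : ℕ → ℝ} (hN : N ∈ W) : ∃ N' ∈ W, ∃ A : ℝ, 1 ≤ A ∧
      ∀ k, ∀ t : ℝ, 0 ≤ t →
        lc N (2 ^ p * k) * t ^ (2 ^ p * k) ≤ (lc N' k * (A * t) ^ k) ^ (2 ^ p) := by
  induction p generalizing N with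
  | zero => exact ⟨N, hN, 1, le_rfl, fun k t _ => by simp⟩
  | succ p ih =>
    obtain ⟨N₁, hN₁, A₁, hA₁, h₁⟩ := hW.exists_lc_two_mul_le hN
    obtain ⟨N₂, hN₂, A₂, hA₂, h₂⟩ := ih hN₁
    refine ⟨N₂, hN₂, A₂ * A₁, by nlinarith, fun k t ht => ?_⟩
    have h3 := h₁ (2 ^ p * k) t ht
    have h4 := h₂ k (A₁ * t) (by positivity)
    have h5 : 0 ≤ lc N₁ (2 ^ p * k) * (A₁ * t) ^ (2 ^ p * k) :=
      mul_nonneg (lc_pos (hW.matrix.weight _ hN₁) _).le (by positivity)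
    rw [show 2 ^ (p + 1) * k = 2 * (2 ^ p * k) by ring, pow_succ 2 p,
      pow_mul (lc N₂ k * (A₂ * A₁ * t) ^ k), mul_assoc A₂]
    exact h3.trans (pow_le_pow_left₀ h5 h4 2)

/-- Bounds at the truncation index, with the weight inequality raised to a power of two. -/
theorem RAdmissible.exists_truncation_bounds {W : Set (ℕ → ℝ)} (hW : RAdmissible W) (p : ℕ)
    {M : ℕ → ℝ} (hM : M ∈ W) : ∃ N ∈ W, ∃ A : ℝ, 1 ≤ A ∧ ∀ t : ℝ, 0 < t → ∃ d : ℕ,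
      (∀ i ≤ d, lc M i * t ^ i ≤ 1) ∧
        ∀ k, lc M d * t ^ d ≤ (lc N k * (A * t) ^ k) ^ (2 ^ p) := by
  obtain ⟨N₁, hN₁, C, hC, h₁⟩ := hW.gamma M hM
  obtain ⟨N₂, hN₂, A, hA, h₂⟩ := hW.exists_lc_two_pow_mul_le p hN₁
  refine ⟨N₂, hN₂, A * C, by nlinarith, fun t ht => ⟨GammaLower (lc M) t, ?_⟩⟩
  obtain ⟨h3, h4⟩ := gammaLower_bounds (hW.matrix.weight M hM) (hW.matrix.weight N₁ hN₁)
    (hW.roots N₁ hN₁) hC h₁ ht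
  refine ⟨h3, fun k => (h4 (2 ^ p * k)).trans ?_⟩
  rw [mul_assoc A]
  exact h₂ k (C * t) (by positivity)

theorem RAdmissible.exists_shift_bounds {W : Set (ℕ → ℝ)} (hW : RAdmissible W)
    {N : ℕ → ℝ} (hN : N ∈ W) : ∃ N' ∈ W, ∃ B : ℝ, 1 ≤ B ∧ ∀ n : ℕ,
      N n ≤ B ^ n * N' n ∧ N (n + 1) ≤ B ^ (n + 1) * N' n ∧ (n.factorial : ℝ) ≤ B * (B ^ n * N' n) := by
  obtain ⟨N', hN', hmg⟩ := hW.mgrowth N hN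
  have hw := hW.matrix.weight N hN
  have hw' := hW.matrix.weight N' hN'
  obtain ⟨A, hA, h⟩ := exists_of_mg_lt_top hw hw' hmg
  obtain ⟨e, he, -⟩ := exists_isLeastArgmin
    (tendsto_mul_pow_of_rootsTendsto (lc_pos hw) (hW.roots N hN) one_pos)
  simp only [one_pow, mul_one] at he
  have hc := lc_pos hw e
  set c := lc N e
  have hA0 : 0 ≤ A := by linarith
  have hone := hw'.one_le
  set B := max (A * N' 1) (c⁻¹) with hB
  have hAB : A ≤ B := (le_mul_of_one_le_right hA0 hone).trans (le_max_left _ _)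
  have hB1 : 1 ≤ B := hA.trans hAB
  have hNn : ∀ n, N n ≤ B ^ n * N' n := fun n => by
    have h1 := h n 0
    simp only [add_zero, hw'.first, mul_one] at h1
    refine h1.trans (mul_le_mul_of_nonneg_right (pow_le_pow_left₀ hA0 hAB n) (hw'.pos n).le)
  refine ⟨N', hN', B, hB1, fun n => ⟨hNn n, ?_, ?_⟩⟩
  · calc N (n + 1) ≤ A ^ (n + 1) * (N' n * N' 1) := h n 1
      _ ≤ A ^ (n + 1) * (N' n * N' 1 ^ (n + 1)) := by
        have := hw'.pos n
        gcongr
        exact le_self_pow₀ hone (by omega)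
      _ = (A * N' 1) ^ (n + 1) * N' n := by rw [mul_pow]; ring
      _ ≤ B ^ (n + 1) * N' n := by
        have := hw'.pos n
        gcongr
        exact le_max_left _ _
  · have h1 : c * n.factorial ≤ N n := by
      have := he n
      rwa [lc, le_div_iff₀ (by positivity)] at this
    calc (n.factorial : ℝ) = c⁻¹ * (c * n.factorial) := by rw [inv_mul_cancel_left₀ hc.ne']
      _ ≤ B * (B ^ n * N' n) :=
        mul_le_mul (le_max_right _ _) (h1.trans (hNn n)) (by positivity) (by positivity)

end WeightPowers

section TwoConstants

theorem norm_le_of_norm_le_real_of_im_pos {P : ℂ → ℂ} {R K q : ℝ} (hR : 0 < R) (hq : 0 < q) (hq1 : q ≤ 1)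
    (hP : DiffContOnCl ℂ P (ball 0 R)) (hK : ∀ z : ℂ, ‖z‖ ≤ R → ‖P z‖ ≤ K)
    (hr : ∀ x : ℝ, |x| ≤ R → ‖P x‖ ≤ K * q ^ 4) {z : ℂ} (hz : ‖z‖ ≤ R / 4) (him : 0 < z.im) :
    ‖P z‖ ≤ K * q := by
  have hK0 : 0 ≤ K := (norm_nonneg _).trans (hK 0 (by simpa using hR.le))
  set l : ℝ := -(4 * Real.log q) with hl
  have hl0 : 0 ≤ l := by have := Real.log_nonpos hq.le hq1; linarith
  have hel : Real.exp (-l) = q ^ 4 := by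
    rw [hl, neg_neg, ← Real.log_rpow hq, Real.exp_log (by positivity)]
    norm_cast
  have hel4 : Real.exp (-(l / 4)) = q := by
    rw [hl, show -(-(4 * Real.log q) / 4) = Real.log q by ring, Real.exp_log hq]
  set e : ℂ → ℂ := fun w => Complex.exp (l * (1 - (w / R) ^ 2 + 2 * Complex.I * (w / R))) with he
  have hen : ∀ w : ℂ, ‖e w‖ = Real.exp (l * (1 - (w.re / R) ^ 2 + (w.im / R) ^ 2 - 2 * (w.im / R))) := by
    intro w
    rw [he, Complex.norm_exp, Complex.re_ofReal_mul]
    congr 2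
    have h1 : (w / R).re = w.re / R := Complex.div_ofReal_re w R
    have h2 : (w / R).im = w.im / R := Complex.div_ofReal_im w R
    simp [pow_two, h1, h2, Complex.mul_re, Complex.mul_im]
    ring
  set V : Set ℂ := {w | 0 < w.im} ∩ ball 0 R with hV
  have hdiff : DiffContOnCl ℂ (fun w => P w * e w) V := by
    have h1 : DiffContOnCl ℂ P V := hP.mono inter_subset_right
    have h2 : Differentiable ℂ e := by rw [he]; fun_prop
    exact h1.smul h2.diffContOnCl
  have hVb : Bornology.IsBounded V := isBounded_ball.subset inter_subset_right
  have hVo : IsOpen V := (isOpen_lt continuous_const Complex.continuous_im).inter isOpen_ball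
  have hsub : closure V ⊆ {w | 0 ≤ w.im ∧ ‖w‖ ≤ R} := by
    refine closure_minimal ?_ ((isClosed_le continuous_const Complex.continuous_im).inter
      (isClosed_le continuous_norm continuous_const))
    rintro w ⟨h1, h2⟩
    exact ⟨le_of_lt h1, by simpa using (mem_ball_zero_iff.1 h2).le⟩
  have hfr : ∀ w ∈ frontier V, ‖P w * e w‖ ≤ K := by
    intro w hw
    obtain ⟨h1, h2⟩ := hsub (frontier_subset_closure hw)
    have h3 : w ∉ V := by rw [hVo.frontier_eq] at hw; exact hw.2
    rw [norm_mul, hen]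
    rcases h1.eq_or_lt with h0 | h0
    · have hw' : w = (w.re : ℂ) := Complex.ext rfl (by simpa using h0.symm)
      have h4 : ‖P w‖ ≤ K * q ^ 4 := by
        rw [hw']; exact hr _ ((Complex.abs_re_le_norm w).trans h2)
      rw [← h0]
      calc ‖P w‖ * Real.exp (l * (1 - (w.re / R) ^ 2 + (0 / R) ^ 2 - 2 * (0 / R)))
          ≤ (K * q ^ 4) * Real.exp l := by
            gcongr
            have : 0 ≤ l * (w.re / R) ^ 2 := by positivity
            simp only [zero_div]
            nlinarith
        _ = K := by rw [← hel, mul_assoc, ← Real.exp_add]; simp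
    · have h4 : ‖w‖ = R := by
        by_contra hne
        exact h3 ⟨h0, mem_ball_zero_iff.2 (lt_of_le_of_ne h2 hne)⟩
      have h5 : (w.re / R) ^ 2 + (w.im / R) ^ 2 = 1 := by
        have := Complex.sq_norm w
        rw [h4, Complex.normSq_apply] at this
        field_simp
        linarith
      have h6 : w.im / R ≤ 1 := by
        rw [div_le_one hR, ← h4]
        exact (le_abs_self _).trans (Complex.abs_im_le_norm w)
      have h7 : 0 ≤ w.im / R := by positivity
      calc ‖P w‖ * Real.exp (l * (1 - (w.re / R) ^ 2 + (w.im / R) ^ 2 - 2 * (w.im / R)))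
          ≤ K * Real.exp 0 := by
            gcongr
            · exact hK w h2
            · exact mul_nonpos_of_nonneg_of_nonpos hl0 (by nlinarith)
        _ = K := by simp
  have hzV : z ∈ closure V := subset_closure ⟨him, mem_ball_zero_iff.2 (by linarith)⟩
  have hmain := Complex.norm_le_of_forall_mem_frontier_norm_le hVb hdiff hfr hzV
  rw [norm_mul, hen] at hmain
  have h8 : 1 / 4 ≤ 1 - (z.re / R) ^ 2 + (z.im / R) ^ 2 - 2 * (z.im / R) := by
    have h1 : |z.re / R| ≤ 1 / 4 := by
      rw [abs_div, abs_of_pos hR, div_le_iff₀ hR]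
      linarith [Complex.abs_re_le_norm z]
    have h2 : z.im / R ≤ 1 / 4 := by
      rw [div_le_iff₀ hR]
      linarith [Complex.abs_im_le_norm z, le_abs_self z.im]
    have h3 := sq_le_sq' (abs_le.1 h1).1 (abs_le.1 h1).2
    nlinarith [sq_nonneg (z.im / R)]
  have h9 : ‖P z‖ * Real.exp (l / 4) ≤ K := by
    refine le_trans ?_ hmain
    gcongr
    nlinarith
  calc ‖P z‖ = (‖P z‖ * Real.exp (l / 4)) * Real.exp (-(l / 4)) := by
        rw [mul_assoc, ← Real.exp_add]; simp
    _ ≤ K * q := by rw [hel4]; gcongr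

/-- A two-constants estimate: a function small on the real diameter of a disc is small on a
smaller disc. -/
theorem norm_le_of_norm_le_real {P : ℂ → ℂ} {R K q : ℝ} (hR : 0 < R) (hq : 0 < q) (hq1 : q ≤ 1)
    (hP : DiffContOnCl ℂ P (ball 0 R)) (hK : ∀ z : ℂ, ‖z‖ ≤ R → ‖P z‖ ≤ K)
    (hr : ∀ x : ℝ, |x| ≤ R → ‖P x‖ ≤ K * q ^ 4) {z : ℂ} (hz : ‖z‖ ≤ R / 4) :
    ‖P z‖ ≤ K * q := by
  have hK0 : 0 ≤ K := (norm_nonneg _).trans (hK 0 (by simpa using hR.le))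
  rcases lt_trichotomy z.im 0 with him | him | him
  · have h1 : DiffContOnCl ℂ (fun w => P (-w)) (ball 0 R) := by
      refine hP.comp (g := fun w : ℂ => -w) differentiable_neg.diffContOnCl fun w hw => ?_
      simpa using hw
    have := norm_le_of_norm_le_real_of_im_pos (z := -z) hR hq hq1 h1
      (fun w hw => hK (-w) (by simpa using hw))
      (fun x hx => by simpa using hr (-x) (by simpa using hx)) (by simpa using hz) (by simpa using him)
    simpa using this
  · have hz' : z = (z.re : ℂ) := Complex.ext rfl (by simpa using him)
    rw [hz']
    refine (hr _ ((Complex.abs_re_le_norm z).trans (by linarith))).trans ?_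
    gcongr
    exact pow_le_of_le_one hq.le hq1 (by norm_num)
  · exact norm_le_of_norm_le_real_of_im_pos hR hq hq1 hP hK hr hz him

end TwoConstants

section HolomorphicDifferences

theorem fwdDiff_bound_of_differentiableOn {F : ℂ → ℂ} {R Q s τ : ℝ} (hs : 0 ≤ s) (hτ : 0 < τ)
    (hF : DifferentiableOn ℂ F (ball 0 R)) (hQ : ∀ z ∈ ball (0 : ℂ) R, ‖F z‖ ≤ Q) :
    DifferentiableOn ℂ (fwdDiff (s : ℂ) F) (ball 0 (R - (s + τ))) ∧
      ∀ z ∈ ball (0 : ℂ) (R - (s + τ)), ‖fwdDiff (s : ℂ) F z‖ ≤ Q * (s / τ) := by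
  have hns : ‖(s : ℂ)‖ = s := by rw [Complex.norm_real, Real.norm_of_nonneg hs]
  have hmem : ∀ z ∈ ball (0 : ℂ) (R - (s + τ)), z ∈ ball (0 : ℂ) (R - τ) ∧
      z + s ∈ ball (0 : ℂ) (R - τ) := by
    intro z hz
    rw [mem_ball_zero_iff] at hz ⊢
    refine ⟨by linarith, ?_⟩
    rw [mem_ball_zero_iff]
    linarith [norm_add_le z s]
  have hsub : ball (0 : ℂ) (R - τ) ⊆ ball 0 R := ball_subset_ball (by linarith)
  refine ⟨?_, fun z hz => ?_⟩
  · refine DifferentiableOn.sub ?_ (hF.mono fun z hz => hsub (hmem z hz).1)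
    exact hF.comp (by fun_prop) fun z hz => hsub (hmem z hz).2
  · have hd : ∀ w ∈ ball (0 : ℂ) (R - τ), ‖deriv F w‖ ≤ Q / τ := by
      intro w hw
      rw [mem_ball_zero_iff] at hw
      have hcb : closedBall w τ ⊆ ball 0 R := by
        intro v hv
        rw [mem_closedBall, dist_eq_norm] at hv
        rw [mem_ball_zero_iff]
        calc ‖v‖ = ‖(v - w) + w‖ := by simp
          _ ≤ ‖v - w‖ + ‖w‖ := norm_add_le _ _
          _ < R := by linarith
      refine Complex.norm_deriv_le_of_forall_mem_sphere_norm_le hτ ?_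
        fun v hv => hQ v (hcb (sphere_subset_closedBall hv))
      exact (hF.mono (by rw [closure_ball _ hτ.ne']; exact hcb)).diffContOnCl
    have := (convex_ball (0 : ℂ) (R - τ)).norm_image_sub_le_of_norm_deriv_le
      (fun w hw => hF.differentiableAt (isOpen_ball.mem_nhds (hsub hw))) hd
      (hmem z hz).1 (hmem z hz).2
    rw [add_sub_cancel_left, hns] at this
    rw [fwdDiff]
    exact this.trans (le_of_eq (by ring))

theorem iterate_fwdDiff_bound_of_differentiableOn {F : ℂ → ℂ} {R Q s τ : ℝ} (hs : 0 ≤ s)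
    (hτ : 0 < τ) (hF : DifferentiableOn ℂ F (ball 0 R)) (hQ : ∀ z ∈ ball (0 : ℂ) R, ‖F z‖ ≤ Q)
    (i : ℕ) :
    DifferentiableOn ℂ ((fwdDiff (s : ℂ))^[i] F) (ball 0 (R - i * (s + τ))) ∧
      ∀ z ∈ ball (0 : ℂ) (R - i * (s + τ)), ‖(fwdDiff (s : ℂ))^[i] F z‖ ≤ Q * (s / τ) ^ i := by
  induction i with
  | zero => simpa only [Nat.cast_zero, zero_mul, sub_zero, Function.iterate_zero, id, pow_zero,
      mul_one] using ⟨hF, hQ⟩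
  | succ i ih =>
    have := fwdDiff_bound_of_differentiableOn hs hτ ih.1 ih.2
    rw [Function.iterate_succ_apply', pow_succ, ← mul_assoc,
      show R - ((i + 1 : ℕ) : ℝ) * (s + τ) = R - i * (s + τ) - (s + τ) by push_cast; ring]
    exact this

theorem natCast_pow_self_le (n : ℕ) : (n : ℝ) ^ n ≤ 3 ^ n * n.factorial := by
  have h1 := Real.pow_div_factorial_le_exp (n : ℝ) n.cast_nonneg n
  rw [div_le_iff₀ (by positivity)] at h1
  refine h1.trans ?_
  gcongr
  rw [← mul_one (n : ℝ), Real.exp_nat_mul]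
  gcongr
  exact Real.exp_one_lt_three.le

/-- Iterated differences at the origin of a bounded holomorphic function on a disc. -/
theorem norm_iterate_fwdDiff_le_of_differentiableOn {F : ℂ → ℂ} {R Q s : ℝ} (hR : 0 < R)
    (hs : 0 ≤ s) (hF : DifferentiableOn ℂ F (ball 0 R)) (hQ : ∀ z ∈ ball (0 : ℂ) R, ‖F z‖ ≤ Q)
    {n : ℕ} (hn : 1 ≤ n) (hns : n * s ≤ R / 4) :
    ‖(fwdDiff s)^[n] (fun t : ℝ => F t) 0‖ ≤ Q * (12 / R) ^ n * n.factorial * s ^ n := by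
  have hn0 : (0 : ℝ) < n := by exact_mod_cast hn
  have hQ0 : 0 ≤ Q := (norm_nonneg _).trans (hQ 0 (by simpa using hR))
  have hτ : 0 < R / (4 * n) := by positivity
  have key := (iterate_fwdDiff_bound_of_differentiableOn hs hτ hF hQ n).2 0 (by
    rw [mem_ball_zero_iff, norm_zero]
    have : (n : ℝ) * (s + R / (4 * n)) = n * s + R / 4 := by field_simp
    rw [this]; linarith)
  have hreal : (fwdDiff s)^[n] (fun t : ℝ => F t) 0 = (fwdDiff (s : ℂ))^[n] F 0 := by
    rw [fwdDiff_iter_eq_sum_shift, fwdDiff_iter_eq_sum_shift]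
    simp
  have hfac := natCast_pow_self_le n
  rw [hreal]
  refine key.trans ?_
  rw [show s / (R / (4 * n)) = (4 / R) * s * n by field_simp, mul_pow, mul_pow]
  calc Q * ((4 / R) ^ n * s ^ n * n ^ n) ≤ Q * ((4 / R) ^ n * s ^ n * (3 ^ n * n.factorial)) := by
        gcongr
    _ = Q * (12 / R) ^ n * n.factorial * s ^ n := by
        rw [show (12 : ℝ) / R = 4 / R * 3 by ring, mul_pow]; ring

theorem norm_iterate_fwdDiff_le {φ : ℝ → ℂ} {s Q : ℝ} (n : ℕ)
    (h : ∀ k ≤ n, ‖φ (k * s)‖ ≤ Q) : ‖(fwdDiff s)^[n] φ 0‖ ≤ 2 ^ n * Q := by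
  rw [fwdDiff_iter_eq_sum_shift]
  have h1 : (2 : ℝ) ^ n * Q = ∑ k ∈ Finset.range (n + 1), (n.choose k : ℝ) * Q := by
    rw [← Finset.sum_mul, ← Nat.cast_sum, Nat.sum_range_choose]; simp
  rw [h1]
  refine norm_sum_le_of_le _ fun k hk => ?_
  have h2 := h k (by simpa [Nat.lt_succ_iff] using Finset.mem_range.1 hk)
  simp only [nsmul_eq_mul, zero_add, zsmul_eq_mul, norm_mul]
  push_cast
  rw [norm_mul]
  simp
  gcongr

end HolomorphicDifferences

section CauchyPompeiu

open MeasureTheory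

/-- The Wirtinger derivative `∂̄`. -/
def dbar (f : ℂ → ℂ) (z : ℂ) : ℂ := (fderiv ℝ f z 1 + Complex.I * fderiv ℝ f z Complex.I) / 2

theorem integrableOn_polar_of_continuous {A : ℝ × ℝ → ℂ} (hA : Continuous A) {R : ℝ}
    (h0 : ∀ p, R < p.1 → A p = 0) :
    IntegrableOn A (Ioi (0 : ℝ) ×ˢ Ioo (-Real.pi) Real.pi) := by
  have h1 : IntegrableOn A (Icc (0 : ℝ) R ×ˢ Icc (-Real.pi) Real.pi) :=
    hA.continuousOn.integrableOn_compact (isCompact_Icc.prod isCompact_Icc)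
  refine h1.of_forall_sdiff_eq_zero (measurableSet_Ioi.prod measurableSet_Ioo) ?_
  rintro p ⟨⟨h2, h3⟩, h4⟩
  refine h0 p ?_
  by_contra! h5
  exact h4 ⟨⟨le_of_lt h2, h5⟩, ⟨h3.1.le, h3.2.le⟩⟩

/-- The Cauchy–Pompeiu formula at the origin. -/
theorem integral_dbar_div {f : ℂ → ℂ} (hf : ContDiff ℝ 1 f) (hc : HasCompactSupport f) :
    ∫ z, dbar f z / z = -Real.pi * f 0 := by
  obtain ⟨R, hR⟩ := hc.isCompact.isBounded.subset_closedBall (0 : ℂ)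
  have hfd : Continuous (fderiv ℝ f) := hf.continuous_fderiv (by norm_num)
  have hdiff : ∀ z, HasFDerivAt f (fderiv ℝ f z) z := fun z =>
    (hf.differentiable (by norm_num) z).hasFDerivAt
  set R' := max R 0
  have hout : ∀ z : ℂ, R' < ‖z‖ → f z = 0 ∧ fderiv ℝ f z = 0 := by
    intro z hz
    have h1 : z ∉ tsupport f := fun h => by
      have := hR h
      rw [mem_closedBall_zero_iff] at this
      linarith [le_max_left R 0]
    refine ⟨image_eq_zero_of_notMem_tsupport h1, ?_⟩
    by_contra h2
    exact h1 (support_fderiv_subset ℝ h2)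
  set e : ℝ → ℂ := fun θ => Complex.exp (θ * Complex.I) with he
  have hecont : Continuous e := by rw [he]; fun_prop
  have hen : ∀ θ, ‖e θ‖ = 1 := fun θ => Complex.norm_exp_ofReal_mul_I θ
  have hrn : ∀ p : ℝ × ℝ, R' < p.1 → R' < ‖(p.1 : ℂ) * e p.2‖ := fun p hp => by
    rw [norm_mul, hen, mul_one, Complex.norm_real]
    exact hp.trans_le (le_abs_self _)
  set A : ℝ × ℝ → ℂ := fun p => fderiv ℝ f (p.1 * e p.2) (e p.2) with hA
  set B : ℝ × ℝ → ℂ := fun p => fderiv ℝ f (p.1 * e p.2) (Complex.I * e p.2) with hB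
  have hpc : Continuous fun p : ℝ × ℝ => fderiv ℝ f (p.1 * e p.2) := by fun_prop
  have hAc : Continuous A := hpc.clm_apply (by fun_prop)
  have hBc : Continuous B := hpc.clm_apply (by fun_prop)
  have hA0 : ∀ p, R' < p.1 → A p = 0 := fun p hp => by simp [hA, (hout _ (hrn p hp)).2]
  have hB0 : ∀ p, R' < p.1 → B p = 0 := fun p hp => by simp [hB, (hout _ (hrn p hp)).2]
  have hAi := integrableOn_polar_of_continuous hAc hA0
  have hBi := integrableOn_polar_of_continuous hBc hB0
  have hpolar : ∫ z, dbar f z / z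
      = ∫ p in Ioi (0 : ℝ) ×ˢ Ioo (-Real.pi) Real.pi, (A p + Complex.I * B p) / 2 := by
    rw [← Complex.integral_comp_polarCoord_symm, polarCoord_target]
    refine setIntegral_congr_fun (measurableSet_Ioi.prod measurableSet_Ioo) ?_
    rintro ⟨r, θ⟩ ⟨hr, -⟩
    have hr0 : (r : ℂ) ≠ 0 := by exact_mod_cast (ne_of_gt hr)
    have he' : e θ = (Real.cos θ : ℂ) + Real.sin θ * Complex.I := by
      simp [he, Complex.exp_mul_I]
    have hsym : Complex.polarCoord.symm (r, θ) = r * e θ := by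
      rw [Complex.polarCoord_symm_apply, he']
    have hlin : ∀ L : ℂ →L[ℝ] ℂ, ∀ a b : ℝ, L (a + b * Complex.I) = a * L 1 + b * L Complex.I := by
      intro L a b
      rw [show (a : ℂ) + b * Complex.I = a • (1 : ℂ) + b • Complex.I by simp, map_add, map_smul,
        map_smul]
      simp
    have hL1 := hlin (fderiv ℝ f (r * e θ)) (Real.cos θ) (Real.sin θ)
    have hL2 := hlin (fderiv ℝ f (r * e θ)) (-Real.sin θ) (Real.cos θ)
    rw [← he'] at hL1
    have he2 : ((-Real.sin θ : ℝ) : ℂ) + Real.cos θ * Complex.I = Complex.I * e θ := by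
      rw [he']
      push_cast
      linear_combination -(Complex.sin θ) * Complex.I_sq
    rw [he2] at hL2
    have hcs : (Complex.cos θ) ^ 2 + (Complex.sin θ) ^ 2 = 1 := by
      rw [add_comm]; exact Complex.sin_sq_add_cos_sq θ
    have hne : e θ ≠ 0 := Complex.exp_ne_zero _
    simp only [hA, hB, hsym, dbar, hL1, hL2, Complex.real_smul]
    field_simp
    rw [he']
    push_cast
    generalize fderiv ℝ f _ 1 = a
    generalize fderiv ℝ f _ Complex.I = b
    generalize Complex.cos θ = c at *
    generalize Complex.sin θ = d at *
    linear_combination (-(a + Complex.I * b)) * hcs + (a * d ^ 2 - b * c * d) * Complex.I_sq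
  have hIA : ∫ p in Ioi (0 : ℝ) ×ˢ Ioo (-Real.pi) Real.pi, A p = -(2 * Real.pi) * f 0 := by
    have hr : ∀ θ : ℝ, ∫ r in Ioi (0 : ℝ), A (r, θ) = - f 0 := by
      intro θ
      have hd : ∀ r ∈ Ici (0 : ℝ), HasDerivAt (fun r : ℝ => f (r * e θ)) (A (r, θ)) r := by
        intro r _
        have h1 : HasDerivAt (fun r : ℝ => (r : ℂ) * e θ) (e θ) r := by
          simpa using (Complex.ofRealCLM.hasDerivAt (x := r)).mul_const (e θ)
        exact (hdiff (r * e θ)).comp_hasDerivAt r h1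
      have hi : IntegrableOn (fun r => A (r, θ)) (Ioi 0) := by
        have h1 : IntegrableOn (fun r => A (r, θ)) (Icc 0 R') :=
          (by fun_prop : Continuous fun r => A (r, θ)).continuousOn.integrableOn_compact isCompact_Icc
        refine h1.of_forall_sdiff_eq_zero measurableSet_Ioi ?_
        rintro r ⟨h2, h3⟩
        refine hA0 (r, θ) ?_
        by_contra! h5
        exact h3 ⟨le_of_lt h2, h5⟩
      have hlim : Tendsto (fun r : ℝ => f (r * e θ)) atTop (𝓝 0) := by
        refine tendsto_const_nhds.congr' ?_
        filter_upwards [eventually_gt_atTop R'] with r hr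
        exact (hout _ (hrn (r, θ) hr)).1.symm
      have := integral_Ioi_of_hasDerivAt_of_tendsto' hd hi hlim
      simpa using this
    have hAi' := hAi
    rw [IntegrableOn, Measure.volume_eq_prod, ← Measure.prod_restrict] at hAi'
    rw [Measure.volume_eq_prod, ← Measure.prod_restrict, integral_prod_symm _ hAi']
    simp only [hr, integral_const]
    simp [Real.pi_pos.le]
    exact Or.inl (by ring)
  have hIB : ∫ p in Ioi (0 : ℝ) ×ˢ Ioo (-Real.pi) Real.pi, B p = 0 := by
    have hθ : ∀ r ∈ Ioi (0 : ℝ), ∫ θ in Ioo (-Real.pi) Real.pi, B (r, θ) = 0 := by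
      intro r hr
      have hr0 : (r : ℂ) ≠ 0 := by exact_mod_cast (ne_of_gt hr)
      have hd : ∀ θ ∈ uIcc (-Real.pi) Real.pi,
          HasDerivAt (fun θ : ℝ => f (r * e θ)) (r * B (r, θ)) θ := by
        intro θ _
        have h0 : HasDerivAt (fun θ : ℝ => (θ : ℂ) * Complex.I) Complex.I θ := by
          simpa using (Complex.ofRealCLM.hasDerivAt (x := θ)).mul_const Complex.I
        have h1 : HasDerivAt (fun θ : ℝ => (r : ℂ) * e θ) (r • (Complex.I * e θ)) θ := by
          rw [Complex.real_smul, mul_comm Complex.I]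
          exact (h0.cexp).const_mul (r : ℂ)
        have := (hdiff (r * e θ)).comp_hasDerivAt θ h1
        rw [map_smul, Complex.real_smul] at this
        exact this
      have := intervalIntegral.integral_eq_sub_of_hasDerivAt hd
        ((by fun_prop : Continuous fun θ : ℝ => (r : ℂ) * B (r, θ)).intervalIntegrable _ _)
      have hends : e Real.pi = e (-Real.pi) := by
        simp [he, Complex.exp_neg, Complex.exp_pi_mul_I]
      rw [hends, sub_self, intervalIntegral.integral_const_mul] at this
      have h2 := (mul_eq_zero.1 this).resolve_left hr0
      rwa [intervalIntegral.integral_of_le (by linarith [Real.pi_pos]),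
        integral_Ioc_eq_integral_Ioo] at h2
    have hBi' := hBi
    rw [Measure.volume_eq_prod] at hBi' ⊢
    rw [setIntegral_prod _ hBi', setIntegral_congr_fun measurableSet_Ioi hθ]
    simp
  rw [hpolar, integral_div, integral_add hAi (hBi.const_mul _), integral_const_mul, hIA, hIB]
  ring

theorem dbar_comp_add (f : ℂ → ℂ) (w z : ℂ) : dbar (fun z => f (z + w)) z = dbar f (z + w) := by
  simp only [dbar, fderiv_comp_add_right]

/-- The Cauchy–Pompeiu formula. -/
theorem integral_dbar_div_sub {f : ℂ → ℂ} (hf : ContDiff ℝ 1 f) (hc : HasCompactSupport f)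
    (w : ℂ) : ∫ z, dbar f z / (z - w) = -Real.pi * f w := by
  have h1 := integral_dbar_div (f := fun z => f (z + w)) (hf.comp (contDiff_id.add contDiff_const))
    (hc.comp_homeomorph (Homeomorph.addRight w))
  rw [zero_add] at h1
  rw [← h1, ← integral_add_right_eq_self _ w]
  simp [dbar_comp_add]

end CauchyPompeiu

section PointwiseEstimates

theorem norm_pow_sub_pow_le {a b : ℂ} {L : ℝ} (hL : 0 ≤ L) (ha : ‖a‖ ≤ L) (hb : ‖b‖ ≤ L) (n : ℕ) :
    ‖a ^ (n + 1) - b ^ (n + 1)‖ ≤ (n + 1) * L ^ n * ‖a - b‖ := by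
  induction n with
  | zero => simp
  | succ n ih =>
    have h1 : a ^ (n + 1 + 1) - b ^ (n + 1 + 1) = a ^ (n + 1) * (a - b) + (a ^ (n + 1) - b ^ (n + 1)) * b := by
      ring
    have h2 : ‖a ^ (n + 1)‖ ≤ L ^ (n + 1) := by rw [norm_pow]; gcongr
    calc _ ≤ ‖a ^ (n + 1)‖ * ‖a - b‖ + ‖a ^ (n + 1) - b ^ (n + 1)‖ * ‖b‖ := by
          rw [h1, ← norm_mul, ← norm_mul]; exact norm_add_le _ _
      _ ≤ L ^ (n + 1) * ‖a - b‖ + ((n + 1) * L ^ n * ‖a - b‖) * L := by gcongr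
      _ = _ := by push_cast; ring

theorem le_add_of_pow_le {a b c : ℝ} {j : ℕ} (hj : j ≠ 0) (hb : 0 ≤ b) (hc : 0 ≤ c)
    (h : a ^ j ≤ b ^ j + c ^ j) : a ≤ b + c := by
  by_contra! hlt
  have h1 := pow_lt_pow_left₀ hlt (by positivity) hj
  have h2 := pow_add_pow_le hb hc hj
  linarith

theorem le_mul_of_pow_le {a b K : ℝ} {j : ℕ} (hj : j ≠ 0) (hb : 0 ≤ b) (hK : 1 ≤ K)
    (h : a ^ j ≤ K * b ^ j) : a ≤ K * b := by
  by_contra! hlt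
  have h1 := pow_lt_pow_left₀ hlt (by positivity) hj
  have h2 : K * b ^ j ≤ K ^ j * b ^ j := by gcongr; exact le_self_pow₀ hK hj
  rw [mul_pow] at h1
  linarith

theorem mul_sq_le_of_pow {α p : ℝ} {j : ℕ} (hj : 1 ≤ j) (hα : 0 ≤ α) :
    α * (p ^ (2 * j)) ^ 2 ≤ p ^ 2 * (α ^ (2 * j) + (p ^ (2 * j)) ^ 2) := by
  rcases le_total α (p ^ 2) with h | h
  · have h1 : α * (p ^ (2 * j)) ^ 2 ≤ p ^ 2 * (p ^ (2 * j)) ^ 2 := by gcongr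
    have h2 : 0 ≤ p ^ 2 * α ^ (2 * j) := by positivity
    linarith
  · obtain ⟨i, rfl⟩ : ∃ i, j = i + 1 := ⟨j - 1, by omega⟩
    have h1 : (p ^ 2) ^ (2 * i + 1) ≤ α ^ (2 * i + 1) := by gcongr
    calc α * (p ^ (2 * (i + 1))) ^ 2 = p ^ 2 * (α * (p ^ 2) ^ (2 * i + 1)) := by ring
      _ ≤ p ^ 2 * (α * α ^ (2 * i + 1)) := by gcongr
      _ ≤ p ^ 2 * (α ^ (2 * (i + 1)) + (p ^ (2 * (i + 1))) ^ 2) := by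
        gcongr
        have : 0 ≤ (p ^ (2 * (i + 1))) ^ 2 := by positivity
        rw [show α * α ^ (2 * i + 1) = α ^ (2 * (i + 1)) by ring]
        linarith

/-- Estimates on `h g / (g² + η²)` with `η = p ^ (2 j)` when `h` is nearly `g ^ (1 + 1 / j)`. -/
theorem quotient_estimates {g h p K K₁ : ℝ} {j : ℕ} (hj : 1 ≤ j) (hg : 0 ≤ g)
    (hp : 0 < p) (hp1 : p ≤ 1) (hK : 1 ≤ K) (hK₁ : 1 ≤ K₁) (hgK : g ≤ K)
    (hP : h ^ j ≤ g ^ (j + 1) + K₁ * (p ^ (2 * j)) ^ (2 * j)) :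
    h * g / (g ^ 2 + (p ^ (2 * j)) ^ 2) ≤ (1 + K₁) * K ∧
    h * g * (p ^ (2 * j)) ^ 2 / (g ^ 2 + (p ^ (2 * j)) ^ 2) ^ 2 ≤ (1 + K₁) * p ^ 2 ∧
    h * (p ^ (2 * j)) ^ 2 / (g ^ 2 + (p ^ (2 * j)) ^ 2) ^ 2 ≤ (1 + K₁) * (p ^ 2 / p ^ (2 * j)) := by
  have hj0 : j ≠ 0 := by omega
  obtain ⟨α, hα, rfl⟩ : ∃ α, 0 ≤ α ∧ α ^ j = g :=
    ⟨g ^ ((j : ℝ)⁻¹), by positivity, Real.rpow_inv_natCast_pow hg hj0⟩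
  have hηp : p ^ (2 * j) ≤ p ^ 2 := pow_le_pow_of_le_one hp.le hp1 (by omega)
  have hkey := mul_sq_le_of_pow (p := p) hj hα
  set η := p ^ (2 * j) with hη
  have hη0 : 0 < η := by positivity
  have hη1 : η ≤ 1 := pow_le_one₀ hp.le hp1
  have hhle : h ≤ α ^ (j + 1) + K₁ * η ^ 2 := by
    refine le_add_of_pow_le hj0 (by positivity) (by positivity) (hP.trans ?_)
    have h1 : K₁ * η ^ (2 * j) ≤ (K₁ * η ^ 2) ^ j := by
      rw [mul_pow, pow_mul η]
      gcongr
      exact le_self_pow₀ hK₁ hj0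
    have h2 : (α ^ j) ^ (j + 1) = (α ^ (j + 1)) ^ j := by rw [← pow_mul, ← pow_mul, mul_comm]
    rw [h2]; linarith
  have hαK : α ≤ K := by
    have := le_mul_of_pow_le (K := K) hj0 zero_le_one hK (by simpa using hgK : α ^ j ≤ K * 1 ^ j)
    simpa using this
  have hsq : α ^ (2 * j) = (α ^ j) ^ 2 := by rw [← pow_mul, mul_comm]
  rw [hsq] at hkey
  have hsucc : α ^ (j + 1) = α * α ^ j := by ring
  rw [hsucc] at hhle
  set g := α ^ j
  set D := g ^ 2 + η ^ 2 with hD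
  have hD0 : 0 < D := by positivity
  have hgη : g * η ≤ D := by nlinarith [sq_nonneg (g - η)]
  have hg2 : g ^ 2 ≤ D := by nlinarith
  have hη2 : η ^ 2 ≤ D := by nlinarith
  refine ⟨?_, ?_, ?_⟩
  · rw [div_le_iff₀ hD0]
    calc h * g ≤ (α * g + K₁ * η ^ 2) * g := by gcongr
      _ = α * g ^ 2 + K₁ * g * η ^ 2 := by ring
      _ ≤ K * D + K₁ * K * D := by gcongr
      _ = (1 + K₁) * K * D := by ring
  · rw [div_le_iff₀ (by positivity)]
    calc h * g * η ^ 2 ≤ (α * g + K₁ * η ^ 2) * g * η ^ 2 := by gcongr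
      _ = g ^ 2 * (α * η ^ 2) + K₁ * (g * η) * η * η ^ 2 := by ring
      _ ≤ D * (p ^ 2 * D) + K₁ * D * p ^ 2 * D := by gcongr
      _ = (1 + K₁) * p ^ 2 * D ^ 2 := by ring
  · rw [div_le_iff₀ (by positivity)]
    have h1 : 1 ≤ p ^ 2 / η := by rw [one_le_div hη0]; exact hηp
    have h2 : g ≤ D / η := by rw [le_div_iff₀ hη0]; exact hgη
    calc h * η ^ 2 ≤ (α * g + K₁ * η ^ 2) * η ^ 2 := by gcongr
      _ = g * (α * η ^ 2) + K₁ * η ^ 2 * η ^ 2 * 1 := by ring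
      _ ≤ D / η * (p ^ 2 * D) + K₁ * D * D * (p ^ 2 / η) := by gcongr
      _ = (1 + K₁) * (p ^ 2 / η) * D ^ 2 := by ring

/-- On the real line, `h conj(g) / (|g|² + η²)` is close to `φ` when `g`, `h` are close to the
powers of `φ`. -/
theorem norm_sub_quotient_le {φ g h : ℂ} {p K : ℝ} {j : ℕ} (hj : 1 ≤ j)
    (hp : 0 < p) (hp1 : p ≤ 1) (hK : 1 ≤ K) (hgK : ‖g‖ ≤ K)
    (h1 : ‖φ ^ j - g‖ ≤ K * (p ^ (2 * j)) ^ 2) (h2 : ‖φ ^ (j + 1) - h‖ ≤ K * (p ^ (2 * j)) ^ 2) :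
    ‖φ - h * starRingEnd ℂ g / (g * starRingEnd ℂ g + ((p ^ (2 * j)) ^ 2 : ℝ))‖
      ≤ (1 + K) * (1 + 2 * K) * p := by
  have hj0 : j ≠ 0 := by omega
  have hηp : p ^ (2 * j) ≤ p ^ 2 := pow_le_pow_of_le_one hp.le hp1 (by omega)
  have hp2 : p ^ 2 ≤ p := pow_le_of_le_one hp.le hp1 two_ne_zero
  obtain ⟨α, hα, hαg⟩ : ∃ α, 0 ≤ α ∧ α ^ j = ‖g‖ :=
    ⟨‖g‖ ^ ((j : ℝ)⁻¹), by positivity, Real.rpow_inv_natCast_pow (norm_nonneg _) hj0⟩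
  have hkey := mul_sq_le_of_pow (p := p) hj hα
  have hηj : p ^ (2 * j) = (p ^ 2) ^ j := by rw [pow_mul]
  set η := p ^ (2 * j) with hη
  have hη0 : 0 < η := by positivity
  have hη1 : η ≤ 1 := pow_le_one₀ hp.le hp1
  have hη21 : η ^ 2 ≤ η := pow_le_of_le_one hη0.le hη1 two_ne_zero
  rw [show α ^ (2 * j) = (α ^ j) ^ 2 by rw [← pow_mul, mul_comm], hαg] at hkey
  set D := ‖g‖ ^ 2 + η ^ 2 with hD
  have hD0 : 0 < D := by positivity
  have hDc : g * starRingEnd ℂ g + ((η ^ 2 : ℝ) : ℂ) = (D : ℂ) := by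
    rw [Complex.mul_conj, Complex.normSq_eq_norm_sq]; push_cast [hD]; ring
  have hφj : ‖φ‖ ^ j ≤ ‖g‖ + K * η := by
    rw [← norm_pow]
    calc ‖φ ^ j‖ = ‖g + (φ ^ j - g)‖ := by simp
      _ ≤ ‖g‖ + ‖φ ^ j - g‖ := norm_add_le _ _
      _ ≤ ‖g‖ + K * η := by
        gcongr
        exact h1.trans (by gcongr)
  have hφK : ‖φ‖ ≤ 2 * K := by
    have h3 : ‖φ‖ ^ j ≤ 2 * K * 1 ^ j := by
      rw [one_pow]
      nlinarith
    simpa using le_mul_of_pow_le hj0 zero_le_one (by linarith) h3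
  have hφη : ‖φ‖ * η ^ 2 ≤ (1 + K) * p ^ 2 * D := by
    rcases le_total η ‖g‖ with hle | hle
    · have h3 : ‖φ‖ ≤ (1 + K) * α := by
        refine le_mul_of_pow_le hj0 hα (by linarith) (hφj.trans ?_)
        rw [hαg]; nlinarith
      calc ‖φ‖ * η ^ 2 ≤ (1 + K) * α * η ^ 2 := by gcongr
        _ = (1 + K) * (α * η ^ 2) := by ring
        _ ≤ (1 + K) * (p ^ 2 * D) := by gcongr
        _ = _ := by ring
    · have h3 : ‖φ‖ ≤ (1 + K) * p ^ 2 := by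
        refine le_mul_of_pow_le hj0 (by positivity) (by linarith) (hφj.trans ?_)
        rw [← hηj]; nlinarith
      have h4 : η ^ 2 ≤ D := by nlinarith [norm_nonneg g]
      gcongr
  have hgη : ‖g‖ * η ≤ D := by nlinarith [sq_nonneg (‖g‖ - η)]
  have hφg : ‖φ * g - h‖ ≤ (2 * K + 1) * K * η ^ 2 := by
    have : φ * g - h = -(φ * (φ ^ j - g)) + (φ ^ (j + 1) - h) := by ring
    calc ‖φ * g - h‖ ≤ ‖φ‖ * ‖φ ^ j - g‖ + ‖φ ^ (j + 1) - h‖ := by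
          rw [this, ← norm_mul, ← norm_neg (φ * (φ ^ j - g))]; exact norm_add_le _ _
      _ ≤ 2 * K * (K * η ^ 2) + K * η ^ 2 := by gcongr
      _ = _ := by ring
  have hDC : (D : ℂ) ≠ 0 := by exact_mod_cast hD0.ne'
  have hid : φ - h * starRingEnd ℂ g / D
      = (starRingEnd ℂ g * (φ * g - h) + φ * ((η ^ 2 : ℝ) : ℂ)) / D := by
    rw [eq_div_iff hDC, sub_mul, div_mul_cancel₀ _ hDC, ← hDc]
    ring
  rw [hDc, hid, norm_div, Complex.norm_real, Real.norm_of_nonneg hD0.le, div_le_iff₀ hD0]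
  calc _ ≤ ‖g‖ * ‖φ * g - h‖ + ‖φ‖ * η ^ 2 := by
        refine (norm_add_le _ _).trans (le_of_eq ?_)
        rw [norm_mul, norm_mul, RCLike.norm_conj, Complex.norm_real,
          Real.norm_of_nonneg (by positivity)]
    _ ≤ ‖g‖ * ((2 * K + 1) * K * η ^ 2) + (1 + K) * p ^ 2 * D := by gcongr
    _ = (2 * K + 1) * K * (‖g‖ * η) * η + (1 + K) * p ^ 2 * D := by ring
    _ ≤ (2 * K + 1) * K * D * p + (1 + K) * p * D := by
        gcongr
        exact hηp.trans hp2
    _ ≤ _ := by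
        have h5 : 0 ≤ D * p := by positivity
        nlinarith

end PointwiseEstimates

section Kernels

open MeasureTheory

/-- An integrable majorant of `‖ζ - w‖ ^ (-β)` on the disc of radius `2`. -/
def kernelMajorant (β : ℝ) (w ζ : ℂ) : ℝ :=
  (ball (0 : ℂ) 1).indicator (fun ξ => ‖ξ‖ ^ (-β)) (ζ - w) +
    (closedBall (0 : ℂ) 2).indicator (fun _ => 1) ζ

theorem integrable_indicator_rpow {β : ℝ} (hβ : β < 2) :
    Integrable ((ball (0 : ℂ) 1).indicator fun ξ => ‖ξ‖ ^ (-β)) := by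
  rw [integrable_indicator_iff measurableSet_ball]
  refine integrableOn_ball_of_norm_le_rpow (C := 1) (α := β) (by simp) (by simpa using hβ) ?_ ?_
  · refine Eventually.of_forall fun x => ?_
    rw [Real.norm_of_nonneg (by positivity), one_mul]
  · exact (measurable_norm.pow_const _).aestronglyMeasurable

theorem integrable_indicator_closedBall (Q : ℝ) :
    Integrable ((closedBall (0 : ℂ) 2).indicator fun _ => Q) :=
  (integrable_indicator_iff measurableSet_closedBall).2
    (continuousOn_const.integrableOn_compact (isCompact_closedBall 0 2))

theorem integrable_kernelMajorant {β : ℝ} (hβ : β < 2) (w : ℂ) :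
    Integrable (kernelMajorant β w) :=
  ((integrable_indicator_rpow hβ).comp_sub_right w).add (integrable_indicator_closedBall 1)

theorem integral_kernelMajorant {β : ℝ} (hβ : β < 2) (w : ℂ) :
    ∫ ζ, kernelMajorant β w ζ = ∫ ζ, kernelMajorant β 0 ζ := by
  have h1 := integrable_indicator_rpow hβ
  have h2 := integrable_indicator_closedBall 1
  simp only [kernelMajorant]
  rw [integral_add (h1.comp_sub_right w) h2, integral_add (h1.comp_sub_right 0) h2,
    integral_sub_right_eq_self (fun ζ => (ball (0 : ℂ) 1).indicator (fun ξ => ‖ξ‖ ^ (-β)) ζ) w]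
  simp

theorem kernelMajorant_nonneg (β : ℝ) (w ζ : ℂ) : 0 ≤ kernelMajorant β w ζ :=
  add_nonneg (indicator_nonneg (fun _ _ => by positivity) _) (indicator_nonneg (fun _ _ => one_pos.le) _)

theorem rpow_le_kernelMajorant {β : ℝ} (hβ : 0 ≤ β) {w ζ : ℂ} (hζ : ‖ζ‖ ≤ 2) :
    ‖ζ - w‖ ^ (-β) ≤ kernelMajorant β w ζ := by
  have h2 : (closedBall (0 : ℂ) 2).indicator (fun _ => (1 : ℝ)) ζ = 1 :=
    indicator_of_mem (by simpa using hζ) _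
  rw [kernelMajorant, h2]
  by_cases h : ‖ζ - w‖ < 1
  · rw [indicator_of_mem (by simpa using h)]
    linarith
  · rw [indicator_of_notMem (by simpa using h), zero_add]
    rw [Real.rpow_neg (norm_nonneg _)]
    exact inv_le_one_of_one_le₀ (Real.one_le_rpow (not_lt.1 h) hβ)

theorem rpow_mul_inv_le {a b c : ℝ} (ha : 0 < a) (hb : 0 < b) (hc : 0 ≤ c) :
    a ^ (-c) * b⁻¹ ≤ a ^ (-(c + 1)) + b ^ (-(c + 1)) := by
  have key : ∀ m : ℝ, 0 < m → m ^ (-(c + 1)) = m ^ (-c) * m⁻¹ := fun m hm => by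
    rw [← Real.rpow_neg_one, ← Real.rpow_add hm]; congr 1; ring
  have h1 : 0 ≤ a ^ (-(c + 1)) := by positivity
  have h2 : 0 ≤ b ^ (-(c + 1)) := by positivity
  rcases le_total a b with h | h
  · have : a ^ (-c) * b⁻¹ ≤ a ^ (-c) * a⁻¹ := by gcongr
    rw [← key a ha] at this
    linarith
  · have : a ^ (-c) * b⁻¹ ≤ b ^ (-c) * b⁻¹ := by
      gcongr ?_ * _
      exact Real.rpow_le_rpow_of_nonpos hb h (by linarith)
    rw [← key b hb] at this
    linarith

theorem sum_map_rpow_le {c : ℝ} (hc : 0 < c) (hc1 : c ≤ 1) (f : ℂ → ℝ) (hf : ∀ z, 0 ≤ f z)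
    (s : Multiset ℂ) : (s.map f).sum ^ c ≤ (s.map fun z => f z ^ c).sum := by
  induction s using Multiset.induction with
  | empty => simp [Real.zero_rpow hc.ne']
  | cons a s ih =>
    simp only [Multiset.map_cons, Multiset.sum_cons]
    have h0 : 0 ≤ (s.map f).sum := Multiset.sum_nonneg (by simpa using fun a _ => hf a)
    exact (Real.rpow_add_le_add_rpow (hf a) h0 hc.le hc1).trans (by gcongr)

/-- The Cauchy transform of a function vanishing on the unit disc is holomorphic there. -/
theorem differentiableOn_integral_div {k : ℂ → ℂ} (hk : Continuous k) (hc : HasCompactSupport k)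
    (h0 : ∀ ζ ∈ ball (0 : ℂ) 1, k ζ = 0) :
    DifferentiableOn ℂ (fun z => ∫ ζ, k ζ / (ζ - z)) (ball 0 1) := by
  intro z₀ hz₀
  rw [mem_ball_zero_iff] at hz₀
  set ε := (1 - ‖z₀‖) / 2 with hε
  have hε0 : 0 < ε := by linarith
  have hfar : ∀ z ∈ ball z₀ ε, ∀ ζ : ℂ, k ζ ≠ 0 → ε ≤ ‖ζ - z‖ := by
    intro z hz ζ hζ
    have h1 : 1 ≤ ‖ζ‖ := by
      by_contra! h
      exact hζ (h0 ζ (mem_ball_zero_iff.2 h))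
    rw [mem_ball, dist_eq_norm] at hz
    have h2 : ‖ζ‖ ≤ ‖ζ - z‖ + ‖z - z₀‖ + ‖z₀‖ := by
      calc ‖ζ‖ = ‖(ζ - z) + (z - z₀) + z₀‖ := by ring_nf
        _ ≤ _ := norm_add₃_le
    linarith
  have hmeas : ∀ z n, AEStronglyMeasurable (fun ζ => k ζ / (ζ - z) ^ n) := fun z n =>
    (hk.measurable.div (by fun_prop)).aestronglyMeasurable
  have hki : Integrable k := hk.integrable_of_hasCompactSupport hc
  refine (hasDerivAt_integral_of_dominated_loc_of_deriv_le (F := fun z ζ => k ζ / (ζ - z))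
    (F' := fun z ζ => k ζ / (ζ - z) ^ 2) (bound := fun ζ => ‖k ζ‖ / ε ^ 2) (s := ball z₀ ε)
    (ball_mem_nhds z₀ hε0) (Eventually.of_forall fun z => by simpa using hmeas z 1) ?_
    (hmeas z₀ 2) ?_ (hki.norm.div_const _) ?_).2.differentiableAt.differentiableWithinAt
  · refine (hki.norm.div_const ε).mono' (by simpa using hmeas z₀ 1) (Eventually.of_forall fun ζ => ?_)
    by_cases hζ : k ζ = 0
    · simp [hζ]
    · rw [norm_div]
      gcongr
      exact hfar z₀ (mem_ball_self hε0) ζ hζ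
  · refine Eventually.of_forall fun ζ z hz => ?_
    by_cases hζ : k ζ = 0
    · simp [hζ]
    · rw [norm_div, norm_pow]
      gcongr
      exact hfar z hz ζ hζ
  · refine Eventually.of_forall fun ζ z hz => ?_
    by_cases hζ : k ζ = 0
    · simpa [hζ] using hasDerivAt_const z (0 : ℂ)
    · have hne : ζ - z ≠ 0 := norm_pos_iff.1 (hε0.trans_le (hfar z hz ζ hζ))
      have := (((hasDerivAt_id z).const_sub ζ).inv hne).const_mul (k ζ)
      simp only [id, neg_neg] at this
      simpa [div_eq_mul_inv] using this

theorem norm_integral_div_le {k : ℂ → ℂ} {Q : ℝ} (h0 : ∀ ζ ∈ ball (0 : ℂ) 1, k ζ = 0)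
    (h2 : ∀ ζ, 2 < ‖ζ‖ → k ζ = 0) (hQ : ∀ ζ, ‖ζ‖ ≤ 2 → ‖k ζ‖ ≤ Q) {z : ℂ} (hz : ‖z‖ < 1 / 2) :
    ‖∫ ζ, k ζ / (ζ - z)‖ ≤ 2 * Q * volume.real (closedBall (0 : ℂ) 2) := by
  have hQ0 : 0 ≤ Q := (norm_nonneg _).trans (hQ 0 (by simp))
  have hi := integrable_indicator_closedBall (2 * Q)
  refine (norm_integral_le_of_norm_le hi (Eventually.of_forall fun ζ => ?_)).trans (le_of_eq ?_)
  · by_cases hζ : ‖ζ‖ ≤ 2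
    · rw [indicator_of_mem (by simpa using hζ)]
      by_cases h1 : ‖ζ‖ < 1
      · simp [h0 ζ (by simpa using h1)]; positivity
      · have h3 : 1 / 2 ≤ ‖ζ - z‖ := by
          have := norm_sub_norm_le ζ z
          linarith [not_lt.1 h1]
        rw [norm_div, div_le_iff₀ (by linarith)]
        have := hQ ζ hζ
        nlinarith
    · rw [indicator_of_notMem (by simpa using hζ), h2 ζ (not_le.1 hζ)]
      simp
  · rw [integral_indicator measurableSet_closedBall, setIntegral_const, smul_eq_mul, mul_comm]

end Kernels

section Quotient

open Polynomial

/-- The smooth function `H conj(G) / (|G|² + η²)`. -/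
def quotientExt (G H : ℂ[X]) (η : ℝ) (z : ℂ) : ℂ :=
  H.eval z * starRingEnd ℂ (G.eval z) / (G.eval z * starRingEnd ℂ (G.eval z) + ((η ^ 2 : ℝ) : ℂ))

theorem mul_conj_add_sq (g : ℂ) (η : ℝ) :
    g * starRingEnd ℂ g + ((η ^ 2 : ℝ) : ℂ) = ((‖g‖ ^ 2 + η ^ 2 : ℝ) : ℂ) := by
  rw [Complex.mul_conj, Complex.normSq_eq_norm_sq]; push_cast; ring

theorem mul_conj_add_sq_ne_zero (g : ℂ) {η : ℝ} (hη : 0 < η) :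
    g * starRingEnd ℂ g + ((η ^ 2 : ℝ) : ℂ) ≠ 0 := by
  rw [mul_conj_add_sq]
  exact_mod_cast (by positivity : (0 : ℝ) < ‖g‖ ^ 2 + η ^ 2).ne'

theorem contDiff_quotientExt (G H : ℂ[X]) {η : ℝ} (hη : 0 < η) :
    ContDiff ℝ 1 (quotientExt G H η) := by
  have h : ∀ P : ℂ[X], ContDiff ℝ 1 fun z => P.eval z := fun P => by
    simpa [Polynomial.aeval_def] using (P.contDiff_aeval (𝕜 := ℂ) 1).restrict_scalars ℝ
  have hconj : ContDiff ℝ 1 fun z => starRingEnd ℂ (G.eval z) :=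
    Complex.conjCLE.contDiff.comp (h G)
  unfold quotientExt
  simp only [div_eq_mul_inv]
  exact ((h H).mul hconj).mul ((((h G).mul hconj).add contDiff_const).inv
    fun z => mul_conj_add_sq_ne_zero _ hη)

theorem dbar_quotientExt (G H : ℂ[X]) {η : ℝ} (hη : 0 < η) (z : ℂ) :
    dbar (quotientExt G H η) z = H.eval z * starRingEnd ℂ (G.derivative.eval z) * ((η ^ 2 : ℝ) : ℂ) /
      (((‖G.eval z‖ ^ 2 + η ^ 2) ^ 2 : ℝ) : ℂ) := by
  have hne := mul_conj_add_sq_ne_zero (G.eval z) hη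
  have hdir : ∀ v : ℂ, fderiv ℝ (quotientExt G H η) z v =
      ((H.derivative.eval z * v * starRingEnd ℂ (G.eval z) +
          H.eval z * starRingEnd ℂ (G.derivative.eval z * v)) *
          (G.eval z * starRingEnd ℂ (G.eval z) + ((η ^ 2 : ℝ) : ℂ)) -
        H.eval z * starRingEnd ℂ (G.eval z) *
          (G.derivative.eval z * v * starRingEnd ℂ (G.eval z) +
            G.eval z * starRingEnd ℂ (G.derivative.eval z * v))) /
        (G.eval z * starRingEnd ℂ (G.eval z) + ((η ^ 2 : ℝ) : ℂ)) ^ 2 := by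
    intro v
    have hl : HasDerivAt (fun t : ℝ => z + (t : ℂ) * v) v 0 := by
      simpa using ((Complex.ofRealCLM.hasDerivAt (x := (0 : ℝ))).mul_const v).const_add z
    have hP : ∀ P : ℂ[X], HasDerivAt (fun t : ℝ => P.eval (z + (t : ℂ) * v)) (P.derivative.eval z * v) 0 := by
      intro P
      have h1 := P.hasDerivAt (z + ((0 : ℝ) : ℂ) * v)
      have h2 := h1.comp (0 : ℝ) hl
      simp only [Complex.ofReal_zero, zero_mul, add_zero] at h2
      exact h2
    have hC : HasDerivAt (fun t : ℝ => starRingEnd ℂ (G.eval (z + (t : ℂ) * v)))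
        (starRingEnd ℂ (G.derivative.eval z * v)) 0 :=
      (Complex.conjCLE.toContinuousLinearMap.hasFDerivAt).comp_hasDerivAt (0 : ℝ) (hP G)
    have h3 := ((hP H).mul hC).div (((hP G).mul hC).add_const ((η ^ 2 : ℝ) : ℂ))
      (mul_conj_add_sq_ne_zero _ hη)
    have h4 : HasFDerivAt (quotientExt G H η) (fderiv ℝ (quotientExt G H η) z)
        (z + ((0 : ℝ) : ℂ) * v) := by
      simpa using ((contDiff_quotientExt G H hη).differentiable (by norm_num) z).hasFDerivAt
    have h5 := h4.comp_hasDerivAt (0 : ℝ) hl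
    have h6 := h5.unique h3
    simpa using h6
  have hD : (((‖G.eval z‖ ^ 2 + η ^ 2) ^ 2 : ℝ) : ℂ)
      = (G.eval z * starRingEnd ℂ (G.eval z) + ((η ^ 2 : ℝ) : ℂ)) ^ 2 := by
    rw [mul_conj_add_sq]; push_cast; ring
  rw [hD, dbar, hdir, hdir]
  simp only [map_mul, Complex.conj_I, mul_one]
  field_simp
  generalize starRingEnd ℂ (G.derivative.eval z) = c
  generalize starRingEnd ℂ (G.eval z) = b
  have := Complex.I_sq
  ring_nf
  rw [this]
  ring

theorem dbar_mul {f g : ℂ → ℂ} {z : ℂ} (hf : DifferentiableAt ℝ f z) (hg : DifferentiableAt ℝ g z) :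
    dbar (fun z => f z * g z) z = f z * dbar g z + g z * dbar f z := by
  simp only [dbar, fderiv_fun_mul hf hg]
  simp
  ring

end Quotient

section ApproximateRoot

open MeasureTheory Polynomial

theorem integrable_div_sub {k : ℂ → ℂ} (hk : Continuous k) (hc : HasCompactSupport k)
    (h2 : ∀ ζ, 2 < ‖ζ‖ → k ζ = 0) (z : ℂ) : Integrable fun ζ => k ζ / (ζ - z) := by
  obtain ⟨C, hC⟩ := hk.bounded_above_of_compact_support hc
  have hC0 : 0 ≤ C := (norm_nonneg _).trans (hC 0)
  refine ((integrable_kernelMajorant (β := 1) one_lt_two z).const_mul C).mono'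
    (hk.measurable.div (by fun_prop)).aestronglyMeasurable (Eventually.of_forall fun ζ => ?_)
  by_cases hζ : ‖ζ‖ ≤ 2
  · rw [norm_div, div_eq_mul_inv, ← Real.rpow_neg_one]
    exact mul_le_mul (hC ζ) (rpow_le_kernelMajorant zero_le_one hζ) (by positivity) hC0
  · rw [h2 ζ (not_le.1 hζ)]
    simpa using mul_nonneg hC0 (kernelMajorant_nonneg 1 z ζ)

theorem integral_sum_kernelMajorant {β : ℝ} (hβ : β < 2) (z : ℂ) (s : Multiset ℂ) :
    Integrable (fun ζ => (s.map fun w => kernelMajorant β w ζ + kernelMajorant β z ζ).sum) ∧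
      ∫ ζ, (s.map fun w => kernelMajorant β w ζ + kernelMajorant β z ζ).sum
        = s.card * (2 * ∫ ζ, kernelMajorant β 0 ζ) := by
  induction s using Multiset.induction with
  | empty => simp
  | cons a s ih =>
    simp only [Multiset.map_cons, Multiset.sum_cons, Multiset.card_cons]
    have h1 := integrable_kernelMajorant hβ a
    have h2 := integrable_kernelMajorant hβ z
    have h12 : Integrable fun ζ => kernelMajorant β a ζ + kernelMajorant β z ζ := h1.add h2
    refine ⟨h12.add ih.1, ?_⟩
    rw [integral_add h12 ih.1, ih.2, integral_add h1 h2, integral_kernelMajorant hβ a,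
      integral_kernelMajorant hβ z]
    push_cast
    ring

theorem le_rpow_mul_inv_of_le {X S p : ℝ} {j : ℕ} (hj : 1 ≤ j) (hX : 0 ≤ X) (hp : 0 < p)
    (h1 : X ≤ S) (h2 : X ≤ (p ^ (2 * j))⁻¹) :
    X ≤ S ^ (1 - 1 / (2 * j : ℝ)) * p⁻¹ := by
  have hj0 : (1 : ℝ) ≤ j := by exact_mod_cast hj
  have hθ0 : 0 < 1 / (2 * j : ℝ) := by positivity
  have hθ1 : 1 / (2 * j : ℝ) < 1 := by rw [div_lt_one (by positivity)]; linarith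
  have h3 : ((p ^ (2 * j))⁻¹) ^ (1 / (2 * j : ℝ)) = p⁻¹ := by
    rw [← inv_pow, one_div, show (2 * j : ℝ) = ((2 * j : ℕ) : ℝ) by push_cast; ring]
    exact Real.pow_rpow_inv_natCast (by positivity) (by omega)
  have hS : 0 ≤ S := hX.trans h1
  rcases hX.eq_or_lt with h0 | h0
  · rw [← h0]
    positivity
  calc X = X ^ (1 - 1 / (2 * j : ℝ)) * X ^ (1 / (2 * j : ℝ)) := by
        rw [← Real.rpow_add h0]; simp
    _ ≤ S ^ (1 - 1 / (2 * j : ℝ)) * ((p ^ (2 * j))⁻¹) ^ (1 / (2 * j : ℝ)) := by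
        refine mul_le_mul (Real.rpow_le_rpow hX h1 (by linarith))
          (Real.rpow_le_rpow hX h2 hθ0.le) (by positivity) (by positivity)
    _ = _ := by rw [h3]

/-- The smooth cutoff equal to one on the unit disc and supported in the disc of radius `2`. -/
def cutoffBump : ContDiffBump (0 : ℂ) := ⟨1, 2, one_pos, one_lt_two⟩

/-- The complex-valued cutoff. -/
def cutoff (z : ℂ) : ℂ := (cutoffBump z : ℂ)

theorem contDiff_cutoff : ContDiff ℝ 2 cutoff :=
  Complex.ofRealCLM.contDiff.comp cutoffBump.contDiff

theorem cutoff_eq_one {z : ℂ} (hz : ‖z‖ ≤ 1) : cutoff z = 1 := by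
  rw [cutoff, cutoffBump.one_of_mem_closedBall (by simpa [cutoffBump] using hz), Complex.ofReal_one]

theorem cutoff_eq_zero {z : ℂ} (hz : 2 ≤ ‖z‖) : cutoff z = 0 := by
  rw [cutoff, cutoffBump.zero_of_le_dist (by simpa [cutoffBump] using hz), Complex.ofReal_zero]

theorem norm_cutoff_le (z : ℂ) : ‖cutoff z‖ ≤ 1 := by
  rw [cutoff, Complex.norm_real, Real.norm_of_nonneg cutoffBump.nonneg]
  exact cutoffBump.le_one

theorem hasCompactSupport_of_eq_zero {k : ℂ → ℂ} (h : ∀ ζ, 2 < ‖ζ‖ → k ζ = 0) :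
    HasCompactSupport k :=
  HasCompactSupport.intro (isCompact_closedBall (0 : ℂ) 2) fun z hz => h z (by simpa using hz)

theorem continuous_dbar {f : ℂ → ℂ} (hf : ContDiff ℝ 1 f) : Continuous (dbar f) := by
  have h := hf.continuous_fderiv (by norm_num)
  unfold dbar
  fun_prop

theorem dbar_cutoff_eq_zero_of_lt {z : ℂ} (hz : z ∈ ball (0 : ℂ) 1) : dbar cutoff z = 0 := by
  have : cutoff =ᶠ[𝓝 z] fun _ => 1 := by
    filter_upwards [isOpen_ball.mem_nhds hz] with w hw
    exact cutoff_eq_one (mem_ball_zero_iff.1 hw).le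
  simp [dbar, this.fderiv_eq]

theorem dbar_cutoff_eq_zero {z : ℂ} (hz : 2 < ‖z‖) : dbar cutoff z = 0 := by
  have : cutoff =ᶠ[𝓝 z] fun _ => 0 := by
    filter_upwards [(isOpen_lt continuous_const continuous_norm).mem_nhds hz] with w hw
    exact cutoff_eq_zero (le_of_lt hw)
  simp [dbar, this.fderiv_eq]

theorem norm_pow_sub_pow_le_of_approx {φ g h : ℂ} {K δ : ℝ} {j : ℕ} (hj : 1 ≤ j) (hK : 1 ≤ K)
    (hg : ‖g‖ ≤ K) (hh : ‖h‖ ≤ K) (hδ : δ ≤ 1)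
    (h1 : ‖φ ^ j - g‖ ≤ K * δ) (h2 : ‖φ ^ (j + 1) - h‖ ≤ K * δ) :
    ‖g ^ (j + 1) - h ^ j‖ ≤ (2 * j + 1) * (2 * K) ^ j * K * δ := by
  obtain ⟨i, rfl⟩ : ∃ i, j = i + 1 := ⟨j - 1, by omega⟩
  have hKδ : K * δ ≤ K := by nlinarith
  have hδ0 : 0 ≤ K * δ := (norm_nonneg _).trans h1
  have ha : ‖φ ^ (i + 1)‖ ≤ 2 * K := by
    calc ‖φ ^ (i + 1)‖ = ‖g + (φ ^ (i + 1) - g)‖ := by simp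
      _ ≤ ‖g‖ + ‖φ ^ (i + 1) - g‖ := norm_add_le _ _
      _ ≤ 2 * K := by linarith
  have hb : ‖φ ^ (i + 1 + 1)‖ ≤ 2 * K := by
    calc ‖φ ^ (i + 1 + 1)‖ = ‖h + (φ ^ (i + 1 + 1) - h)‖ := by simp
      _ ≤ ‖h‖ + ‖φ ^ (i + 1 + 1) - h‖ := norm_add_le _ _
      _ ≤ 2 * K := by linarith
  have h3 := norm_pow_sub_pow_le (by linarith) (by linarith : ‖g‖ ≤ 2 * K) ha (i + 1)
  have h4 := norm_pow_sub_pow_le (by linarith) hb (by linarith : ‖h‖ ≤ 2 * K) i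
  rw [norm_sub_rev] at h1
  have h5 : g ^ (i + 1 + 1) - h ^ (i + 1) = (g ^ (i + 1 + 1) - (φ ^ (i + 1)) ^ (i + 1 + 1)) +
      ((φ ^ (i + 1 + 1)) ^ (i + 1) - h ^ (i + 1)) := by
    rw [← pow_mul, ← pow_mul, mul_comm (i + 1)]; ring
  have h6 : (2 * K) ^ i ≤ (2 * K) ^ (i + 1) := pow_le_pow_right₀ (by linarith) (by omega)
  rw [h5]
  calc _ ≤ _ := norm_add_le _ _
    _ ≤ (((i + 1 : ℕ) : ℝ) + 1) * (2 * K) ^ (i + 1) * (K * δ) + (i + 1) * (2 * K) ^ (i + 1) * (K * δ) := by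
        refine add_le_add (h3.trans (by gcongr)) (h4.trans (by gcongr))
    _ = _ := by push_cast; ring

theorem norm_eval_derivative_le {G : ℂ[X]} {K : ℝ} (hG : ∀ z : ℂ, ‖z‖ ≤ 8 → ‖G.eval z‖ ≤ K)
    {z : ℂ} (hz : ‖z‖ ≤ 2) : ‖G.derivative.eval z‖ ≤ K := by
  have := Complex.norm_deriv_le_of_forall_mem_sphere_norm_le (f := fun w => G.eval w) (c := z)
    (C := K) one_pos G.differentiable.diffContOnCl fun w hw => hG w (by
      have h1 := norm_sub_norm_le w z
      rw [mem_sphere_iff_norm] at hw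
      linarith)
  simpa using this

theorem norm_eval_derivative_le_mul_sum {G : ℂ[X]} {z : ℂ} (hz : G.eval z ≠ 0) :
    ‖G.derivative.eval z‖ ≤ ‖G.eval z‖ * (G.roots.map fun w => ‖z - w‖⁻¹).sum := by
  have h1 := (IsAlgClosed.splits G).eval_derivative_div_eval_of_ne_zero hz
  have h2 : ‖(G.roots.map fun w => 1 / (z - w)).sum‖ ≤ (G.roots.map fun w => ‖z - w‖⁻¹).sum := by
    refine (norm_multiset_sum_le _).trans (le_of_eq ?_)
    simp
  rw [← h1, norm_div, div_le_iff₀ (norm_pos_iff.2 hz)] at h2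
  linarith

/-- Away from the roots of `G`, `∂̄` of the quotient is small compared to an integrable kernel. -/
theorem norm_dbar_quotientExt_le {G H : ℂ[X]} {p K K₁ : ℝ} {j : ℕ} (hj : 1 ≤ j)
    (hp : 0 < p) (hp1 : p ≤ 1) (hK : 1 ≤ K) (hK₁ : 1 ≤ K₁) {z : ℂ}
    (hG : ‖G.eval z‖ ≤ K) (hG' : ‖G.derivative.eval z‖ ≤ K)
    (hP : ‖H.eval z‖ ^ j ≤ ‖G.eval z‖ ^ (j + 1) + K₁ * (p ^ (2 * j)) ^ (2 * j))
    (hz : z ∉ G.roots) :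
    ‖dbar (quotientExt G H (p ^ (2 * j))) z‖ ≤ (1 + K₁) * K * p *
      (G.roots.map fun w => ‖z - w‖ ^ (-(1 - 1 / (2 * j : ℝ)))).sum := by
  have hη0 : 0 < p ^ (2 * j) := by positivity
  obtain ⟨-, he1, he2⟩ := quotient_estimates hj (norm_nonneg _) hp hp1 hK hK₁ hG hP
  rw [dbar_quotientExt G H hη0, norm_div, norm_mul, norm_mul, RCLike.norm_conj, Complex.norm_real,
    Complex.norm_real, Real.norm_of_nonneg (by positivity), Real.norm_of_nonneg (by positivity)]
  have hsum0 : 0 ≤ (G.roots.map fun w => ‖z - w‖ ^ (-(1 - 1 / (2 * j : ℝ)))).sum :=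
    Multiset.sum_nonneg (by simp only [Multiset.mem_map]; rintro _ ⟨w, -, rfl⟩; positivity)
  rcases eq_or_ne G 0 with rfl | hG0
  · simp
  have hGz : G.eval z ≠ 0 := fun h => hz ((mem_roots hG0).2 h)
  have hder := norm_eval_derivative_le_mul_sum hGz
  set S := (G.roots.map fun w => ‖z - w‖⁻¹).sum with hS
  have hS0 : 0 ≤ S :=
    Multiset.sum_nonneg (by simp only [Multiset.mem_map]; rintro _ ⟨w, -, rfl⟩; positivity)
  set g := ‖G.eval z‖
  set h := ‖H.eval z‖
  set g' := ‖G.derivative.eval z‖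
  set η := p ^ (2 * j) with hη
  set D := g ^ 2 + η ^ 2
  have hX1 : h * g' * η ^ 2 / D ^ 2 ≤ (1 + K₁) * K * p ^ 2 * S := by
    calc h * g' * η ^ 2 / D ^ 2 ≤ h * (g * S) * η ^ 2 / D ^ 2 := by gcongr
      _ = (h * g * η ^ 2 / D ^ 2) * S := by ring
      _ ≤ ((1 + K₁) * p ^ 2) * S := by gcongr
      _ ≤ ((1 + K₁) * p ^ 2) * S * K := le_mul_of_one_le_right (by positivity) hK
      _ = _ := by ring
  have hX2 : h * g' * η ^ 2 / D ^ 2 ≤ (1 + K₁) * K * p ^ 2 * η⁻¹ := by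
    calc h * g' * η ^ 2 / D ^ 2 ≤ h * K * η ^ 2 / D ^ 2 := by gcongr
      _ = (h * η ^ 2 / D ^ 2) * K := by ring
      _ ≤ ((1 + K₁) * (p ^ 2 / η)) * K := by gcongr
      _ = _ := by ring
  set X := h * g' * η ^ 2 / D ^ 2
  have hc0 : 0 < (1 + K₁) * K * p ^ 2 := by positivity
  have hX0 : 0 ≤ X := by positivity
  have hmain := le_rpow_mul_inv_of_le (X := X / ((1 + K₁) * K * p ^ 2)) (S := S) hj (by positivity) hp
    (by rw [div_le_iff₀ hc0]; linarith) (by rw [div_le_iff₀ hc0]; linarith)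
  rw [div_le_iff₀ hc0] at hmain
  have hj0 : (1 : ℝ) ≤ j := by exact_mod_cast hj
  have hθ0 : 0 < 1 / (2 * j : ℝ) := by positivity
  have hθ1 : 1 / (2 * j : ℝ) < 1 := by rw [div_lt_one (by positivity)]; linarith
  have hsub := sum_map_rpow_le (c := 1 - 1 / (2 * j : ℝ)) (by linarith) (by linarith)
    (fun w => ‖z - w‖⁻¹) (fun w => by positivity) G.roots
  rw [← hS] at hsub
  simp only [Real.inv_rpow (norm_nonneg _), ← Real.rpow_neg (norm_nonneg _)] at hsub
  refine hmain.trans ?_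
  calc _ = (1 + K₁) * K * p * S ^ (1 - 1 / (2 * j : ℝ)) := by field_simp
    _ ≤ _ := by gcongr

end ApproximateRoot

section ApproximateRoot

open MeasureTheory Polynomial

theorem norm_pow_le_add_of_approx {G H : ℂ[X]} {φ : ℝ → ℂ} {p K : ℝ} {j : ℕ} (hj : 1 ≤ j)
    (hp : 0 < p) (hp1 : p ≤ 1) (hK : 1 ≤ K)
    (hG : ∀ z : ℂ, ‖z‖ ≤ 8 → ‖G.eval z‖ ≤ K) (hH : ∀ z : ℂ, ‖z‖ ≤ 8 → ‖H.eval z‖ ≤ K)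
    (h1 : ∀ s : ℝ, |s| ≤ 8 → ‖φ s ^ j - G.eval (s : ℂ)‖ ≤ K * p ^ (16 * j ^ 2))
    (h2 : ∀ s : ℝ, |s| ≤ 8 → ‖φ s ^ (j + 1) - H.eval (s : ℂ)‖ ≤ K * p ^ (16 * j ^ 2))
    {z : ℂ} (hz : ‖z‖ ≤ 2) :
    ‖H.eval z‖ ^ j ≤ ‖G.eval z‖ ^ (j + 1) +
      (2 * j + 1) * (2 * K) ^ j * K * (p ^ (2 * j)) ^ (2 * j) := by
  have hq4 : p ^ (16 * j ^ 2) = ((p ^ (2 * j)) ^ (2 * j)) ^ 4 := by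
    rw [← pow_mul, ← pow_mul]; congr 1; ring
  have hq : (p ^ (2 * j)) ^ (2 * j) ≤ 1 := pow_le_one₀ (by positivity) (pow_le_one₀ hp.le hp1)
  have hδ : p ^ (16 * j ^ 2) ≤ 1 := pow_le_one₀ hp.le hp1
  have hbig : ∀ z : ℂ, ‖z‖ ≤ 8 →
      ‖(G ^ (j + 1) - H ^ j).eval z‖ ≤ (2 * j + 1) * (2 * K) ^ j * K := by
    intro z hz
    rw [eval_sub, eval_pow, eval_pow]
    have hj' : (1 : ℝ) ≤ j := by exact_mod_cast hj
    calc _ ≤ ‖G.eval z ^ (j + 1)‖ + ‖H.eval z ^ j‖ := norm_sub_le _ _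
      _ ≤ K ^ (j + 1) + K ^ j := by
          rw [norm_pow, norm_pow]
          have := hG z hz
          have := hH z hz
          gcongr
      _ ≤ K ^ j * K + K ^ j * K := by
          rw [pow_succ]
          have : K ^ j ≤ K ^ j * K := le_mul_of_one_le_right (by positivity) hK
          linarith
      _ = 2 * K ^ j * K := by ring
      _ ≤ (2 * j + 1) * (2 * K) ^ j * K := by
          gcongr
          · linarith
          · linarith
  have := norm_le_of_norm_le_real (P := fun z => (G ^ (j + 1) - H ^ j).eval z) (by norm_num : (0:ℝ) < 8)
    (by positivity : 0 < (p ^ (2 * j)) ^ (2 * j)) hq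
    (G ^ (j + 1) - H ^ j).differentiable.diffContOnCl hbig (fun x hx => by
      have hx' : ‖(x : ℂ)‖ ≤ 8 := by simpa using hx
      rw [← hq4, eval_sub, eval_pow, eval_pow]
      exact norm_pow_sub_pow_le_of_approx hj hK (hG _ hx') (hH _ hx') hδ (h1 x hx) (h2 x hx))
    (z := z) (by linarith)
  simp only [eval_sub, eval_pow] at this
  have h3 := norm_sub_norm_le (H.eval z ^ j) (G.eval z ^ (j + 1))
  rw [norm_sub_rev, norm_pow, norm_pow] at h3
  linarith

/-- The Cauchy–Pompeiu decomposition into a holomorphic part and a `∂̄`-potential. -/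
theorem exists_holomorphic_part :
    ∃ L > 0, ∀ u : ℂ → ℂ, ContDiff ℝ 1 u → ∀ B, 0 ≤ B → (∀ ζ, ‖ζ‖ ≤ 2 → ‖u ζ‖ ≤ B) →
      ∃ F : ℂ → ℂ, DifferentiableOn ℂ F (ball 0 1) ∧ (∀ z, ‖z‖ < 1 / 2 → ‖F z‖ ≤ L * B) ∧
        ∀ z, ‖z‖ ≤ 1 → u z - F z = -(1 / Real.pi) * ∫ ζ, cutoff ζ * dbar u ζ / (ζ - z) := by
  have hcut := contDiff_cutoff.of_le one_le_two
  have hdc := continuous_dbar hcut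
  obtain ⟨C, hC⟩ := hdc.bounded_above_of_compact_support
    (hasCompactSupport_of_eq_zero fun ζ => dbar_cutoff_eq_zero)
  have hC0 : 0 ≤ C := (norm_nonneg _).trans (hC 0)
  refine ⟨1 / Real.pi * (2 * C * volume.real (closedBall (0 : ℂ) 2)) + 1, by positivity,
    fun u hu B hB hub => ?_⟩
  have hk2 : ∀ ζ, 2 < ‖ζ‖ → u ζ * dbar cutoff ζ = 0 := fun ζ hζ => by
    rw [dbar_cutoff_eq_zero hζ, mul_zero]
  have hk1 : ∀ ζ ∈ ball (0 : ℂ) 1, u ζ * dbar cutoff ζ = 0 := fun ζ hζ => by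
    rw [dbar_cutoff_eq_zero_of_lt hζ, mul_zero]
  have hk : Continuous fun ζ => u ζ * dbar cutoff ζ := hu.continuous.mul hdc
  have hl2 : ∀ ζ, 2 < ‖ζ‖ → cutoff ζ * dbar u ζ = 0 := fun ζ hζ => by
    rw [cutoff_eq_zero hζ.le, zero_mul]
  have hl : Continuous fun ζ => cutoff ζ * dbar u ζ := hcut.continuous.mul (continuous_dbar hu)
  refine ⟨fun z => -(1 / Real.pi) * ∫ ζ, u ζ * dbar cutoff ζ / (ζ - z),
    (differentiableOn_integral_div hk (hasCompactSupport_of_eq_zero hk2) hk1).const_mul _,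
    fun z hz => ?_, fun z hz => ?_⟩
  · have := norm_integral_div_le (Q := B * C) hk1 hk2 (fun ζ hζ => by
      rw [norm_mul]; exact mul_le_mul (hub ζ hζ) (hC ζ) (norm_nonneg _) hB) hz
    have hpi : ‖-(1 / (Real.pi : ℂ))‖ = 1 / Real.pi := by
      rw [norm_neg, norm_div, norm_one, Complex.norm_real, Real.norm_of_nonneg Real.pi_pos.le]
    rw [norm_mul, hpi]
    calc _ ≤ 1 / Real.pi * (2 * (B * C) * volume.real (closedBall (0 : ℂ) 2)) := by gcongr
      _ ≤ _ := by linarith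
  · have hΦ : ContDiff ℝ 1 fun z => cutoff z * u z := hcut.mul hu
    have hcp := integral_dbar_div_sub hΦ (hasCompactSupport_of_eq_zero fun ζ hζ => by
      rw [cutoff_eq_zero hζ.le, zero_mul]) z
    have hsplit : ∀ ζ, dbar (fun z => cutoff z * u z) ζ / (ζ - z) =
        cutoff ζ * dbar u ζ / (ζ - z) + u ζ * dbar cutoff ζ / (ζ - z) := fun ζ => by
      rw [dbar_mul (hcut.differentiable one_ne_zero _) (hu.differentiable one_ne_zero _), add_div]
    simp only [hsplit] at hcp
    rw [integral_add (integrable_div_sub hl (hasCompactSupport_of_eq_zero hl2) hl2 z)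
      (integrable_div_sub hk (hasCompactSupport_of_eq_zero hk2) hk2 z), cutoff_eq_one hz, one_mul] at hcp
    have hpi : (Real.pi : ℂ) ≠ 0 := by exact_mod_cast Real.pi_ne_zero
    field_simp
    linear_combination hcp

/-- If `φ ^ j` and `φ ^ (j + 1)` are close to polynomials on an interval, then `φ` is close to a
holomorphic function there. -/
theorem exists_holomorphic_approx {j : ℕ} (hj : 1 ≤ j) {K : ℝ} (hK : 1 ≤ K) :
    ∃ K' > 0, ∀ (G H : ℂ[X]) (φ : ℝ → ℂ) (p : ℝ), 0 < p → p ≤ 1 →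
      (∀ z : ℂ, ‖z‖ ≤ 8 → ‖G.eval z‖ ≤ K) → (∀ z : ℂ, ‖z‖ ≤ 8 → ‖H.eval z‖ ≤ K) →
      (∀ s : ℝ, |s| ≤ 8 → ‖φ s ^ j - G.eval (s : ℂ)‖ ≤ K * p ^ (16 * j ^ 2)) →
      (∀ s : ℝ, |s| ≤ 8 → ‖φ s ^ (j + 1) - H.eval (s : ℂ)‖ ≤ K * p ^ (16 * j ^ 2)) →
      ∃ F : ℂ → ℂ, DifferentiableOn ℂ F (ball 0 1) ∧ (∀ z, ‖z‖ < 1 / 2 → ‖F z‖ ≤ K') ∧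
        ∀ s : ℝ, |s| < 1 / 2 → ‖φ s - F s‖ ≤ K' * ((G.natDegree + 1) * p) := by
  obtain ⟨L, hL, hpart⟩ := exists_holomorphic_part
  set K₁ : ℝ := (2 * j + 1) * (2 * K) ^ j * K with hK₁def
  have hj0 : (1 : ℝ) ≤ j := by exact_mod_cast hj
  have hθ0 : 0 < 1 / (2 * j : ℝ) := by positivity
  have hθ1 : 1 / (2 * j : ℝ) < 1 := by rw [div_lt_one (by positivity)]; linarith
  have hK₁ : 1 ≤ K₁ := by
    have : 1 ≤ (2 * K) ^ j := one_le_pow₀ (by linarith)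
    have h3 : (1 : ℝ) ≤ 2 * j + 1 := by linarith
    exact one_le_mul_of_one_le_of_one_le (one_le_mul_of_one_le_of_one_le h3 this) hK
  set β : ℝ := (1 - 1 / (2 * j : ℝ)) + 1 with hβdef
  have hβ : β < 2 := by linarith
  set J : ℝ := ∫ ζ, kernelMajorant β 0 ζ with hJ
  have hJ0 : 0 ≤ J := integral_nonneg fun ζ => kernelMajorant_nonneg β 0 ζ
  set B : ℝ := (1 + K₁) * K with hBdef
  have hB : 0 < B := by positivity
  refine ⟨L * B + (1 + K) * (1 + 2 * K) + 1 / Real.pi * B * (2 * J), by positivity,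
    fun G H φ p hp hp1 hG hH h1 h2 => ?_⟩
  have hη : 0 < p ^ (2 * j) := by positivity
  have hP := fun z (hz : ‖z‖ ≤ 2) => norm_pow_le_add_of_approx hj hp hp1 hK hG hH h1 h2 hz
  obtain ⟨F, hF, hFb, hFu⟩ := hpart _ (contDiff_quotientExt G H hη) B hB.le fun ζ hζ => by
    have := (quotient_estimates hj (norm_nonneg _) hp hp1 hK hK₁ (hG ζ (by linarith)) (hP ζ hζ)).1
    rw [quotientExt, mul_conj_add_sq, norm_div, norm_mul, RCLike.norm_conj, Complex.norm_real,
      Real.norm_of_nonneg (by positivity)]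
    exact this
  refine ⟨F, hF, fun z hz => (hFb z hz).trans ?_, fun s hs => ?_⟩
  · have : 0 ≤ (1 + K) * (1 + 2 * K) + 1 / Real.pi * B * (2 * J) := by positivity
    linarith
  have hs' : ‖(s : ℂ)‖ < 1 / 2 := by simpa using hs
  have hd : (0 : ℝ) ≤ G.natDegree := by positivity
  have hu : ‖φ s - quotientExt G H (p ^ (2 * j)) s‖ ≤ (1 + K) * (1 + 2 * K) * p := by
    have hle : K * p ^ (16 * j ^ 2) ≤ K * (p ^ (2 * j)) ^ 2 := by
      rw [← pow_mul]
      have : p ^ (16 * j ^ 2) ≤ p ^ (2 * j * 2) := pow_le_pow_of_le_one hp.le hp1 (by nlinarith)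
      gcongr
    exact norm_sub_quotient_le hj hp hp1 hK (hG s (by linarith)) ((h1 s (by linarith)).trans hle)
      ((h2 s (by linarith)).trans hle)
  obtain ⟨hint, hintval⟩ := integral_sum_kernelMajorant hβ (s : ℂ) G.roots
  have hI : ‖∫ ζ, cutoff ζ * dbar (quotientExt G H (p ^ (2 * j))) ζ / (ζ - s)‖ ≤
      B * p * (G.natDegree * (2 * J)) := by
    have hae : ∀ᵐ ζ : ℂ, ζ ∉ (insert (s : ℂ) (G.roots.toFinset : Set ℂ)) :=
      measure_eq_zero_iff_ae_notMem.1 ((G.roots.toFinset.finite_toSet.insert _).measure_zero _)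
    refine (norm_integral_le_of_norm_le (hint.const_mul (B * p)) ?_).trans ?_
    · filter_upwards [hae] with ζ hζ
      simp only [mem_insert_iff, Finset.mem_coe, Multiset.mem_toFinset, not_or] at hζ
      by_cases hζ2 : ‖ζ‖ ≤ 2
      · have hdb := norm_dbar_quotientExt_le hj hp hp1 hK hK₁ (hG ζ (by linarith))
          (norm_eval_derivative_le hG hζ2) (hP ζ hζ2) hζ.2
        have hpos : 0 < ‖ζ - s‖ := norm_pos_iff.2 (sub_ne_zero.2 hζ.1)
        rw [norm_div, norm_mul, div_eq_mul_inv]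
        calc ‖cutoff ζ‖ * ‖dbar (quotientExt G H (p ^ (2 * j))) ζ‖ * ‖ζ - s‖⁻¹
            ≤ 1 * (B * p * (G.roots.map fun w => ‖ζ - w‖ ^ (-(1 - 1 / (2 * j : ℝ)))).sum) *
              ‖ζ - s‖⁻¹ := by
              have := norm_cutoff_le ζ
              gcongr
          _ = B * p * (G.roots.map fun w =>
                ‖ζ - w‖ ^ (-(1 - 1 / (2 * j : ℝ))) * ‖ζ - s‖⁻¹).sum := by
              rw [Multiset.sum_map_mul_right]; ring
          _ ≤ _ := by
              refine mul_le_mul_of_nonneg_left (Multiset.sum_map_le_sum_map _ _ fun w hw => ?_)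
                (by positivity)
              have hw' : 0 < ‖ζ - w‖ :=
                norm_pos_iff.2 (sub_ne_zero.2 fun h => hζ.2 (h ▸ hw))
              exact (rpow_mul_inv_le hw' hpos (by linarith)).trans (add_le_add
                (rpow_le_kernelMajorant (by linarith) hζ2) (rpow_le_kernelMajorant (by linarith) hζ2))
      · rw [cutoff_eq_zero (not_le.1 hζ2).le, zero_mul, zero_div, norm_zero]
        refine mul_nonneg (by positivity) (Multiset.sum_nonneg ?_)
        simp only [Multiset.mem_map]
        rintro _ ⟨w, -, rfl⟩
        exact add_nonneg (kernelMajorant_nonneg _ _ _) (kernelMajorant_nonneg _ _ _)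
    · rw [integral_const_mul, hintval]
      have : (G.roots.card : ℝ) ≤ G.natDegree := by exact_mod_cast G.card_roots'
      gcongr
  have hpi : ‖-(1 / (Real.pi : ℂ))‖ = 1 / Real.pi := by
    rw [norm_neg, norm_div, norm_one, Complex.norm_real, Real.norm_of_nonneg Real.pi_pos.le]
  calc ‖φ s - F s‖ = ‖(φ s - quotientExt G H (p ^ (2 * j)) s) +
        (quotientExt G H (p ^ (2 * j)) s - F s)‖ := by congr 1; ring
    _ ≤ _ := norm_add_le _ _
    _ ≤ (1 + K) * (1 + 2 * K) * p + 1 / Real.pi * (B * p * (G.natDegree * (2 * J))) := by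
        refine add_le_add hu ?_
        rw [hFu s (by linarith), norm_mul, hpi]
        gcongr
    _ ≤ _ := by
        have e1 : 0 ≤ L * B * ((G.natDegree + 1) * p) := by positivity
        have e2 : 0 ≤ (1 + K) * (1 + 2 * K) * (G.natDegree * p) := by positivity
        have e3 : 0 ≤ 1 / Real.pi * B * (2 * J) * p := by positivity
        linarith

end ApproximateRoot

section Taylor

theorem norm_sub_taylor_le_of_nonneg (d : ℕ) {a Q : ℝ} {u : ℕ → ℝ → ℂ}
    (hu : ∀ k t, 0 ≤ t → t ≤ a → HasDerivAt (u k) (u (k + 1) t) t)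
    (hQ : ∀ t, 0 ≤ t → t ≤ a → ‖u d t‖ ≤ Q) {t : ℝ} (ht0 : 0 ≤ t) (ht : t ≤ a) :
    ‖u 0 t - ∑ i ∈ Finset.range d, u i 0 * (t ^ i / i.factorial : ℝ)‖ ≤
      Q * (t ^ d / d.factorial) := by
  induction d generalizing u t with
  | zero => simpa using hQ t ht0 ht
  | succ d ih =>
    have ih' := fun t ht0 ht => ih (u := fun k => u (k + 1)) (fun k => hu (k + 1)) hQ (t := t) ht0 ht
    have hpow : ∀ (i : ℕ) (t : ℝ), HasDerivAt (fun t : ℝ => t ^ (i + 1) / (i + 1).factorial)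
        (t ^ i / i.factorial) t := fun i t => by
      refine ((hasDerivAt_pow (i + 1) t).div_const ((i + 1).factorial : ℝ)).congr_deriv ?_
      rw [Nat.factorial_succ]
      push_cast
      field_simp
    have hder : ∀ t, 0 ≤ t → t ≤ a → HasDerivAt
        (fun t => u 0 t - ∑ i ∈ Finset.range (d + 1), u i 0 * (t ^ i / i.factorial : ℝ))
        (u 1 t - ∑ i ∈ Finset.range d, u (i + 1) 0 * (t ^ i / i.factorial : ℝ)) t := by
      intro t h0 h1
      simp only [Finset.sum_range_succ']
      have := (hu 0 t h0 h1).fun_sub ((HasDerivAt.fun_sum (u := Finset.range d) fun i _ =>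
        ((hpow i t).ofReal_comp.const_mul (u (i + 1) 0))).add_const
          (u 0 0 * ((t ^ 0 / (0 : ℕ).factorial : ℝ) : ℂ)))
      simpa using this
    refine image_norm_le_of_norm_deriv_right_le_deriv_boundary (a := 0) (b := a)
      (fun s hs => (hder s hs.1 hs.2).continuousAt.continuousWithinAt)
      (fun s hs => (hder s hs.1 hs.2.le).hasDerivWithinAt)
      (B := fun t => Q * (t ^ (d + 1) / (d + 1).factorial)) ?_
      (fun s => (hpow d s).const_mul Q) (fun s hs => ih' s hs.1 hs.2.le) ⟨ht0, ht⟩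
    simp [Finset.sum_range_succ']

theorem norm_sub_taylor_le (d : ℕ) {a Q : ℝ} {u : ℕ → ℝ → ℂ}
    (hu : ∀ k t, |t| ≤ a → HasDerivAt (u k) (u (k + 1) t) t)
    (hQ : ∀ t, |t| ≤ a → ‖u d t‖ ≤ Q) {t : ℝ} (ht : |t| ≤ a) :
    ‖u 0 t - ∑ i ∈ Finset.range d, u i 0 * (t ^ i / i.factorial : ℝ)‖ ≤
      Q * (|t| ^ d / d.factorial) := by
  rcases le_total 0 t with h0 | h0
  · rw [abs_of_nonneg h0] at ht ⊢
    refine norm_sub_taylor_le_of_nonneg d (fun k t h1 h2 => hu k t ?_) (fun t h1 h2 => hQ t ?_) h0 ht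
      <;> rwa [abs_of_nonneg h1]
  · rw [abs_of_nonpos h0] at ht ⊢
    have := norm_sub_taylor_le_of_nonneg d (u := fun k t => (-1) ^ k * u k (-t)) (a := a) (Q := Q)
      (t := -t) (fun k t h1 h2 => ?_) (fun t h1 h2 => ?_) (by linarith) ht
    · convert this using 3
      · simp
      · refine Finset.sum_congr rfl fun i _ => ?_
        have : (-t) ^ i = (-1) ^ i * t ^ i := by rw [neg_pow]
        rw [this]
        push_cast
        have h1 : ((-1 : ℂ) ^ i) * (-1) ^ i = 1 := by rw [← mul_pow]; simp
        simp only [neg_zero]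
        linear_combination (-(u i 0 * (t ^ i / i.factorial)) : ℂ) * h1
    · have := (hu k (-t) (by rwa [abs_neg, abs_of_nonneg h1])).scomp t (hasDerivAt_neg t)
      refine (this.const_mul ((-1 : ℂ) ^ k)).congr_deriv ?_
      rw [pow_succ]; simp
    · simpa using hQ (-t) (by rwa [abs_neg, abs_of_nonneg h1])

end Taylor

section Line

variable {E : Type*} [NormedAddCommGroup E] [NormedSpace ℝ E]

theorem hasDerivAt_iteratedFDeriv_line {g : E → ℂ} {x v : E} {t : ℝ} (k : ℕ)
    (hg : ContDiffAt ℝ (⊤ : ℕ∞) g (x + t • v)) :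
    HasDerivAt (fun t : ℝ => iteratedFDeriv ℝ k g (x + t • v) fun _ => v)
      (iteratedFDeriv ℝ (k + 1) g (x + t • v) fun _ => v) t := by
  have h1 : HasFDerivAt (iteratedFDeriv ℝ k g) (fderiv ℝ (iteratedFDeriv ℝ k g) (x + t • v))
      (x + t • v) := by
    refine DifferentiableAt.hasFDerivAt ?_
    exact hg.differentiableAt_iteratedFDeriv (by exact_mod_cast WithTop.coe_lt_top k)
  have h2 : HasDerivAt (fun t : ℝ => x + t • v) v t := by
    simpa using ((hasDerivAt_id t).smul_const v).const_add x
  have h3 := h1.comp_hasDerivAt t h2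
  have h4 := ((ContinuousMultilinearMap.apply ℝ (fun _ : Fin k => E) ℂ fun _ => v).hasFDerivAt).comp_hasDerivAt t h3
  simpa [Function.comp_def, iteratedFDeriv_succ_apply_left, Fin.tail_def] using h4

theorem iterate_fwdDiff_line (f : E → ℂ) (x v : E) (s : ℝ) (n : ℕ) :
    (fwdDiff s)^[n] (fun t : ℝ => f (x + t • v)) 0 = (fwdDiff (s • v))^[n] f x := by
  rw [fwdDiff_iter_eq_sum_shift, fwdDiff_iter_eq_sum_shift]
  refine Finset.sum_congr rfl fun k _ => ?_
  simp [mul_smul, Nat.cast_smul_eq_nsmul]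

end Line

section Scale

open Polynomial

theorem exists_polynomial_approx {M : ℕ → ℝ} (hM : ∀ k, 0 < M k) {C ρ r ε T : ℝ} (hC : 0 ≤ C)
    (hρ : 0 < ρ) (hε : 0 < ε) (hεr : 8 * ε ≤ r) {Q d : ℕ} (hQ : 1 ≤ Q) (hT : T = 8 * ρ * 2 ^ Q)
    {a : ℕ → ℝ → ℂ} (ha : ∀ k t, |t| ≤ r → HasDerivAt (a k) (a (k + 1) t) t)
    (hab : ∀ k t, |t| ≤ r → ‖a k t‖ ≤ C * ρ ^ k * M k)
    (hd : ∀ i ≤ d, lc M i * (T * ε) ^ i ≤ 1) :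
    ∃ G : ℂ[X], G.natDegree ≤ d ∧ (∀ z : ℂ, ‖z‖ ≤ 8 → ‖G.eval z‖ ≤ 2 * C) ∧
      ∀ s : ℝ, |s| ≤ 8 → ‖a 0 (ε * s) - G.eval (s : ℂ)‖ ≤
        C * (((2 : ℝ) ^ d)⁻¹ ^ Q * (lc M d * (T * ε) ^ d)) := by
  have hr : 0 ≤ r := by linarith
  have hscale : ∀ i : ℕ, ρ ^ i * M i * ((8 * ε) ^ i / i.factorial) =
      ((2 : ℝ) ^ i)⁻¹ ^ Q * (lc M i * (T * ε) ^ i) := fun i => by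
    have h2 : ((2 : ℝ) ^ i)⁻¹ ^ Q * (2 ^ Q) ^ i = 1 := by
      rw [inv_pow, ← pow_mul, ← pow_mul, mul_comm Q i, inv_mul_cancel₀ (by positivity)]
    rw [hT, lc]
    calc _ = ρ ^ i * M i * ((8 * ε) ^ i / i.factorial) * 1 := (mul_one _).symm
      _ = _ := by
        rw [← h2, mul_pow (8 * ρ * 2 ^ Q), mul_pow (8 * ρ), mul_pow 8 ρ, mul_pow 8 ε]
        ring
  refine ⟨∑ i ∈ Finset.range d, Polynomial.C (a i 0 * (ε ^ i / i.factorial : ℝ)) * X ^ i,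
    natDegree_sum_le_of_forall_le _ _ fun i hi =>
      (natDegree_C_mul_X_pow_le _ _).trans (Finset.mem_range.1 hi).le, fun z hz => ?_, fun s hs => ?_⟩
  · rw [eval_finsetSum]
    calc _ ≤ ∑ i ∈ Finset.range d, C * ((1 : ℝ) / 2) ^ i := by
          refine norm_sum_le_of_le _ fun i hi => ?_
          rw [eval_mul, eval_C, eval_pow, eval_X, norm_mul, norm_mul, norm_pow, Complex.norm_real,
            Real.norm_of_nonneg (by positivity)]
          have h1 := hd i (Finset.mem_range.1 hi).le
          have h2 : ((2 : ℝ) ^ i)⁻¹ ^ Q ≤ ((1 : ℝ) / 2) ^ i := by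
            rw [one_div, inv_pow (2 : ℝ) i]
            exact pow_le_of_le_one (by positivity)
              (inv_le_one_of_one_le₀ (one_le_pow₀ one_le_two)) (by omega)
          calc ‖a i 0‖ * (ε ^ i / i.factorial) * ‖z‖ ^ i
              ≤ (C * ρ ^ i * M i) * (ε ^ i / i.factorial) * 8 ^ i := by
                have := hab i 0 (by simpa using hr)
                have := (hM i).le
                gcongr
            _ = C * (ρ ^ i * M i * ((8 * ε) ^ i / i.factorial)) := by rw [mul_pow]; ring
            _ = C * (((2 : ℝ) ^ i)⁻¹ ^ Q * (lc M i * (T * ε) ^ i)) := by rw [hscale]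
            _ ≤ C * (((1 : ℝ) / 2) ^ i * 1) := by
                have : 0 ≤ lc M i * (T * ε) ^ i := by
                  have := (hM i).le
                  rw [hT, lc]; positivity
                gcongr
            _ = _ := by ring
      _ = C * ∑ i ∈ Finset.range d, ((1 : ℝ) / 2) ^ i := by rw [Finset.mul_sum]
      _ ≤ C * 2 := by gcongr; exact sum_geometric_two_le d
      _ = _ := by ring
  · have ht : |ε * s| ≤ 8 * ε := by
      rw [abs_mul, abs_of_pos hε]; nlinarith
    have := norm_sub_taylor_le d ha (hab d) (ht.trans hεr)
    rw [eval_finsetSum]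
    have hsum : ∑ i ∈ Finset.range d, a i 0 * ((ε * s) ^ i / i.factorial : ℝ) =
        ∑ i ∈ Finset.range d, (Polynomial.C (a i 0 * (ε ^ i / i.factorial : ℝ)) * X ^ i).eval (s : ℂ) := by
      refine Finset.sum_congr rfl fun i _ => ?_
      simp only [eval_mul, eval_C, eval_pow, eval_X]
      push_cast
      ring
    rw [← hsum]
    refine this.trans ?_
    rw [← hscale]
    have hMd := (hM d).le
    calc C * ρ ^ d * M d * (|ε * s| ^ d / d.factorial)
        ≤ C * ρ ^ d * M d * ((8 * ε) ^ d / d.factorial) := by gcongr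
      _ = _ := by ring

/-- At every scale a function with two consecutive powers in a Denjoy–Carleman class is close to a
bounded holomorphic function. -/
theorem RAdmissible.exists_scale_approx {W : Set (ℕ → ℝ)} (hW : RAdmissible W) {M : ℕ → ℝ}
    (hM : M ∈ W) {j : ℕ} (hj : 1 ≤ j) {C ρ : ℝ} (hC : 1 ≤ C) (hρ : 0 < ρ) :
    ∃ N ∈ W, ∃ A : ℝ, 1 ≤ A ∧ ∃ K > 0, ∀ (φ : ℝ → ℂ) (a b : ℕ → ℝ → ℂ) (r : ℝ),
      (∀ t, a 0 t = φ t ^ j) → (∀ t, b 0 t = φ t ^ (j + 1)) →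
      (∀ k t, |t| ≤ r → HasDerivAt (a k) (a (k + 1) t) t) →
      (∀ k t, |t| ≤ r → HasDerivAt (b k) (b (k + 1) t) t) →
      (∀ k t, |t| ≤ r → ‖a k t‖ ≤ C * ρ ^ k * M k) →
      (∀ k t, |t| ≤ r → ‖b k t‖ ≤ C * ρ ^ k * M k) →
      ∀ ε, 0 < ε → 8 * ε ≤ r → ∃ F : ℂ → ℂ, DifferentiableOn ℂ F (ball 0 ε) ∧
        (∀ z, ‖z‖ < ε / 2 → ‖F z‖ ≤ K) ∧
        ∀ s : ℝ, |s| < ε / 2 → ∀ k, ‖φ s - F s‖ ≤ K * (lc N k * (A * ε) ^ k) ^ 4 := by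
  obtain ⟨P, hP⟩ : ∃ P : ℕ, 16 * j ^ 2 ≤ 2 ^ P := ⟨16 * j ^ 2, Nat.lt_two_pow_self.le⟩
  set Q : ℕ := 2 ^ P with hQdef
  have hQ : 1 ≤ Q := Nat.one_le_two_pow
  obtain ⟨N, hN, A, hA, htr⟩ := hW.exists_truncation_bounds (P + 2) hM
  obtain ⟨K, hK, hroot⟩ := exists_holomorphic_approx hj (K := 2 * C) (by linarith)
  have hw := hW.matrix.weight M hM
  have hwN := hW.matrix.weight N hN
  set T : ℝ := 8 * ρ * 2 ^ Q with hT
  have hT0 : 0 < T := by positivity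
  refine ⟨N, hN, A * (T + 1), by nlinarith, K, hK, fun φ a b r ha0 hb0 ha hb hab hbb ε hε hεr => ?_⟩
  obtain ⟨d, hd1, hd2⟩ := htr (T * ε) (by positivity)
  obtain ⟨G, hGd, hGb, hGa⟩ := exists_polynomial_approx hw.pos (by linarith) hρ hε hεr hQ hT ha hab hd1
  obtain ⟨H, -, hHb, hHa⟩ := exists_polynomial_approx hw.pos (by linarith) hρ hε hεr hQ hT hb hbb hd1
  set μ : ℝ := lc M d * (T * ε) ^ d with hμ
  have hμ0 : 0 < μ := mul_pos (lc_pos hw d) (by positivity)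
  have hμ1 : μ ≤ 1 := hd1 d le_rfl
  set ν : ℝ := μ ^ ((Q : ℝ)⁻¹) with hν
  have hν0 : 0 < ν := by positivity
  have hν1 : ν ≤ 1 := Real.rpow_le_one hμ0.le hμ1 (by positivity)
  have hνQ : ν ^ Q = μ := Real.rpow_inv_natCast_pow hμ0.le (by omega)
  have h2d : ((2 : ℝ) ^ d)⁻¹ ≤ 1 := inv_le_one_of_one_le₀ (one_le_pow₀ one_le_two)
  set p : ℝ := ((2 : ℝ) ^ d)⁻¹ * ν with hp
  have hp0 : 0 < p := by positivity
  have hp1 : p ≤ 1 := mul_le_one₀ h2d hν0.le hν1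
  have hpQ : ((2 : ℝ) ^ d)⁻¹ ^ Q * μ ≤ p ^ (16 * j ^ 2) := by
    rw [← hνQ, ← mul_pow]
    exact pow_le_pow_of_le_one hp0.le hp1 hP
  have herr : C * (((2 : ℝ) ^ d)⁻¹ ^ Q * μ) ≤ 2 * C * p ^ (16 * j ^ 2) := by
    have : 0 ≤ C * p ^ (16 * j ^ 2) := by positivity
    nlinarith
  obtain ⟨F, hF, hFb, hFa⟩ := hroot G H (fun s => φ (ε * s)) p hp0 hp1 hGb hHb
    (fun s hs => by rw [← ha0]; exact (hGa s hs).trans herr)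
    (fun s hs => by rw [← hb0]; exact (hHa s hs).trans herr)
  refine ⟨fun z => F (z / ε), ?_, fun z hz => hFb _ ?_, fun s hs k => ?_⟩
  · refine hF.comp (differentiableOn_id.div_const _) fun z hz => ?_
    rw [mem_ball_zero_iff] at hz ⊢
    rw [norm_div, Complex.norm_real, Real.norm_of_nonneg hε.le]
    exact (div_lt_one hε).2 hz
  · rw [norm_div, Complex.norm_real, Real.norm_of_nonneg hε.le, div_lt_iff₀ hε]
    linarith
  · have h1 := hFa (s / ε) (by rw [abs_div, abs_of_pos hε, div_lt_iff₀ hε]; linarith)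
    rw [mul_div_cancel₀ _ hε.ne'] at h1
    push_cast at h1
    refine h1.trans ?_
    gcongr
    have h2 : ((G.natDegree : ℝ) + 1) * ((2 : ℝ) ^ d)⁻¹ ≤ 1 := by
      rw [← div_eq_mul_inv, div_le_one (by positivity)]
      have : G.natDegree + 1 ≤ 2 ^ d := (Nat.succ_le_succ hGd).trans Nat.lt_two_pow_self
      exact_mod_cast this
    have hlc := lc_pos hwN k
    have h3 : ν ≤ (lc N k * (A * (T * ε)) ^ k) ^ 4 := by
      refine (pow_le_pow_iff_left₀ hν0.le (by positivity) (by omega : Q ≠ 0)).1 ?_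
      rw [hνQ, ← pow_mul, show 4 * Q = 2 ^ (P + 2) by rw [hQdef, pow_add]; ring]
      exact hd2 k
    calc ((G.natDegree : ℝ) + 1) * p = ((G.natDegree : ℝ) + 1) * ((2 : ℝ) ^ d)⁻¹ * ν := by
          rw [hp]; ring
      _ ≤ 1 * ν := by gcongr
      _ ≤ (lc N k * (A * (T * ε)) ^ k) ^ 4 := by rw [one_mul]; exact h3
      _ ≤ _ := by
          have : A * (T * ε) ≤ A * (T + 1) * ε := by
            have : 0 ≤ A * ε := by positivity
            nlinarith
          gcongr

end Scale

section MultiScale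

theorem exists_dyadic_scale {ε τ : ℝ} (hτ : 0 < τ) (h : τ ≤ ε) :
    ∃ i : ℕ, τ ≤ ε / 2 ^ i ∧ ε / 2 ^ i < 2 * τ := by
  have hε : 0 < ε := hτ.trans_le h
  have hex : ∃ i : ℕ, ε / 2 ^ i < 2 * τ := by
    obtain ⟨i, hi⟩ := pow_unbounded_of_one_lt (ε / (2 * τ)) (one_lt_two (α := ℝ))
    refine ⟨i, ?_⟩
    rw [div_lt_iff₀ (by positivity)] at hi ⊢
    linarith
  classical
  refine ⟨Nat.find hex, ?_, Nat.find_spec hex⟩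
  rcases hi : Nat.find hex with _ | i
  · simpa using h
  · have := Nat.find_min hex (m := i) (by omega)
    rw [pow_succ, ← div_div]
    linarith

/-- Consecutive holomorphic approximations are close to each other on a smaller disc. -/
theorem norm_sub_le_of_approx {φ : ℝ → ℂ} {F₁ F₂ : ℂ → ℂ} {ε K q : ℝ} (hε : 0 < ε)
    (hq : 0 < q) (hq1 : q ≤ 1)
    (hF₁ : DifferentiableOn ℂ F₁ (ball 0 ε)) (hF₂ : DifferentiableOn ℂ F₂ (ball 0 (ε / 2)))
    (hb₁ : ∀ z, ‖z‖ < ε / 2 → ‖F₁ z‖ ≤ K) (hb₂ : ∀ z, ‖z‖ < ε / 2 / 2 → ‖F₂ z‖ ≤ K)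
    (ha₁ : ∀ s : ℝ, |s| < ε / 2 → ‖φ s - F₁ s‖ ≤ K * q ^ 4)
    (ha₂ : ∀ s : ℝ, |s| < ε / 2 / 2 → ‖φ s - F₂ s‖ ≤ K * q ^ 4)
    {z : ℂ} (hz : ‖z‖ ≤ ε / 32) : ‖F₂ z - F₁ z‖ ≤ 2 * K * q := by
  refine norm_le_of_norm_le_real (P := fun z => F₂ z - F₁ z) (R := ε / 8) (by positivity) hq hq1 ?_
    (fun z hz => ?_) (fun s hs => ?_) (by linarith)
  · refine DifferentiableOn.diffContOnCl ?_
    refine ((hF₂.mono ?_).sub (hF₁.mono ?_)) <;>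
    · refine closure_ball_subset_closedBall.trans (closedBall_subset_ball ?_)
      linarith
  · refine (norm_sub_le _ _).trans ?_
    linarith [hb₁ z (by linarith), hb₂ z (by linarith)]
  · have h1 := ha₁ s (by linarith)
    have h2 := ha₂ s (by linarith)
    calc ‖F₂ s - F₁ s‖ = ‖(φ s - F₁ s) - (φ s - F₂ s)‖ := by congr 1; ring
      _ ≤ _ := norm_sub_le _ _
      _ ≤ _ := by linarith

theorem norm_iterate_fwdDiff_le_of_scales {m : ℕ → ℝ} (hm0 : m 0 = 1) (hm : ∀ k, 0 < m k)
    {A K ε : ℝ} (hA : 1 ≤ A) (hK : 0 < K) (hε : 0 < ε) {φ : ℝ → ℂ} {F : ℕ → ℂ → ℂ}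
    (hF : ∀ i, DifferentiableOn ℂ (F i) (ball 0 (ε / 2 ^ i)))
    (hFb : ∀ i z, ‖z‖ < ε / 2 ^ i / 2 → ‖F i z‖ ≤ K)
    (hFa : ∀ i (s : ℝ), |s| < ε / 2 ^ i / 2 →
      ∀ k, ‖φ s - F i s‖ ≤ K * (m k * (A * (ε / 2 ^ i)) ^ k) ^ 4)
    {n : ℕ} (hn : 1 ≤ n) {s : ℝ} (hs : 0 < s) (hns : n * s ≤ ε / 128) :
    ‖(fwdDiff s)^[n] φ 0‖ ≤ (K * (1536 * A) ^ n * (m n * n.factorial) +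
      K * (24 / ε) ^ n * n.factorial +
        4 * K * A * ε * (384 * A) ^ n * (m (n + 1) * n.factorial)) * s ^ n := by
  have hn0 : (0 : ℝ) < n := by exact_mod_cast hn
  obtain ⟨i₀, hi1, hi2⟩ := exists_dyadic_scale (ε := ε) (τ := 128 * (n * s)) (by positivity)
    (by linarith)
  have hεi : ∀ i : ℕ, 0 < ε / 2 ^ i := fun i => by positivity
  set q : ℕ → ℕ → ℝ := fun k i => min 1 (m k * (A * (ε / 2 ^ i)) ^ k) with hq
  have hq0 : ∀ k i, 0 < q k i := fun k i => by
    have := hm k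
    have := hεi i
    simp only [hq]
    positivity
  have hq1 : ∀ k i, q k i ≤ 1 := fun k i => min_le_left _ _
  have hqa : ∀ k i (s : ℝ), |s| < ε / 2 ^ i / 2 → ‖φ s - F i s‖ ≤ K * q k i ^ 4 := by
    intro k i s hs
    rcases min_choice 1 (m k * (A * (ε / 2 ^ i)) ^ k) with h | h
    · simp only [hq, h]
      simpa [hm0] using hFa i s hs 0
    · simp only [hq, h]
      exact hFa i s hs k
  have hqs : ∀ k i, q k (i + 1) ≤ q k i := fun k i => by
    have := hm k
    simp only [hq]
    gcongr
    · norm_num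
    · omega
  have hdecomp : φ = (fun t : ℝ => φ t - F i₀ t) + (fun t : ℝ => F 0 t) +
      ∑ i ∈ Finset.range i₀, fun t : ℝ => F (i + 1) t - F i t := by
    ext t
    simp only [Pi.add_apply, Finset.sum_apply]
    rw [Finset.sum_range_sub (fun i => F i (t : ℂ))]
    ring
  have hT1 : ‖(fwdDiff s)^[n] (fun t : ℝ => φ t - F i₀ t) 0‖ ≤
      K * (1536 * A) ^ n * (m n * n.factorial) * s ^ n := by
    have hmn := hm n
    have h1 : ∀ k ≤ n, ‖φ (k * s) - F i₀ ((k * s : ℝ) : ℂ)‖ ≤ K * (m n * (A * (ε / 2 ^ i₀)) ^ n) := by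
      intro k hk
      have hks : (k : ℝ) * s ≤ n * s := by gcongr
      refine (hqa n i₀ (k * s) ?_).trans ?_
      · rw [abs_of_nonneg (by positivity)]
        nlinarith
      · have : q n i₀ ^ 4 ≤ q n i₀ := pow_le_of_le_one (hq0 _ _).le (hq1 _ _) (by norm_num)
        gcongr
        exact this.trans (min_le_right _ _)
    refine (norm_iterate_fwdDiff_le n h1).trans ?_
    calc (2 : ℝ) ^ n * (K * (m n * (A * (ε / 2 ^ i₀)) ^ n))
        ≤ 2 ^ n * (K * (m n * (A * (2 * (128 * (n * s)))) ^ n)) := by gcongr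
      _ = K * m n * (512 * A) ^ n * s ^ n * n ^ n := by
          rw [show A * (2 * (128 * (n * s))) = 256 * A * s * n by ring, mul_pow _ (n : ℝ),
            mul_pow _ s, show 512 * A = 2 * (256 * A) by ring, mul_pow 2]
          ring
      _ ≤ K * m n * (512 * A) ^ n * s ^ n * (3 ^ n * n.factorial) := by
          gcongr
          exact natCast_pow_self_le n
      _ = _ := by
          rw [show 1536 * A = 3 * (512 * A) by ring, mul_pow 3]
          ring
  have hT2 : ‖(fwdDiff s)^[n] (fun t : ℝ => F 0 t) 0‖ ≤
      K * (24 / ε) ^ n * n.factorial * s ^ n := by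
    have := norm_iterate_fwdDiff_le_of_differentiableOn (F := F 0) (R := ε / 2) (Q := K)
      (by positivity) hs.le ((hF 0).mono (ball_subset_ball (by simp; linarith)))
      (fun z hz => hFb 0 z (by simpa using hz)) hn (by linarith)
    rwa [show 12 / (ε / 2) = 24 / ε by field_simp; norm_num] at this
  have hT3 : ∀ i ∈ Finset.range i₀, ‖(fwdDiff s)^[n] (fun t : ℝ => F (i + 1) t - F i t) 0‖ ≤
      2 * K * A * ε * (384 * A) ^ n * (m (n + 1) * n.factorial) * s ^ n * (1 / 2) ^ i := by
    intro i hi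
    have hi' := (Finset.mem_range.1 hi).le
    have hmn := hm (n + 1)
    have hle : ε / 2 ^ i₀ ≤ ε / 2 ^ i := by gcongr; norm_num
    have hhalf : ε / 2 ^ (i + 1) = ε / 2 ^ i / 2 := by rw [pow_succ, div_div]
    have hsmall : ∀ z ∈ ball (0 : ℂ) (ε / 2 ^ i / 32),
        ‖F (i + 1) z - F i z‖ ≤ 2 * K * q (n + 1) i := by
      intro z hz
      refine norm_sub_le_of_approx (φ := φ) (hεi i) (hq0 _ _) (hq1 _ _) (hF i)
        (by rw [← hhalf]; exact hF (i + 1)) (hFb i) (by rw [← hhalf]; exact hFb (i + 1))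
        (hqa (n + 1) i) ?_ (mem_ball_zero_iff.1 hz).le
      rw [← hhalf]
      intro s hs
      refine (hqa (n + 1) (i + 1) s hs).trans ?_
      have := hqs (n + 1) i
      have := (hq0 (n + 1) (i + 1)).le
      gcongr
    have := norm_iterate_fwdDiff_le_of_differentiableOn (F := fun z => F (i + 1) z - F i z)
      (R := ε / 2 ^ i / 32) (by have := hεi i; positivity) hs.le
      (((hF (i + 1)).mono (ball_subset_ball (by rw [hhalf]; linarith [hεi i]))).sub
        ((hF i).mono (ball_subset_ball (by linarith [hεi i])))) hsmall hn (by linarith)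
    refine this.trans ?_
    have hei := hεi i
    calc 2 * K * q (n + 1) i * (12 / (ε / 2 ^ i / 32)) ^ n * n.factorial * s ^ n
        ≤ 2 * K * (m (n + 1) * (A * (ε / 2 ^ i)) ^ (n + 1)) * (12 / (ε / 2 ^ i / 32)) ^ n *
          n.factorial * s ^ n := by
          gcongr
          exact min_le_right _ _
      _ = 2 * K * A * (ε / 2 ^ i) * ((A * (ε / 2 ^ i)) * (12 / (ε / 2 ^ i / 32))) ^ n *
          (m (n + 1) * n.factorial) * s ^ n := by
          rw [mul_pow (A * (ε / 2 ^ i)) (12 / (ε / 2 ^ i / 32)), pow_succ (A * (ε / 2 ^ i))]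
          ring
      _ = _ := by
          rw [show (A * (ε / 2 ^ i)) * (12 / (ε / 2 ^ i / 32)) = 384 * A by
            generalize ε / 2 ^ i = e at hei; field_simp; norm_num, one_div, inv_pow]
          ring
  calc ‖(fwdDiff s)^[n] φ 0‖ = ‖(fwdDiff s)^[n] (fun t : ℝ => φ t - F i₀ t) 0 +
        (fwdDiff s)^[n] (fun t : ℝ => F 0 t) 0 +
        ∑ i ∈ Finset.range i₀, (fwdDiff s)^[n] (fun t : ℝ => F (i + 1) t - F i t) 0‖ := by
        conv_lhs => rw [hdecomp]
        rw [fwdDiff_iter_add, fwdDiff_iter_add, fwdDiff_iter_finsetSum]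
        simp only [Pi.add_apply, Finset.sum_apply]
    _ ≤ _ := norm_add₃_le
    _ ≤ K * (1536 * A) ^ n * (m n * n.factorial) * s ^ n + K * (24 / ε) ^ n * n.factorial * s ^ n +
        ∑ i ∈ Finset.range i₀,
          2 * K * A * ε * (384 * A) ^ n * (m (n + 1) * n.factorial) * s ^ n * (1 / 2) ^ i := by
        exact add_le_add (add_le_add hT1 hT2) (norm_sum_le_of_le _ hT3)
    _ ≤ K * (1536 * A) ^ n * (m n * n.factorial) * s ^ n + K * (24 / ε) ^ n * n.factorial * s ^ n +
          2 * K * A * ε * (384 * A) ^ n * (m (n + 1) * n.factorial) * s ^ n * 2 := by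
        rw [← Finset.mul_sum]
        have hmn := hm (n + 1)
        gcongr
        exact sum_geometric_two_le i₀
    _ = _ := by ring

end MultiScale

section Joris

variable {E : Type*} [NormedAddCommGroup E] [NormedSpace ℝ E]

theorem norm_le_one_add_norm_pow {j : ℕ} (hj : 1 ≤ j) (z : ℂ) : ‖z‖ ≤ 1 + ‖z ^ j‖ := by
  rw [norm_pow]
  rcases le_total ‖z‖ 1 with h | h
  · have : 0 ≤ ‖z‖ ^ j := by positivity
    linarith
  · have := le_self_pow₀ h (by omega : j ≠ 0)
    linarith

theorem norm_iteratedFDeriv_apply_le {g : E → ℂ} {y v : E} (hv : ‖v‖ = 1) (k : ℕ) :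
    ‖iteratedFDeriv ℝ k g y fun _ => v‖ ≤ ‖iteratedFDeriv ℝ k g y‖ := by
  simpa [hv] using (iteratedFDeriv ℝ k g y).le_opNorm fun _ => v

/-- Common local bounds for two functions of the Roumieu class. -/
theorem Roumieu.exists_common_ball_bound {W : Set (ℕ → ℝ)} (hW : IsWeightMatrix W) {U : Set E}
    (hU : IsOpen U) {g h : E → ℂ} (hg : Roumieu W U g) (hh : Roumieu W U h) {x₀ : E} (hx₀ : x₀ ∈ U) :
    ∃ M ∈ W, ∃ ρ > 0, ∃ C, 1 ≤ C ∧ ∃ r > 0, ball x₀ r ⊆ U ∧ ∀ x ∈ ball x₀ r, ∀ k,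
      ‖iteratedFDeriv ℝ k g x‖ ≤ C * ρ ^ k * M k ∧ ‖iteratedFDeriv ℝ k h x‖ ≤ C * ρ ^ k * M k := by
  obtain ⟨M₁, hM₁, ρ₁, hρ₁, C₁, hC₁, r₁, hr₁, hb₁, h₁⟩ := Roumieu.exists_ball_bound hW hU hg hx₀
  obtain ⟨M₂, hM₂, ρ₂, hρ₂, C₂, hC₂, r₂, hr₂, hb₂, h₂⟩ := Roumieu.exists_ball_bound hW hU hh hx₀
  obtain ⟨M, hM, hM1, hM2⟩ : ∃ M ∈ W, (∀ k, M₁ k ≤ M k) ∧ ∀ k, M₂ k ≤ M k := by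
    rcases hW.ordered M₁ hM₁ M₂ hM₂ with h | h
    · exact ⟨M₂, hM₂, h, fun _ => le_rfl⟩
    · exact ⟨M₁, hM₁, fun _ => le_rfl, h⟩
  have hM10 := fun k => ((hW.weight M₁ hM₁).pos k).le
  have hM20 := fun k => ((hW.weight M₂ hM₂).pos k).le
  refine ⟨M, hM, ρ₁ + ρ₂, by positivity, 1 + C₁ + C₂, by linarith, min r₁ r₂, lt_min hr₁ hr₂,
    (ball_subset_ball (min_le_left _ _)).trans hb₁, fun x hx k => ⟨?_, ?_⟩⟩
  · refine (h₁ x (ball_subset_ball (min_le_left _ _) hx) k).trans ?_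
    have := hM10 k
    gcongr
    · linarith
    · linarith
    · exact hM1 k
  · refine (h₂ x (ball_subset_ball (min_le_right _ _) hx) k).trans ?_
    have := hM20 k
    gcongr
    · linarith
    · linarith
    · exact hM2 k

/-- Finite differences of a function along lines, when two consecutive powers of it are in the
Roumieu class. -/
theorem RAdmissible.exists_line_bound {W : Set (ℕ → ℝ)} (hW : RAdmissible W) {U : Set E}
    (hU : IsOpen U) {j : ℕ} (hj : 1 ≤ j) {f : E → ℂ} (h1 : Roumieu W U fun x => f x ^ j)
    (h2 : Roumieu W U fun x => f x ^ (j + 1)) {x₀ : E} (hx₀ : x₀ ∈ U) :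
    ∃ M ∈ W, ∃ ρ > 0, ∃ C > 0, ∃ r > 0, ∀ n, ∃ s > 0, ∀ x y, ‖x - x₀‖ < r → ‖y‖ ≤ s →
      ‖(fwdDiff y)^[n] f x‖ ≤ C * ρ ^ n * M n * ‖y‖ ^ n := by
  obtain ⟨M, hM, ρ, hρ, C, hC, R, hR, hRU, hb⟩ :=
    Roumieu.exists_common_ball_bound hW.matrix hU h1 h2 hx₀
  obtain ⟨N, hN, A, hA, K, hK, hscale⟩ := hW.exists_scale_approx hM hj hC hρ
  obtain ⟨N', hN', B, hB, hshift⟩ := hW.exists_shift_bounds hN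
  have hwN := hW.matrix.weight N hN
  have hwN' := hW.matrix.weight N' hN'
  set ε : ℝ := R / 32 with hε
  have hε0 : 0 < ε := by positivity
  set ρ' : ℝ := (1536 * A + 24 / ε) * B with hρ'
  set C' : ℝ := 1 + C + K + K * B + 4 * K * A * ε * B with hC'
  have hρ'0 : 0 < ρ' := by positivity
  have hKB : 0 < K * B := by positivity
  have hKA : 0 < 4 * K * A * ε * B := by positivity
  refine ⟨N', hN', ρ', hρ'0, C', by positivity, R / 2, by positivity, fun n => ?_⟩
  rcases Nat.eq_zero_or_pos n with rfl | hn
  · refine ⟨1, one_pos, fun x y hx _ => ?_⟩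
    have hfj := (hb x (by rw [mem_ball_iff_norm]; linarith) 0).1
    rw [norm_iteratedFDeriv_zero, (hW.matrix.weight M hM).first] at hfj
    have := norm_le_one_add_norm_pow hj (f x)
    simp only [Function.iterate_zero, id, pow_zero, hwN'.first, mul_one] at hfj ⊢
    linarith
  have hn0 : (0 : ℝ) < n := by exact_mod_cast hn
  refine ⟨ε / (128 * n), by positivity, fun x y hx hy => ?_⟩
  rcases eq_or_ne y 0 with rfl | hy0
  · obtain ⟨i, rfl⟩ : ∃ i, n = i + 1 := ⟨n - 1, by omega⟩
    rw [Function.iterate_succ_apply']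
    simp [fwdDiff]
  have hs0 : 0 < ‖y‖ := norm_pos_iff.2 hy0
  set s : ℝ := ‖y‖ with hs
  set v : E := s⁻¹ • y with hv
  have hv1 : ‖v‖ = 1 := by
    rw [hv, norm_smul, norm_inv, norm_norm, ← hs, inv_mul_cancel₀ hs0.ne']
  have hsv : s • v = y := by rw [hv, smul_inv_smul₀ hs0.ne']
  have hmem : ∀ t : ℝ, |t| ≤ R / 4 → x + t • v ∈ ball x₀ R := fun t ht => by
    rw [mem_ball_iff_norm, show x + t • v - x₀ = (x - x₀) + t • v by abel]
    refine (norm_add_le _ _).trans_lt ?_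
    rw [norm_smul, hv1, mul_one, Real.norm_eq_abs]
    linarith
  have hsmooth : ∀ {g : E → ℂ}, ContDiffOn ℝ (⊤ : ℕ∞) g U → ∀ t : ℝ, |t| ≤ R / 4 →
      ContDiffAt ℝ (⊤ : ℕ∞) g (x + t • v) := fun hg t ht =>
    hg.contDiffAt (hU.mem_nhds (hRU (hmem t ht)))
  have happrox := hscale (fun t => f (x + t • v))
    (fun k t => iteratedFDeriv ℝ k (fun x => f x ^ j) (x + t • v) fun _ => v)
    (fun k t => iteratedFDeriv ℝ k (fun x => f x ^ (j + 1)) (x + t • v) fun _ => v) (R / 4)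
    (fun t => by simp) (fun t => by simp)
    (fun k t ht => hasDerivAt_iteratedFDeriv_line k (hsmooth h1.1 t ht))
    (fun k t ht => hasDerivAt_iteratedFDeriv_line k (hsmooth h2.1 t ht))
    (fun k t ht => (norm_iteratedFDeriv_apply_le hv1 k).trans (hb _ (hmem t ht) k).1)
    (fun k t ht => (norm_iteratedFDeriv_apply_le hv1 k).trans (hb _ (hmem t ht) k).2)
  choose F hF hFb hFa using fun i : ℕ => happrox (ε / 2 ^ i) (by positivity) (by
    have : ε / 2 ^ i ≤ ε := div_le_self hε0.le (one_le_pow₀ one_le_two)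
    linarith)
  have hns : n * s ≤ ε / 128 := by
    rw [le_div_iff₀ (by positivity)] at hy ⊢
    linarith
  have hmain := norm_iterate_fwdDiff_le_of_scales (m := lc N) (by simp [lc, hwN.first])
    (lc_pos hwN) hA hK hε0 hF hFb hFa hn hs0 hns
  rw [iterate_fwdDiff_line, hsv] at hmain
  refine hmain.trans ?_
  gcongr
  obtain ⟨hsh1, hsh2, hsh3⟩ := hshift n
  have hN'n := hwN'.pos n
  have hNn := hwN.pos n
  have hNn1 := hwN.pos (n + 1)
  have e1 : lc N n * n.factorial = N n := by rw [lc]; field_simp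
  have e2 : lc N (n + 1) * n.factorial ≤ N (n + 1) := by
    rw [lc, div_mul_eq_mul_div, div_le_iff₀ (by positivity)]
    gcongr
    omega
  have hp : ∀ c, 0 ≤ c → c ≤ 1536 * A + 24 / ε → c ^ n * B ^ n ≤ ρ' ^ n := fun c hc0 hc => by
    rw [hρ', ← mul_pow]
    gcongr
  have hε24 : 0 < 24 / ε := by positivity
  have p1 := hp (1536 * A) (by positivity) (by linarith)
  have p2 := hp (24 / ε) (by positivity) (by linarith)
  have p3 := hp (384 * A) (by positivity) (by linarith)
  calc K * (1536 * A) ^ n * (lc N n * n.factorial) + K * (24 / ε) ^ n * n.factorial +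
        4 * K * A * ε * (384 * A) ^ n * (lc N (n + 1) * n.factorial)
      ≤ K * (1536 * A) ^ n * (B ^ n * N' n) + K * (24 / ε) ^ n * (B * (B ^ n * N' n)) +
        4 * K * A * ε * (384 * A) ^ n * (B ^ (n + 1) * N' n) := by
        rw [e1]
        have e3 := e2.trans hsh2
        refine add_le_add (add_le_add ?_ ?_) (mul_le_mul_of_nonneg_left e3 (by positivity)) <;> gcongr
    _ = K * ((1536 * A) ^ n * B ^ n) * N' n + K * B * ((24 / ε) ^ n * B ^ n) * N' n +
        4 * K * A * ε * B * ((384 * A) ^ n * B ^ n) * N' n := by ring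
    _ ≤ K * ρ' ^ n * N' n + K * B * ρ' ^ n * N' n + 4 * K * A * ε * B * ρ' ^ n * N' n := by gcongr
    _ ≤ (1 + C) * (ρ' ^ n * N' n) + (K * ρ' ^ n * N' n + K * B * ρ' ^ n * N' n +
          4 * K * A * ε * B * ρ' ^ n * N' n) := le_add_of_nonneg_left (by positivity)
    _ = _ := by rw [hC']; ring

end Joris

/-- Joris' theorem for Roumieu classes on a Banach space. -/
theorem statement14 {E : Type*} [NormedAddCommGroup E] [NormedSpace ℝ E] [CompleteSpace E]
    (W : Set (ℕ → ℝ)) (hW : RAdmissible W)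
    (U : Set E) (hU : IsOpen U)
    (j : ℕ) (hj : 1 ≤ j) (f : E → ℂ)
    (h1 : Roumieu W U (fun x => f x ^ j))
    (h2 : Roumieu W U (fun x => f x ^ (j + 1))) :
    Roumieu W U f := by
  obtain ⟨M, hM, -⟩ := h1.2 ∅ (empty_subset U) isCompact_empty
  exact roumieu_of_line_bound hW.matrix ⟨M, hM⟩ hU fun x₀ hx₀ =>
    hW.exists_line_bound hU hj h1 h2 hx₀

end JorisPaper
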